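/- arXiv:2007.03957 — 2 statements merged into one kernel-verified Lean document; each statement's English description precedes it below -/
import Mathlib

section
/- ∫₀¹ (Li₂(−1/x) · Li₂(4x/(1+x)²))/x dx = 24·Li₅(1/2) + 16·Li₄(1/2)·log 2 + π²ζ(3)/2 − 93ζ(5)/4 + (7/2)·ζ(3)·log²2 + (7/15)·log⁵2 − (1/3)·π²·log³2 − (41/360)·π⁴·log 2, where for y ≤ 0 one defines Li₂(y) = −∫₀^y log(1−t)/t dt (the analytic continuation of the dilogarithm to the negative real axis), and for 0 ≤ y ≤ 1, Li₂(y) = ∑_{n≥1} yⁿ/n². -/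
/-- Catalan's constant `C = ∑_{k≥0} (-1)^k/(2k+1)²`. -/
noncomputable def catalanConst : ℝ := ∑' k : ℕ, (-1 : ℝ) ^ k / ((2 * k + 1 : ℕ) : ℝ) ^ 2

/-- `β(4) = ∑_{k≥0} (-1)^k/(2k+1)⁴`. -/
noncomputable def diriBeta4 : ℝ := ∑' k : ℕ, (-1 : ℝ) ^ k / ((2 * k + 1 : ℕ) : ℝ) ^ 4

/-- The real polylogarithm `Li_s(x) = ∑_{n≥1} xⁿ/n^s`. -/
noncomputable def rpolylog (s : ℕ) (x : ℝ) : ℝ :=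
  ∑' n : ℕ, x ^ (n + 1) / ((n + 1 : ℕ) : ℝ) ^ s

/-- The complex polylogarithm `Li_s(z) = ∑_{n≥1} zⁿ/n^s`. -/
noncomputable def cpolylog (s : ℕ) (z : ℂ) : ℂ :=
  ∑' n : ℕ, z ^ (n + 1) / ((n + 1 : ℕ) : ℂ) ^ s

/-- The dilogarithm on the negative real axis, `Li₂(y) = −∫₀^y log(1−t)/t dt` for `y ≤ 0`. -/
noncomputable def dilogNeg (y : ℝ) : ℝ := -∫ t in (0 : ℝ)..y, Real.log (1 - t) / t

namespace DilogIntegral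

open Set Filter Topology MeasureTheory

/-- Functions on `(0,1)` of at most polylogarithmic growth at both endpoints. -/
@[fun_prop]
def LogBdd (F : ℝ → ℝ) : Prop :=
  ContinuousOn F (Ioo 0 1) ∧
    ∃ (C : ℝ) (n : ℕ), ∀ x ∈ Ioo (0 : ℝ) 1, |F x| ≤ C * (1 - Real.log x - Real.log (1 - x)) ^ n

/-- The integral over the unit interval. -/
noncomputable def unitInt (F : ℝ → ℝ) : ℝ := ∫ x in Ioo (0 : ℝ) 1, F x

theorem one_le_weight {x : ℝ} (hx : x ∈ Ioo (0 : ℝ) 1) :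
    1 ≤ 1 - Real.log x - Real.log (1 - x) := by
  have h1 := Real.log_nonpos hx.1.le hx.2.le
  have h2 := Real.log_nonpos (sub_nonneg.2 hx.2.le) (by linarith [hx.1] : 1 - x ≤ 1)
  linarith

namespace LogBdd

@[fun_prop]
theorem const (c : ℝ) : LogBdd (fun _ => c) :=
  ⟨continuousOn_const, |c|, 0, fun x _ => by simp⟩

theorem of_bounded {F : ℝ → ℝ} (hc : ContinuousOn F (Ioo 0 1)) (C : ℝ)
    (h : ∀ x ∈ Ioo (0 : ℝ) 1, |F x| ≤ C) : LogBdd F :=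
  ⟨hc, C, 0, fun x hx => by simpa using h x hx⟩

@[fun_prop]
theorem id' : LogBdd (fun x => x) :=
  of_bounded continuousOn_id 1 fun x hx => abs_le.2 ⟨by linarith [hx.1], hx.2.le⟩

@[fun_prop]
theorem add {F G : ℝ → ℝ} (hF : LogBdd F) (hG : LogBdd G) : LogBdd (fun x => F x + G x) := by
  obtain ⟨cF, C, n, hC⟩ := hF
  obtain ⟨cG, D, k, hD⟩ := hG
  refine ⟨cF.add cG, |C| + |D|, n + k, fun x hx => ?_⟩
  have hw := one_le_weight hx
  refine (abs_add_le _ _).trans ?_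
  rw [add_mul]
  refine add_le_add ((hC x hx).trans ?_) ((hD x hx).trans ?_)
  · refine mul_le_mul (le_abs_self C) (pow_le_pow_right₀ hw (by omega)) (by positivity)
      (by positivity)
  · refine mul_le_mul (le_abs_self D) (pow_le_pow_right₀ hw (by omega)) (by positivity)
      (by positivity)

@[fun_prop]
theorem neg {F : ℝ → ℝ} (hF : LogBdd F) : LogBdd (fun x => -F x) := by
  obtain ⟨cF, C, n, hC⟩ := hF
  exact ⟨cF.neg, C, n, fun x hx => by simpa using hC x hx⟩

@[fun_prop]
theorem sub {F G : ℝ → ℝ} (hF : LogBdd F) (hG : LogBdd G) : LogBdd (fun x => F x - G x) := by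
  simpa [sub_eq_add_neg] using hF.add hG.neg

@[fun_prop]
theorem mul {F G : ℝ → ℝ} (hF : LogBdd F) (hG : LogBdd G) : LogBdd (fun x => F x * G x) := by
  obtain ⟨cF, C, n, hC⟩ := hF
  obtain ⟨cG, D, k, hD⟩ := hG
  refine ⟨cF.mul cG, C * D, n + k, fun x hx => ?_⟩
  rw [abs_mul, pow_add, mul_mul_mul_comm]
  exact mul_le_mul (hC x hx) (hD x hx) (abs_nonneg _) ((abs_nonneg _).trans (hC x hx))

@[fun_prop]
theorem pow {F : ℝ → ℝ} (hF : LogBdd F) (n : ℕ) : LogBdd (fun x => F x ^ n) := by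
  induction n with
  | zero => simpa using const 1
  | succ n ih => simpa only [pow_succ] using ih.mul hF

theorem congr {F G : ℝ → ℝ} (hF : LogBdd F) (h : ∀ x ∈ Ioo (0 : ℝ) 1, G x = F x) : LogBdd G := by
  obtain ⟨cF, C, n, hC⟩ := hF
  exact ⟨cF.congr h, C, n, fun x hx => by rw [h x hx]; exact hC x hx⟩

theorem mono {F G : ℝ → ℝ} (hF : LogBdd F) (hc : ContinuousOn G (Ioo 0 1))
    (h : ∀ x ∈ Ioo (0 : ℝ) 1, |G x| ≤ |F x|) : LogBdd G := by
  obtain ⟨cF, C, n, hC⟩ := hF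
  exact ⟨hc, C, n, fun x hx => (h x hx).trans (hC x hx)⟩

theorem reflect {F : ℝ → ℝ} (hF : LogBdd F) : LogBdd (fun x => F (1 - x)) := by
  obtain ⟨cF, C, n, hC⟩ := hF
  have hmem : ∀ x ∈ Ioo (0 : ℝ) 1, 1 - x ∈ Ioo (0 : ℝ) 1 := fun x hx =>
    ⟨by linarith [hx.2], by linarith [hx.1]⟩
  refine ⟨cF.comp (by fun_prop) hmem, C, n, fun x hx => ?_⟩
  have h := hC _ (hmem x hx)
  rw [show (1 : ℝ) - (1 - x) = x by ring] at h
  rwa [show 1 - Real.log x - Real.log (1 - x) = 1 - Real.log (1 - x) - Real.log x by ring]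

/-- A function of polylogarithmic growth is dominated by an inverse square root at each endpoint. -/
theorem exists_le {F : ℝ → ℝ} (hF : LogBdd F) :
    ∃ C : ℝ, 0 ≤ C ∧ ∀ x ∈ Ioo (0 : ℝ) 1, |F x| ≤ C * (√(x * (1 - x)))⁻¹ := by
  obtain ⟨-, C, n, hC⟩ := hF
  refine ⟨|C| * (2 ^ n * n.factorial * Real.exp (1 / 2)), by positivity, fun x hx => ?_⟩
  have hw := one_le_weight hx
  have hx1 : 0 < 1 - x := by linarith [hx.2]
  set w := 1 - Real.log x - Real.log (1 - x) with hw_def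
  have h1 : (w / 2) ^ n / n.factorial ≤ Real.exp (w / 2) :=
    Real.pow_div_factorial_le_exp (w / 2) (by linarith) n
  have h2 : Real.exp (w / 2) = Real.exp (1 / 2) * (√(x * (1 - x)))⁻¹ := by
    rw [Real.sqrt_eq_rpow, ← Real.rpow_neg (mul_pos hx.1 hx1).le,
      Real.rpow_def_of_pos (mul_pos hx.1 hx1), Real.log_mul hx.1.ne' hx1.ne', ← Real.exp_add]
    congr 1
    rw [hw_def]; ring
  have h3 : w ^ n ≤ 2 ^ n * n.factorial * Real.exp (w / 2) := by
    rw [div_le_iff₀ (by positivity), div_pow, div_le_iff₀ (by positivity)] at h1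
    linarith
  calc |F x| ≤ C * w ^ n := hC x hx
    _ ≤ |C| * (2 ^ n * n.factorial * Real.exp (w / 2)) :=
      mul_le_mul (le_abs_self C) h3 (by positivity) (by positivity)
    _ = _ := by rw [h2]; ring

theorem integrableOn {F : ℝ → ℝ} (hF : LogBdd F) : IntegrableOn F (Ioo 0 1) := by
  obtain ⟨C, hC0, hC⟩ := hF.exists_le
  have h1 : IntegrableOn (fun x : ℝ => x ^ (-(1 / 2) : ℝ)) (Ioo 0 1) := by
    have := intervalIntegral.intervalIntegrable_rpow' (a := 0) (b := 1) (r := -(1 / 2))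
      (by norm_num)
    rw [intervalIntegrable_iff_integrableOn_Ioo_of_le zero_le_one] at this
    exact this
  have h2 : IntegrableOn (fun x : ℝ => (1 - x) ^ (-(1 / 2) : ℝ)) (Ioo 0 1) := by
    have := (intervalIntegral.intervalIntegrable_rpow' (a := 0) (b := 1) (r := -(1 / 2))
      (by norm_num)).comp_sub_left 1
    simp only [sub_zero, sub_self] at this
    have := this.symm
    rw [intervalIntegrable_iff_integrableOn_Ioo_of_le zero_le_one] at this
    exact this
  refine Integrable.mono' ((h1.add h2).const_mul (2 * C))
    (hF.1.aestronglyMeasurable measurableSet_Ioo) ?_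
  refine (ae_restrict_iff' measurableSet_Ioo).2 (Eventually.of_forall fun x hx => ?_)
  refine (hC x hx).trans ?_
  have hx1 : 0 < 1 - x := by linarith [hx.2]
  have hx0 := hx.1
  have key : (√(x * (1 - x)))⁻¹ ≤ 2 * (x ^ (-(1 / 2) : ℝ) + (1 - x) ^ (-(1 / 2) : ℝ)) := by
    rw [Real.rpow_neg hx0.le, Real.rpow_neg hx1.le, ← Real.sqrt_eq_rpow, ← Real.sqrt_eq_rpow,
      Real.sqrt_mul hx0.le]
    have a0 := Real.sqrt_pos.2 hx0
    have b0 := Real.sqrt_pos.2 hx1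
    have ha := Real.sq_sqrt hx0.le
    have hb := Real.sq_sqrt hx1.le
    rw [inv_add_inv a0.ne' b0.ne', mul_div_assoc', inv_eq_one_div]
    refine div_le_div_of_nonneg_right ?_ (by positivity)
    nlinarith [mul_pos a0 b0]
  calc C * (√(x * (1 - x)))⁻¹ ≤ C * (2 * (x ^ (-(1 / 2) : ℝ) + (1 - x) ^ (-(1 / 2) : ℝ))) :=
        mul_le_mul_of_nonneg_left key hC0
    _ = _ := by simp only [Pi.add_apply]; ring

theorem tendsto_id_mul {F : ℝ → ℝ} (hF : LogBdd F) :
    Tendsto (fun x => x * F x) (𝓝[>] 0) (𝓝 0) := by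
  obtain ⟨C, hC0, hC⟩ := hF.exists_le
  have hlim : Tendsto (fun x : ℝ => C * (√x / √(1 - x))) (𝓝[>] 0) (𝓝 0) := by
    have : ContinuousAt (fun x : ℝ => C * (√x / √(1 - x))) 0 := by
      refine continuousAt_const.mul (ContinuousAt.div (by fun_prop) (by fun_prop) (by simp))
    have h := this.tendsto
    simp only [Real.sqrt_zero, zero_div, mul_zero] at h
    exact h.mono_left nhdsWithin_le_nhds
  refine squeeze_zero_norm' ?_ hlim
  filter_upwards [Ioo_mem_nhdsGT (zero_lt_one' ℝ)] with x hx
  have hx0 := hx.1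
  have hx1 : 0 < 1 - x := by linarith [hx.2]
  rw [norm_mul, Real.norm_eq_abs, Real.norm_eq_abs, abs_of_pos hx0]
  have a0 := Real.sqrt_pos.2 hx0
  have b0 := Real.sqrt_pos.2 hx1
  calc x * |F x| ≤ x * (C * (√(x * (1 - x)))⁻¹) := mul_le_mul_of_nonneg_left (hC x hx) hx0.le
    _ = C * (√x / √(1 - x)) := by
      rw [Real.sqrt_mul hx0.le]
      nth_rewrite 1 [← Real.mul_self_sqrt hx0.le]
      field_simp

theorem tendsto_one_sub_mul {F : ℝ → ℝ} (hF : LogBdd F) :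
    Tendsto (fun x => (1 - x) * F x) (𝓝[<] 1) (𝓝 0) := by
  have h := hF.reflect.tendsto_id_mul
  have h2 : Tendsto (fun x : ℝ => 1 - x) (𝓝[<] 1) (𝓝[>] 0) := by
    refine tendsto_nhdsWithin_iff.2 ⟨?_, ?_⟩
    · have : ContinuousAt (fun x : ℝ => 1 - x) 1 := by fun_prop
      have := this.tendsto
      simp only [sub_self] at this
      exact this.mono_left nhdsWithin_le_nhds
    · filter_upwards [self_mem_nhdsWithin] with x hx
      simpa using hx
  have := h.comp h2
  simpa [Function.comp_def] using this

end LogBdd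

theorem unitInt_congr {F G : ℝ → ℝ} (h : ∀ x ∈ Ioo (0 : ℝ) 1, F x = G x) :
    unitInt F = unitInt G :=
  setIntegral_congr_fun measurableSet_Ioo h

theorem unitInt_add {F G : ℝ → ℝ} (hF : LogBdd F) (hG : LogBdd G) :
    unitInt (fun x => F x + G x) = unitInt F + unitInt G :=
  integral_add hF.integrableOn hG.integrableOn

theorem unitInt_sub {F G : ℝ → ℝ} (hF : LogBdd F) (hG : LogBdd G) :
    unitInt (fun x => F x - G x) = unitInt F - unitInt G :=
  integral_sub hF.integrableOn hG.integrableOn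

theorem unitInt_neg (F : ℝ → ℝ) : unitInt (fun x => -F x) = -unitInt F :=
  integral_neg F

theorem unitInt_const_mul (c : ℝ) (F : ℝ → ℝ) :
    unitInt (fun x => c * F x) = c * unitInt F :=
  integral_const_mul c F

/-- The fundamental theorem of calculus on `(0,1)` with boundary limits. -/
theorem unitInt_deriv {F F' : ℝ → ℝ} {a b : ℝ}
    (hd : ∀ x ∈ Ioo (0 : ℝ) 1, HasDerivAt F (F' x) x) (hF' : LogBdd F')
    (h0 : Tendsto F (𝓝[>] 0) (𝓝 a)) (h1 : Tendsto F (𝓝[<] 1) (𝓝 b)) :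
    unitInt F' = b - a := by
  have := intervalIntegral.integral_eq_sub_of_hasDerivAt_of_tendsto (zero_lt_one' ℝ) hd
    ((intervalIntegrable_iff_integrableOn_Ioo_of_le zero_le_one).2 hF'.integrableOn) h0 h1
  rw [← this, unitInt, intervalIntegral.integral_of_le zero_le_one, integral_Ioc_eq_integral_Ioo]

/-- A function with vanishing derivative on `(0,1)` equals its limit at `0`. -/
theorem eq_of_deriv_eq_zero {F : ℝ → ℝ} {a : ℝ}
    (hd : ∀ x ∈ Ioo (0 : ℝ) 1, HasDerivAt F 0 x)
    (h0 : Tendsto F (𝓝[>] 0) (𝓝 a)) {x : ℝ} (hx : x ∈ Ioo (0 : ℝ) 1) : F x = a := by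
  have hc : ∀ y ∈ Ioo (0 : ℝ) 1, F y = F x := fun y hy =>
    isOpen_Ioo.is_const_of_deriv_eq_zero isPreconnected_Ioo
      (fun z hz => (hd z hz).differentiableAt.differentiableWithinAt)
      (fun z hz => (hd z hz).deriv) hy hx
  refine tendsto_nhds_unique (tendsto_const_nhds.congr' ?_) h0
  filter_upwards [Ioo_mem_nhdsGT (zero_lt_one' ℝ)] with y hy using (hc y hy).symm

/-- A function with vanishing derivative on `(0,1)` equals its limit at `1`. -/
theorem eq_tendsto_one_of_deriv_eq_zero {F : ℝ → ℝ} {a : ℝ}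
    (hd : ∀ x ∈ Ioo (0 : ℝ) 1, HasDerivAt F 0 x)
    (h1 : Tendsto F (𝓝[<] 1) (𝓝 a)) {x : ℝ} (hx : x ∈ Ioo (0 : ℝ) 1) : F x = a := by
  have h := eq_of_deriv_eq_zero (F := fun y => F (1 - y)) (a := a) (x := 1 - x) (fun y hy => by
    refine ((hd (1 - y) ⟨by linarith [hy.2], by linarith [hy.1]⟩).comp y
      ((hasDerivAt_id y).const_sub 1)).congr_deriv (by simp)) ?_
    ⟨by linarith [hx.2], by linarith [hx.1]⟩
  · rwa [sub_sub_cancel] at h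
  · refine h1.comp (tendsto_nhdsWithin_iff.2 ⟨?_, ?_⟩)
    · have : ContinuousAt (fun y : ℝ => 1 - y) 0 := by fun_prop
      have := this.tendsto
      rw [sub_zero] at this
      exact this.mono_left nhdsWithin_le_nhds
    · filter_upwards [self_mem_nhdsWithin] with y hy using sub_lt_self (1 : ℝ) hy

theorem tendsto_zero_of_eq {F G : ℝ → ℝ} (hG : LogBdd G)
    (h : ∀ x ∈ Ioo (0 : ℝ) 1, F x = x * G x) : Tendsto F (𝓝[>] 0) (𝓝 0) :=
  hG.tendsto_id_mul.congr' (by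
    filter_upwards [Ioo_mem_nhdsGT (zero_lt_one' ℝ)] with x hx using (h x hx).symm)

theorem tendsto_one_of_eq {F G : ℝ → ℝ} (hG : LogBdd G)
    (h : ∀ x ∈ Ioo (0 : ℝ) 1, F x = (1 - x) * G x) : Tendsto F (𝓝[<] 1) (𝓝 0) :=
  hG.tendsto_one_sub_mul.congr' (by
    filter_upwards [Ioo_mem_nhdsLT (zero_lt_one' ℝ)] with x hx using (h x hx).symm)

/-- Interchange of the order of integration on the unit square. -/
theorem unitInt_swap {k : ℝ → ℝ → ℝ} {a b : ℝ → ℝ}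
    (hk : ContinuousOn (Function.uncurry k) (Ioo 0 1 ×ˢ Ioo 0 1)) (ha : LogBdd a) (hb : LogBdd b)
    (h : ∀ x ∈ Ioo (0 : ℝ) 1, ∀ y ∈ Ioo (0 : ℝ) 1, |k x y| ≤ |a x * b y|) :
    unitInt (fun x => unitInt (fun y => k x y)) = unitInt (fun y => unitInt (fun x => k x y)) := by
  refine integral_integral_swap ?_
  rw [Measure.prod_restrict]
  have hab : Integrable (fun z : ℝ × ℝ => a z.1 * b z.2)
      ((volume.prod volume).restrict (Ioo (0 : ℝ) 1 ×ˢ Ioo (0 : ℝ) 1)) := by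
    rw [← Measure.prod_restrict]
    exact Integrable.mul_prod ha.integrableOn hb.integrableOn
  refine Integrable.mono hab
    (hk.aestronglyMeasurable (measurableSet_Ioo.prod measurableSet_Ioo)) ?_
  refine (ae_restrict_iff' (measurableSet_Ioo.prod measurableSet_Ioo)).2
    (Eventually.of_forall fun z hz => ?_)
  exact h z.1 hz.1 z.2 hz.2

section Polylog

theorem norm_term_le (s n : ℕ) (x : ℝ) :
    ‖x ^ (n + 1) / ((n + 1 : ℕ) : ℝ) ^ s‖ = |x| ^ (n + 1) / ((n + 1 : ℕ) : ℝ) ^ s := by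
  rw [norm_div, norm_pow, norm_pow, Real.norm_eq_abs, Real.norm_natCast]

theorem summable_inv_pow {s : ℕ} (hs : 2 ≤ s) :
    Summable (fun n : ℕ => 1 / ((n + 1 : ℕ) : ℝ) ^ s) :=
  (summable_nat_add_iff 1).2 (Real.summable_one_div_nat_pow.2 (by omega))

theorem summable_abs_term {s : ℕ} (hs : 2 ≤ s) {x : ℝ} (hx : |x| ≤ 1) :
    Summable (fun n : ℕ => |x| ^ (n + 1) / ((n + 1 : ℕ) : ℝ) ^ s) :=
  (summable_inv_pow hs).of_nonneg_of_le (fun n => by positivity) fun n => by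
    gcongr; exact pow_le_one₀ (abs_nonneg x) hx

theorem summable_abs_term_of_lt (s : ℕ) {x : ℝ} (hx : |x| < 1) :
    Summable (fun n : ℕ => |x| ^ (n + 1) / ((n + 1 : ℕ) : ℝ) ^ s) :=
  ((summable_nat_add_iff 1).2 (summable_geometric_of_lt_one (abs_nonneg x) hx)).of_nonneg_of_le
    (fun n => by positivity) fun n => by
      refine div_le_self (by positivity) (one_le_pow₀ ?_)
      exact_mod_cast Nat.succ_pos n

theorem summable_term {s : ℕ} (hs : 2 ≤ s) {x : ℝ} (hx : |x| ≤ 1) :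
    Summable (fun n : ℕ => x ^ (n + 1) / ((n + 1 : ℕ) : ℝ) ^ s) :=
  Summable.of_norm (by simpa only [norm_term_le] using summable_abs_term hs hx)

theorem summable_term_of_lt (s : ℕ) {x : ℝ} (hx : |x| < 1) :
    Summable (fun n : ℕ => x ^ (n + 1) / ((n + 1 : ℕ) : ℝ) ^ s) :=
  Summable.of_norm (by simpa only [norm_term_le] using summable_abs_term_of_lt s hx)

theorem rpolylog_zero_right (s : ℕ) : rpolylog s 0 = 0 := by simp [rpolylog]

theorem rpolylog_one {x : ℝ} (hx : |x| < 1) : rpolylog 1 x = -Real.log (1 - x) := by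
  rw [rpolylog, ← (Real.hasSum_pow_div_log_of_abs_lt_one hx).tsum_eq]
  simp

theorem rpolylog_zero {x : ℝ} (hx : |x| < 1) : rpolylog 0 x = x / (1 - x) := by
  rw [rpolylog]
  simp only [pow_zero, div_one, pow_succ']
  rw [tsum_mul_left, tsum_geometric_of_abs_lt_one hx, div_eq_mul_inv]

theorem abs_rpolylog_le {s : ℕ} (hs : 2 ≤ s) {x : ℝ} (hx : |x| ≤ 1) :
    |rpolylog s x| ≤ rpolylog 2 1 * |x| := by
  rw [rpolylog, rpolylog, ← tsum_mul_right, ← Real.norm_eq_abs]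
  have h2 : Summable (fun n : ℕ => (1 : ℝ) ^ (n + 1) / ((n + 1 : ℕ) : ℝ) ^ 2 * |x|) := by
    simpa using (summable_inv_pow le_rfl).mul_right |x|
  refine tsum_of_norm_bounded h2.hasSum fun n => ?_
  rw [norm_term_le, pow_succ, mul_div_right_comm, one_pow]
  refine mul_le_mul_of_nonneg_right ?_ (abs_nonneg x)
  have h1 : (1 : ℝ) ≤ ((n + 1 : ℕ) : ℝ) := by exact_mod_cast Nat.succ_pos n
  gcongr
  · exact pow_le_one₀ (abs_nonneg x) hx

theorem abs_rpolylog_le_log {s : ℕ} (hs : 1 ≤ s) {x y : ℝ} (hxy : |x| ≤ y) (hy : y < 1) :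
    |rpolylog s x| ≤ -Real.log (1 - y) := by
  have hy0 : 0 ≤ y := (abs_nonneg x).trans hxy
  have hy1 : |y| < 1 := by rwa [abs_of_nonneg hy0]
  rw [← rpolylog_one hy1, rpolylog, rpolylog, ← Real.norm_eq_abs]
  refine tsum_of_norm_bounded (summable_term_of_lt 1 hy1).hasSum fun n => ?_
  rw [norm_term_le]
  have h1 : (1 : ℝ) ≤ ((n + 1 : ℕ) : ℝ) := by exact_mod_cast Nat.succ_pos n
  gcongr

theorem continuousOn_rpolylog {s : ℕ} (hs : 2 ≤ s) : ContinuousOn (rpolylog s) (Icc (-1) 1) := by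
  refine continuousOn_tsum (fun n => by fun_prop) (summable_inv_pow hs) fun n x hx => ?_
  rw [norm_term_le]
  gcongr
  exact pow_le_one₀ (abs_nonneg x) (abs_le.2 hx)

theorem hasDerivAt_rpolylog_tsum (s : ℕ) {x : ℝ} (hx : |x| < 1) :
    HasDerivAt (rpolylog (s + 1)) (∑' n : ℕ, x ^ n / ((n + 1 : ℕ) : ℝ) ^ s) x := by
  obtain ⟨ρ, hxρ, hρ⟩ := exists_between hx
  have hρ0 : 0 ≤ ρ := (abs_nonneg x).trans hxρ.le
  refine hasDerivAt_tsum_of_isPreconnected (t := Ioo (-ρ) ρ) (y₀ := 0) (u := fun n => ρ ^ n)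
    (summable_geometric_of_lt_one hρ0 hρ) isOpen_Ioo isPreconnected_Ioo
    (g := fun n y => y ^ (n + 1) / ((n + 1 : ℕ) : ℝ) ^ (s + 1))
    (g' := fun n y => y ^ n / ((n + 1 : ℕ) : ℝ) ^ s) ?_ ?_ ?_ ?_ (abs_lt.1 hxρ)
  · intro n y _
    have h := (hasDerivAt_pow (n + 1) y).div_const (((n + 1 : ℕ) : ℝ) ^ (s + 1))
    refine h.congr_deriv ?_
    rw [pow_succ ((n + 1 : ℕ) : ℝ) s, Nat.add_sub_cancel]
    have h1 : ((n + 1 : ℕ) : ℝ) ≠ 0 := by exact_mod_cast Nat.succ_ne_zero n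
    field_simp
  · intro n y hy
    rw [norm_div, norm_pow, norm_pow, Real.norm_eq_abs, Real.norm_natCast]
    have h1 : (1 : ℝ) ≤ ((n + 1 : ℕ) : ℝ) := by exact_mod_cast Nat.succ_pos n
    refine (div_le_self (by positivity) (one_le_pow₀ h1)).trans ?_
    gcongr
    exact (abs_lt.2 hy).le
  · exact ⟨by linarith [abs_nonneg x], by linarith [abs_nonneg x]⟩
  · simp

theorem hasDerivAt_rpolylog (s : ℕ) {x : ℝ} (hx : |x| < 1) (h0 : x ≠ 0) :
    HasDerivAt (rpolylog (s + 1)) (rpolylog s x / x) x := by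
  refine (hasDerivAt_rpolylog_tsum s hx).congr_deriv ?_
  rw [rpolylog, ← tsum_div_const]
  refine tsum_congr fun n => ?_
  rw [pow_succ]
  field_simp

theorem continuousAt_rpolylog {s : ℕ} (hs : 1 ≤ s) {x : ℝ} (hx : |x| < 1) :
    ContinuousAt (rpolylog s) x := by
  obtain ⟨t, rfl⟩ := Nat.exists_eq_add_of_le' hs
  exact (hasDerivAt_rpolylog_tsum t hx).continuousAt

theorem rpolylog_add_neg {s : ℕ} (hs : 2 ≤ s) {x : ℝ} (hx : |x| ≤ 1) :
    2 ^ s * (rpolylog s x + rpolylog s (-x)) = 2 * rpolylog s (x ^ 2) := by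
  have hx' : |-x| ≤ 1 := by rwa [abs_neg]
  have hs1 := summable_term hs hx
  have hs2 := summable_term hs hx'
  let g : ℕ → ℝ := fun n => x ^ (n + 1) / ((n + 1 : ℕ) : ℝ) ^ s
    + (-x) ^ (n + 1) / ((n + 1 : ℕ) : ℝ) ^ s
  have hg : Summable g := hs1.add hs2
  have h0 : ∀ k : ℕ, g (2 * k) = 0 := fun k => by
    simp only [g]
    rw [Odd.neg_pow ⟨k, rfl⟩]; ring
  have h1 : ∀ k : ℕ, 2 ^ s * g (2 * k + 1) = 2 * ((x ^ 2) ^ (k + 1) / ((k + 1 : ℕ) : ℝ) ^ s) :=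
    fun k => by
      simp only [g]
      rw [show (2 * k + 1 + 1) = 2 * (k + 1) by ring, Even.neg_pow ⟨k + 1, by ring⟩, Nat.cast_mul,
        mul_pow, ← pow_mul]
      have : (((k + 1 : ℕ) : ℝ)) ≠ 0 := by exact_mod_cast Nat.succ_ne_zero k
      rw [Nat.cast_two]
      field_simp
      ring
  have hsplit := tsum_even_add_odd
    (hg.comp_injective (i := fun n : ℕ => 2 * n) fun a b h => by simp only at h; omega)
    (hg.comp_injective (i := fun n : ℕ => 2 * n + 1) fun a b h => by simp only at h; omega)
  simp only [h0, tsum_zero, zero_add] at hsplit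
  calc 2 ^ s * (rpolylog s x + rpolylog s (-x)) = 2 ^ s * ∑' n, g n := by
        rw [rpolylog, rpolylog, ← hs1.tsum_add hs2]
    _ = ∑' k, 2 ^ s * g (2 * k + 1) := by rw [← hsplit, tsum_mul_left]
    _ = _ := by rw [tsum_congr h1, tsum_mul_left, rpolylog]

theorem rpolylog_two_one : rpolylog 2 1 = Real.pi ^ 2 / 6 := by
  rw [← hasSum_zeta_two.tsum_eq, hasSum_zeta_two.summable.tsum_eq_zero_add]
  simp [rpolylog]

theorem rpolylog_four_one : rpolylog 4 1 = Real.pi ^ 4 / 90 := by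
  rw [← hasSum_zeta_four.tsum_eq, hasSum_zeta_four.summable.tsum_eq_zero_add]
  simp [rpolylog]

theorem riemannZeta_eq_rpolylog {s : ℕ} (hs : 2 ≤ s) : riemannZeta s = (rpolylog s 1 : ℂ) := by
  have hs' : Summable (fun n : ℕ => 1 / (n : ℝ) ^ s) := Real.summable_one_div_nat_pow.2 (by omega)
  have : (rpolylog s 1 : ℝ) = ∑' n : ℕ, 1 / (n : ℝ) ^ s := by
    rw [hs'.tsum_eq_zero_add]
    simp [rpolylog, show s ≠ 0 by omega]
  rw [zeta_nat_eq_tsum_of_gt_one (by omega), this]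
  push_cast
  rfl

theorem rpolylog_neg_one {s : ℕ} (hs : 2 ≤ s) :
    2 ^ s * rpolylog s (-1) = (2 - 2 ^ s) * rpolylog s 1 := by
  have := rpolylog_add_neg hs (x := 1) (by simp)
  rw [one_pow] at this
  linarith

theorem tendsto_rpolylog_zero {s : ℕ} (hs : 1 ≤ s) (c : ℝ) :
    Tendsto (fun y => rpolylog s (c * y)) (𝓝[>] 0) (𝓝 0) := by
  have h : ContinuousAt (fun y => rpolylog s (c * y)) 0 := by
    refine ContinuousAt.comp' ?_ (by fun_prop)
    rw [mul_zero]
    exact continuousAt_rpolylog hs (by simp)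
  have := h.tendsto
  rw [mul_zero, rpolylog_zero_right] at this
  exact this.mono_left nhdsWithin_le_nhds

theorem tendsto_rpolylog_one {s : ℕ} (hs : 2 ≤ s) {c : ℝ} (hc : |c| ≤ 1) :
    Tendsto (fun y => rpolylog s (c * y)) (𝓝[<] 1) (𝓝 (rpolylog s c)) := by
  have h := (continuousOn_rpolylog hs) c (abs_le.1 hc)
  refine h.tendsto.comp (tendsto_nhdsWithin_iff.2 ⟨?_, ?_⟩)
  · have : ContinuousAt (fun y : ℝ => c * y) 1 := by fun_prop
    have := this.tendsto
    rw [mul_one] at this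
    exact this.mono_left nhdsWithin_le_nhds
  · filter_upwards [Ioo_mem_nhdsLT (zero_lt_one' ℝ)] with y hy
    refine abs_le.1 ?_
    rw [abs_mul, abs_of_pos hy.1]
    exact mul_le_one₀ hc hy.1.le hy.2.le

theorem abs_mul_lt_one {c y : ℝ} (hc : |c| ≤ 1) (hy : y ∈ Ioo (0 : ℝ) 1) : |c * y| < 1 := by
  rw [abs_mul, abs_of_pos hy.1]
  exact (mul_le_of_le_one_left hy.1.le hc).trans_lt hy.2

end Polylog

/-- `log x` -/
noncomputable def l (x : ℝ) : ℝ := Real.log x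
/-- `log (1 - x)` -/
noncomputable def m (x : ℝ) : ℝ := Real.log (1 - x)
/-- `log (1 + x)` -/
noncomputable def p (x : ℝ) : ℝ := Real.log (1 + x)
/-- `1 / (1 + x)` -/
noncomputable def ic (x : ℝ) : ℝ := 1 / (1 + x)
/-- `log (1 - x) / x` -/
noncomputable def mx (x : ℝ) : ℝ := m x / x
/-- `log (1 + x) / x` -/
noncomputable def px (x : ℝ) : ℝ := p x / x
/-- `log x / (1 - x)` -/
noncomputable def lc (x : ℝ) : ℝ := l x / (1 - x)
/-- `(log (1 + x) - log 2) / (1 - x)` -/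
noncomputable def pc (x : ℝ) : ℝ := (p x - Real.log 2) / (1 - x)
/-- `Li₂(-x)` -/
noncomputable def q2 (x : ℝ) : ℝ := rpolylog 2 (-x)
/-- `Li₃(-x)` -/
noncomputable def q3 (x : ℝ) : ℝ := rpolylog 3 (-x)
/-- `Li₄(-x)` -/
noncomputable def q4 (x : ℝ) : ℝ := rpolylog 4 (-x)
/-- `Li₂(x)` -/
noncomputable def r2 (x : ℝ) : ℝ := rpolylog 2 x
/-- `Li₂(-x) / x` -/
noncomputable def q2x (x : ℝ) : ℝ := q2 x / x
/-- `Li₃(-x) / x` -/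
noncomputable def q3x (x : ℝ) : ℝ := q3 x / x
/-- `Li₂(x) / x` -/
noncomputable def r2x (x : ℝ) : ℝ := r2 x / x

namespace LogBdd

@[fun_prop]
theorem l : LogBdd l := by
  refine ⟨fun x hx => (Real.continuousAt_log hx.1.ne').continuousWithinAt, 1, 1, fun x hx => ?_⟩
  have h1 := Real.log_nonpos hx.1.le hx.2.le
  have h2 := Real.log_nonpos (sub_nonneg.2 hx.2.le) (by linarith [hx.1] : 1 - x ≤ 1)
  rw [DilogIntegral.l, abs_of_nonpos h1]
  linarith

@[fun_prop]
theorem m : LogBdd m := l.reflect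

@[fun_prop]
theorem ic : LogBdd ic := by
  refine of_bounded (continuousOn_const.div (by fun_prop) fun x hx => by linarith [hx.1]) 1
    fun x hx => ?_
  have h1 : 0 < 1 + x := by linarith [hx.1]
  rw [DilogIntegral.ic, abs_of_pos (by positivity), div_le_one h1]
  linarith [hx.1]

@[fun_prop]
theorem mx : LogBdd mx := by
  refine mono (F := fun x => 2 * DilogIntegral.m x - 2) (by fun_prop)
    (m.1.div continuousOn_id fun x hx => hx.1.ne') fun x hx => ?_
  have hx0 := hx.1
  have hx1 : 0 < 1 - x := by linarith [hx.2]
  have h2 : Real.log (1 - x) ≤ 0 := Real.log_nonpos hx1.le (by linarith)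
  have h3 := Real.one_sub_inv_le_log_of_pos hx1
  simp only [DilogIntegral.mx, DilogIntegral.m]
  rw [abs_of_nonpos (div_nonpos_of_nonpos_of_nonneg h2 hx0.le), abs_of_nonpos (by linarith),
    ← neg_div, div_le_iff₀ hx0]
  rcases le_or_gt x (1 / 2) with h | h
  · have : (1 - x)⁻¹ ≤ 1 + 2 * x := by
      rw [inv_le_iff_one_le_mul₀ hx1]; nlinarith
    nlinarith
  · nlinarith

@[fun_prop]
theorem lc : LogBdd lc := by
  refine mx.reflect.congr fun x _ => ?_
  simp [DilogIntegral.mx, DilogIntegral.m, DilogIntegral.lc, DilogIntegral.l]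

theorem rpolylog_mul_div {s : ℕ} (hs : 1 ≤ s) {c : ℝ} (hc : |c| ≤ 1) :
    LogBdd (fun y => rpolylog s (c * y) / y) := by
  refine mono mx (fun y hy => ?_) fun y hy => ?_
  · exact ((ContinuousAt.comp' (f := fun y => c * y)
      (continuousAt_rpolylog hs (abs_mul_lt_one hc hy)) (by fun_prop)).div
      continuousAt_id hy.1.ne').continuousWithinAt
  · have h1 : |c * y| ≤ y := by
      rw [abs_mul, abs_of_pos hy.1]; exact mul_le_of_le_one_left hy.1.le hc
    rw [DilogIntegral.mx, DilogIntegral.m, abs_div, abs_div]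
    exact div_le_div_of_nonneg_right
      ((abs_rpolylog_le_log hs h1 hy.2).trans (neg_le_abs _)) (abs_nonneg y)

theorem rpolylog_mul {s : ℕ} (hs : 1 ≤ s) {c : ℝ} (hc : |c| ≤ 1) :
    LogBdd (fun y => rpolylog s (c * y)) := by
  refine (id'.mul (rpolylog_mul_div hs hc)).congr fun y hy => ?_
  have := hy.1.ne'
  field_simp

@[fun_prop]
theorem px : LogBdd px := by
  refine (rpolylog_mul_div le_rfl (c := -1) (by simp)).neg.congr fun x hx => ?_
  have := rpolylog_one (x := -1 * x) (abs_mul_lt_one (by simp) hx)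
  simp only [this, DilogIntegral.px, DilogIntegral.p]
  ring_nf

@[fun_prop]
theorem p : LogBdd p := by
  refine (id'.mul px).congr fun y hy => ?_
  have := hy.1.ne'
  simp only [DilogIntegral.px]
  field_simp

@[fun_prop]
theorem pc : LogBdd pc := by
  refine of_bounded ((p.1.sub continuousOn_const).div (by fun_prop)
    fun x hx => by linarith [hx.2]) 1 fun x hx => ?_
  have hx1 : 0 < 1 - x := by linarith [hx.2]
  have hp : 0 < 1 + x := by linarith [hx.1]
  have h1 : Real.log (1 + x) ≤ Real.log 2 := Real.log_le_log hp (by linarith)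
  have h2 := Real.one_sub_inv_le_log_of_pos (show (0 : ℝ) < (1 + x) / 2 by positivity)
  rw [Real.log_div hp.ne' two_ne_zero, inv_div] at h2
  have h3 : 2 / (1 + x) ≤ 2 - x := by
    rw [div_le_iff₀ hp]; nlinarith [hx.1, hx.2]
  rw [DilogIntegral.pc, DilogIntegral.p, abs_div, abs_of_pos hx1, div_le_one hx1,
    abs_of_nonpos (by linarith)]
  linarith

@[fun_prop]
theorem q2 : LogBdd q2 := by
  have h := rpolylog_mul (s := 2) (by norm_num) (c := -1) (by simp)
  simp only [neg_one_mul] at h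
  exact h

@[fun_prop]
theorem q3 : LogBdd q3 := by
  have h := rpolylog_mul (s := 3) (by norm_num) (c := -1) (by simp)
  simp only [neg_one_mul] at h
  exact h

@[fun_prop]
theorem q4 : LogBdd q4 := by
  have h := rpolylog_mul (s := 4) (by norm_num) (c := -1) (by simp)
  simp only [neg_one_mul] at h
  exact h

@[fun_prop]
theorem r2 : LogBdd r2 := by
  have h := rpolylog_mul (s := 2) (by norm_num) (c := 1) (by simp)
  simp only [one_mul] at h
  exact h

@[fun_prop]
theorem q2x : LogBdd q2x := by
  have h := rpolylog_mul_div (s := 2) (by norm_num) (c := -1) (by simp)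
  simp only [neg_one_mul] at h
  exact h

@[fun_prop]
theorem q3x : LogBdd q3x := by
  have h := rpolylog_mul_div (s := 3) (by norm_num) (c := -1) (by simp)
  simp only [neg_one_mul] at h
  exact h

@[fun_prop]
theorem r2x : LogBdd r2x := by
  have h := rpolylog_mul_div (s := 2) (by norm_num) (c := 1) (by simp)
  simp only [one_mul] at h
  exact h

end LogBdd

section Deriv

theorem hasDerivAt_l {x : ℝ} (hx : x ∈ Ioo (0 : ℝ) 1) : HasDerivAt l (1 / x) x := by
  rw [one_div]
  exact Real.hasDerivAt_log hx.1.ne'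

theorem hasDerivAt_m {x : ℝ} (hx : x ∈ Ioo (0 : ℝ) 1) : HasDerivAt m (-(1 / (1 - x))) x := by
  have h : (1 : ℝ) - x ≠ 0 := by linarith [hx.2]
  exact (((hasDerivAt_id x).const_sub 1).log h).congr_deriv (neg_div _ _)

theorem hasDerivAt_p {x : ℝ} (hx : x ∈ Ioo (0 : ℝ) 1) : HasDerivAt p (1 / (1 + x)) x := by
  have h : (1 : ℝ) + x ≠ 0 := by linarith [hx.1]
  exact ((hasDerivAt_id x).const_add 1).log h

theorem hasDerivAt_neg_rpolylog {x : ℝ} (hx : x ∈ Ioo (0 : ℝ) 1) (s : ℕ) :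
    HasDerivAt (fun x => rpolylog (s + 1) (-x)) (rpolylog s (-x) / x) x := by
  have h := (hasDerivAt_rpolylog s (x := -x) (by rw [abs_neg, abs_of_pos hx.1]; exact hx.2)
    (neg_ne_zero.2 hx.1.ne')).comp x (hasDerivAt_neg x)
  refine h.congr_deriv ?_
  have := hx.1.ne'
  field_simp

theorem rpolylog_one_neg {x : ℝ} (hx : x ∈ Ioo (0 : ℝ) 1) : rpolylog 1 (-x) = -p x := by
  rw [rpolylog_one (by rw [abs_neg, abs_of_pos hx.1]; exact hx.2), p, sub_neg_eq_add]

theorem hasDerivAt_q2 {x : ℝ} (hx : x ∈ Ioo (0 : ℝ) 1) : HasDerivAt q2 (-(p x / x)) x := by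
  have := hasDerivAt_neg_rpolylog hx 1
  rw [rpolylog_one_neg hx, neg_div] at this
  exact this

theorem hasDerivAt_q3 {x : ℝ} (hx : x ∈ Ioo (0 : ℝ) 1) : HasDerivAt q3 (q2 x / x) x :=
  hasDerivAt_neg_rpolylog hx 2

theorem hasDerivAt_q4 {x : ℝ} (hx : x ∈ Ioo (0 : ℝ) 1) : HasDerivAt q4 (q3 x / x) x :=
  hasDerivAt_neg_rpolylog hx 3

theorem hasDerivAt_r2 {x : ℝ} (hx : x ∈ Ioo (0 : ℝ) 1) : HasDerivAt r2 (-(m x / x)) x := by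
  have habs : |x| < 1 := by rw [abs_of_pos hx.1]; exact hx.2
  have := hasDerivAt_rpolylog 1 habs hx.1.ne'
  rw [rpolylog_one habs, neg_div] at this
  exact this

end Deriv

theorem tendsto_l_one : Tendsto l (𝓝[<] 1) (𝓝 0) := by
  have := (Real.continuousAt_log one_ne_zero).tendsto
  rw [Real.log_one] at this
  exact this.mono_left nhdsWithin_le_nhds

theorem continuousAt_p {x : ℝ} (hx : 0 ≤ x) : ContinuousAt p x :=
  ContinuousAt.log (by fun_prop) (by linarith)

theorem tendsto_p_zero : Tendsto p (𝓝[>] 0) (𝓝 0) := by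
  have := (continuousAt_p le_rfl).tendsto
  rw [p, add_zero, Real.log_one] at this
  exact this.mono_left nhdsWithin_le_nhds

theorem tendsto_p_one : Tendsto p (𝓝[<] 1) (𝓝 (Real.log 2)) := by
  have := (continuousAt_p zero_le_one).tendsto
  rw [p, one_add_one_eq_two] at this
  exact this.mono_left nhdsWithin_le_nhds

theorem tendsto_q2_zero : Tendsto q2 (𝓝[>] 0) (𝓝 0) := by
  have h := tendsto_rpolylog_zero (s := 2) (by norm_num) (-1)
  simp only [neg_one_mul] at h
  exact h

theorem tendsto_q3_zero : Tendsto q3 (𝓝[>] 0) (𝓝 0) := by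
  have h := tendsto_rpolylog_zero (s := 3) (by norm_num) (-1)
  simp only [neg_one_mul] at h
  exact h

theorem tendsto_q4_zero : Tendsto q4 (𝓝[>] 0) (𝓝 0) := by
  have h := tendsto_rpolylog_zero (s := 4) (by norm_num) (-1)
  simp only [neg_one_mul] at h
  exact h

theorem tendsto_r2_zero : Tendsto r2 (𝓝[>] 0) (𝓝 0) := by
  have h := tendsto_rpolylog_zero (s := 2) (by norm_num) 1
  simp only [one_mul] at h
  exact h

theorem tendsto_q2_one : Tendsto q2 (𝓝[<] 1) (𝓝 (q2 1)) := by
  have h := tendsto_rpolylog_one (s := 2) (by norm_num) (c := -1) (by simp)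
  simp only [neg_one_mul] at h
  exact h

theorem tendsto_q3_one : Tendsto q3 (𝓝[<] 1) (𝓝 (q3 1)) := by
  have h := tendsto_rpolylog_one (s := 3) (by norm_num) (c := -1) (by simp)
  simp only [neg_one_mul] at h
  exact h

theorem tendsto_q4_one : Tendsto q4 (𝓝[<] 1) (𝓝 (q4 1)) := by
  have h := tendsto_rpolylog_one (s := 4) (by norm_num) (c := -1) (by simp)
  simp only [neg_one_mul] at h
  exact h

theorem tendsto_r2_one : Tendsto r2 (𝓝[<] 1) (𝓝 (Real.pi ^ 2 / 6)) := by
  rw [← rpolylog_two_one]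
  have h := tendsto_rpolylog_one (s := 2) (by norm_num) (c := 1) (by simp)
  simp only [one_mul] at h
  exact h

theorem q2_one : q2 1 = -(Real.pi ^ 2 / 12) := by
  have := rpolylog_neg_one (s := 2) le_rfl
  rw [rpolylog_two_one] at this
  rw [q2]; linarith

theorem q3_one : q3 1 = -(3 / 4) * rpolylog 3 1 := by
  have := rpolylog_neg_one (s := 3) (by norm_num)
  rw [q3]; linarith

theorem q4_one : q4 1 = -(7 / 8) * (Real.pi ^ 4 / 90) := by
  have := rpolylog_neg_one (s := 4) (by norm_num)
  rw [rpolylog_four_one] at this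
  rw [q4]; linarith

section ChangeOfVariables

theorem setIntegral_eq_unitInt_comp {φ φ' : ℝ → ℝ} {s : Set ℝ} (G : ℝ → ℝ)
    (hd : ∀ x ∈ Ioo (0 : ℝ) 1, HasDerivAt φ (φ' x) x) (hinj : InjOn φ (Ioo 0 1))
    (himg : φ '' Ioo 0 1 = s) :
    ∫ x in s, G x = unitInt (fun x => |φ' x| * G (φ x)) := by
  rw [← himg, integral_image_eq_integral_abs_deriv_smul measurableSet_Ioo
    (fun x hx => (hd x hx).hasDerivWithinAt) hinj]
  rfl

theorem unitInt_reflect (G : ℝ → ℝ) : unitInt (fun x => G (1 - x)) = unitInt G := by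
  have h := setIntegral_eq_unitInt_comp (φ := fun x => 1 - x) (φ' := fun _ => -1)
    (s := Ioo 0 1) G
    (fun x _ => (hasDerivAt_id x).const_sub 1) (fun x _ y _ h => by simpa using h) (by simp)
  simpa [unitInt] using h.symm

theorem unitInt_sq (G : ℝ → ℝ) : unitInt G = unitInt (fun x => 2 * x * G (x ^ 2)) := by
  have h := setIntegral_eq_unitInt_comp (φ := fun x => x ^ 2) (φ' := fun x => 2 * x)
    (s := Ioo 0 1) G (fun x _ => by simpa using hasDerivAt_pow 2 x)
    (fun x hx y hy h => by
      exact (pow_left_inj₀ hx.1.le hy.1.le two_ne_zero).1 h)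
    (by
      ext y
      constructor
      · rintro ⟨x, hx, rfl⟩
        exact ⟨pow_pos hx.1 2, pow_lt_one₀ hx.1.le hx.2 two_ne_zero⟩
      · intro hy
        refine ⟨√y, ⟨Real.sqrt_pos.2 hy.1, ?_⟩, Real.sq_sqrt hy.1.le⟩
        rw [Real.sqrt_lt' one_pos]; simpa using hy.2)
  rw [unitInt, h]
  exact unitInt_congr fun x hx => by rw [abs_of_pos (by linarith [hx.1])]

theorem unitInt_dual (G : ℝ → ℝ) :
    unitInt G = unitInt (fun x => 2 / (1 + x) ^ 2 * G ((1 - x) / (1 + x))) := by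
  have h := setIntegral_eq_unitInt_comp (φ := fun x => (1 - x) / (1 + x))
    (φ' := fun x => -(2 / (1 + x) ^ 2)) (s := Ioo 0 1) G
    (fun x hx => by
      have h1 : 1 + x ≠ 0 := by linarith [hx.1]
      refine (((hasDerivAt_id x).const_sub 1).div ((hasDerivAt_id x).const_add 1) h1).congr_deriv ?_
      simp only [id]
      field_simp
      ring)
    (fun x hx y hy h => by
      have h1 : 1 + x ≠ 0 := by linarith [hx.1]
      have h2 : 1 + y ≠ 0 := by linarith [hy.1]
      simp only at h
      rw [div_eq_div_iff h1 h2] at h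
      linarith)
    (by
      ext y
      constructor
      · rintro ⟨x, hx, rfl⟩
        have h1 : 0 < 1 + x := by linarith [hx.1]
        refine ⟨div_pos (by linarith [hx.2]) h1, ?_⟩
        rw [div_lt_one h1]; linarith [hx.1]
      · intro hy
        have h1 : 0 < 1 + y := by linarith [hy.1]
        refine ⟨(1 - y) / (1 + y), ⟨div_pos (by linarith [hy.2]) h1, ?_⟩, ?_⟩
        · rw [div_lt_one h1]; linarith [hy.1]
        · field_simp
          ring)
  rw [unitInt, h]
  refine unitInt_congr fun x hx => ?_
  rw [abs_neg, abs_of_pos]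
  have := hx.1
  positivity

theorem unitInt_halves {F : ℝ → ℝ} (hF : LogBdd F) :
    unitInt F = unitInt (fun x => 1 / (1 + x) ^ 2 * F (x / (1 + x)))
      + unitInt (fun x => 1 / (1 + x) ^ 2 * F (1 / (1 + x))) := by
  have h1 := setIntegral_eq_unitInt_comp (φ := fun x => x / (1 + x))
    (φ' := fun x => 1 / (1 + x) ^ 2) (s := Ioo 0 (1 / 2)) F
    (fun x hx => by
      have h1 : 1 + x ≠ 0 := by linarith [hx.1]
      refine ((hasDerivAt_id x).div ((hasDerivAt_id x).const_add 1) h1).congr_deriv ?_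
      simp only [id]
      field_simp
      ring)
    (fun x hx y hy h => by
      have h1 : 1 + x ≠ 0 := by linarith [hx.1]
      have h2 : 1 + y ≠ 0 := by linarith [hy.1]
      simp only at h
      rw [div_eq_div_iff h1 h2] at h
      linarith)
    (by
      ext y
      constructor
      · rintro ⟨x, hx, rfl⟩
        have h1 : 0 < 1 + x := by linarith [hx.1]
        refine ⟨div_pos hx.1 h1, ?_⟩
        rw [div_lt_div_iff₀ h1 two_pos]; linarith [hx.2]
      · intro hy
        have h1 : 0 < 1 - y := by linarith [hy.2]
        refine ⟨y / (1 - y), ⟨div_pos hy.1 h1, ?_⟩, ?_⟩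
        · rw [div_lt_one h1]; linarith [hy.2]
        · field_simp
          ring)
  have h2 := setIntegral_eq_unitInt_comp (φ := fun x => 1 / (1 + x))
    (φ' := fun x => -(1 / (1 + x) ^ 2)) (s := Ioo (1 / 2) 1) F
    (fun x hx => by
      have h1 : 1 + x ≠ 0 := by linarith [hx.1]
      refine ((hasDerivAt_const x (1 : ℝ)).div ((hasDerivAt_id x).const_add 1) h1).congr_deriv ?_
      simp only [id]
      field_simp
      ring)
    (fun x hx y hy h => by
      have h1 : 1 + x ≠ 0 := by linarith [hx.1]
      have h2 : 1 + y ≠ 0 := by linarith [hy.1]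
      simp only at h
      rw [div_eq_div_iff h1 h2] at h
      linarith)
    (by
      ext y
      constructor
      · rintro ⟨x, hx, rfl⟩
        have h1 : 0 < 1 + x := by linarith [hx.1]
        refine ⟨?_, ?_⟩
        · rw [div_lt_div_iff₀ two_pos h1]; linarith [hx.2]
        · rw [div_lt_one h1]; linarith [hx.1]
      · intro hy
        have h1 : 0 < y := by linarith [hy.1]
        refine ⟨(1 - y) / y, ⟨div_pos (by linarith [hy.2]) h1, ?_⟩, ?_⟩
        · rw [div_lt_one h1]; linarith [hy.1]
        · field_simp
          ring)
  have hpos : ∀ x ∈ Ioo (0 : ℝ) 1, |1 / (1 + x) ^ 2| = 1 / (1 + x) ^ 2 := fun x hx =>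
    abs_of_pos (by have := hx.1; positivity)
  have hi := (intervalIntegrable_iff_integrableOn_Ioo_of_le zero_le_one).2 hF.integrableOn
  have hsplit := intervalIntegral.integral_add_adjacent_intervals (a := 0) (b := 1 / 2) (c := 1)
    (f := F) (μ := volume)
    (hi.mono_set (by rw [uIcc_of_le (by norm_num), uIcc_of_le (by norm_num)]
                     exact Icc_subset_Icc_right (by norm_num)))
    (hi.mono_set (by rw [uIcc_of_le (by norm_num), uIcc_of_le (by norm_num)]
                     exact Icc_subset_Icc_left (by norm_num)))
  rw [intervalIntegral.integral_of_le (by norm_num), intervalIntegral.integral_of_le (by norm_num),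
    intervalIntegral.integral_of_le (by norm_num), integral_Ioc_eq_integral_Ioo,
    integral_Ioc_eq_integral_Ioo, integral_Ioc_eq_integral_Ioo, h1, h2] at hsplit
  rw [unitInt, ← hsplit]
  congr 1
  · exact unitInt_congr fun x hx => by rw [hpos x hx]
  · exact unitInt_congr fun x hx => by rw [abs_neg, hpos x hx]

variable {x : ℝ}

theorem m_dual (hx : x ∈ Ioo (0 : ℝ) 1) : m ((1 - x) / (1 + x)) = Real.log 2 + l x - p x := by
  have h1 : 0 < 1 + x := by linarith [hx.1]
  rw [m, show 1 - (1 - x) / (1 + x) = 2 * x / (1 + x) by field_simp; ring,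
    Real.log_div (by linarith [hx.1]) h1.ne', Real.log_mul two_ne_zero hx.1.ne', l, p]

theorem p_dual (hx : x ∈ Ioo (0 : ℝ) 1) : p ((1 - x) / (1 + x)) = Real.log 2 - p x := by
  have h1 : 0 < 1 + x := by linarith [hx.1]
  rw [p, show 1 + (1 - x) / (1 + x) = 2 / (1 + x) by field_simp; ring,
    Real.log_div two_ne_zero h1.ne', p]

theorem ic_dual (hx : x ∈ Ioo (0 : ℝ) 1) : 2 / (1 + x) ^ 2 * ic ((1 - x) / (1 + x)) = ic x := by
  have h1 : 0 < 1 + x := by linarith [hx.1]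
  rw [ic, ic, show 1 + (1 - x) / (1 + x) = 2 / (1 + x) by field_simp; ring]
  field_simp

theorem inv_dual (hx : x ∈ Ioo (0 : ℝ) 1) :
    2 / (1 + x) ^ 2 * (1 / ((1 - x) / (1 + x))) = 1 / (1 - x) + 1 / (1 + x) := by
  have h1 : 0 < 1 + x := by linarith [hx.1]
  have h2 : 0 < 1 - x := by linarith [hx.2]
  field_simp
  ring

theorem l_left (hx : x ∈ Ioo (0 : ℝ) 1) : l (x / (1 + x)) = l x - p x := by
  have h1 : 0 < 1 + x := by linarith [hx.1]
  rw [l, Real.log_div hx.1.ne' h1.ne', l, p]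

theorem m_left (hx : x ∈ Ioo (0 : ℝ) 1) : m (x / (1 + x)) = -p x := by
  have h1 : 0 < 1 + x := by linarith [hx.1]
  rw [m, show 1 - x / (1 + x) = (1 + x)⁻¹ by field_simp; ring, Real.log_inv, p]

theorem l_right : l (1 / (1 + x)) = -p x := by
  rw [l, one_div, Real.log_inv, p]

theorem m_right (hx : x ∈ Ioo (0 : ℝ) 1) : m (1 / (1 + x)) = l x - p x := by
  have h1 : 0 < 1 + x := by linarith [hx.1]
  rw [m, show 1 - 1 / (1 + x) = x / (1 + x) by field_simp; ring,
    Real.log_div hx.1.ne' h1.ne', l, p]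

theorem m_sq (hx : x ∈ Ioo (0 : ℝ) 1) : m (x ^ 2) = m x + p x := by
  rw [m, show 1 - x ^ 2 = (1 - x) * (1 + x) by ring,
    Real.log_mul (by linarith [hx.2]) (by linarith [hx.1]), m, p]

theorem l_sq : l (x ^ 2) = 2 * l x := by simp [l]

end ChangeOfVariables

section LogIntegrals

theorem l_eq {x : ℝ} (hx : x ∈ Ioo (0 : ℝ) 1) : l x = (1 - x) * lc x := by
  have : 1 - x ≠ 0 := by linarith [hx.2]
  rw [lc]; field_simp

theorem m_eq {x : ℝ} (hx : x ∈ Ioo (0 : ℝ) 1) : m x = x * mx x := by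
  have := hx.1.ne'
  rw [mx]; field_simp

theorem p_eq {x : ℝ} (hx : x ∈ Ioo (0 : ℝ) 1) : p x = x * px x := by
  have := hx.1.ne'
  rw [px]; field_simp

theorem q2_eq {x : ℝ} (hx : x ∈ Ioo (0 : ℝ) 1) : q2 x = x * q2x x := by
  have := hx.1.ne'
  rw [q2x]; field_simp

theorem q3_eq {x : ℝ} (hx : x ∈ Ioo (0 : ℝ) 1) : q3 x = x * q3x x := by
  have := hx.1.ne'
  rw [q3x]; field_simp

theorem hasDerivAt_rpolylog_mul {s : ℕ} {c y : ℝ} (hc : |c| ≤ 1) (hy : y ∈ Ioo (0 : ℝ) 1) :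
    HasDerivAt (fun y => rpolylog (s + 1) (c * y)) (rpolylog s (c * y) / y) y := by
  rcases eq_or_ne c 0 with rfl | h0
  · simpa [rpolylog_zero_right] using hasDerivAt_const y (0 : ℝ)
  have h := (hasDerivAt_rpolylog s (abs_mul_lt_one hc hy) (mul_ne_zero h0 hy.1.ne')).comp y
    ((hasDerivAt_id y).const_mul c)
  refine h.congr_deriv ?_
  have := hy.1.ne'
  field_simp

/-- Moments of polylogarithms against powers of the logarithm. -/
theorem unitInt_log_pow_mul_rpolylog {c : ℝ} (hc : |c| ≤ 1) (k : ℕ) : ∀ {s : ℕ}, 1 ≤ s →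
    unitInt (fun y => l y ^ k * (rpolylog s (c * y) / y))
      = (-1) ^ k * k.factorial * rpolylog (s + k + 1) c := by
  induction k with
  | zero =>
    intro s hs
    have h := unitInt_deriv (fun y hy => hasDerivAt_rpolylog_mul (s := s) hc hy)
      (LogBdd.rpolylog_mul_div hs hc) (tendsto_rpolylog_zero (by omega) c)
      (tendsto_rpolylog_one (by omega) hc)
    simpa using h
  | succ k ih =>
    intro s hs
    have hb1 := LogBdd.rpolylog_mul_div hs hc
    have hb2 := LogBdd.rpolylog_mul_div (s := s + 1) (by omega) hc
    have hb3 := LogBdd.rpolylog_mul (s := s + 1) (by omega) hc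
    have h := unitInt_deriv (F := fun y => l y ^ (k + 1) * rpolylog (s + 1) (c * y))
      (F' := fun y => (k + 1 : ℝ) * (l y ^ k * (rpolylog (s + 1) (c * y) / y))
        + l y ^ (k + 1) * (rpolylog s (c * y) / y)) (a := 0) (b := 0)
      (fun y hy => by
        refine (((hasDerivAt_l hy).pow (k + 1)).mul (hasDerivAt_rpolylog_mul hc hy)).congr_deriv ?_
        rw [Nat.add_sub_cancel]
        push_cast
        simp only [Pi.pow_apply]
        ring)
      (by fun_prop)
      (tendsto_zero_of_eq (G := fun y => l y ^ (k + 1) * (rpolylog (s + 1) (c * y) / y))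
        (by fun_prop) fun y hy => by have := hy.1.ne'; field_simp)
      (tendsto_one_of_eq (G := fun y => lc y * (l y ^ k * rpolylog (s + 1) (c * y)))
        (by fun_prop) fun y hy => by simp only [pow_succ]; nth_rewrite 2 [l_eq hy]; ring)
    rw [unitInt_add (by fun_prop) (by fun_prop), unitInt_const_mul, ih (by omega)] at h
    rw [Nat.factorial_succ, show s + (k + 1) + 1 = s + 1 + k + 1 by ring]
    push_cast
    rw [pow_succ]
    linear_combination h

theorem logBdd_log_mul_inv {c : ℝ} (hc : |c| ≤ 1) : LogBdd (fun y => l y * (c / (1 - c * y))) := by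
  have hpos : ∀ y ∈ Ioo (0 : ℝ) 1, 1 - y ≤ 1 - c * y := fun y hy => by
    have := mul_le_mul_of_nonneg_right (abs_le.1 hc).2 hy.1.le
    linarith
  refine LogBdd.lc.mono (LogBdd.l.1.mul (continuousOn_const.div (by fun_prop) fun y hy => ?_))
    fun y hy => ?_
  · linarith [hpos y hy, hy.2]
  · have h1 : 0 < 1 - y := by linarith [hy.2]
    have h2 : 0 < 1 - c * y := h1.trans_le (hpos y hy)
    rw [lc, abs_mul, abs_div, abs_div, abs_of_pos h1, abs_of_pos h2, div_eq_mul_inv]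
    refine mul_le_mul_of_nonneg_left ?_ (abs_nonneg _)
    rw [← one_mul (1 - y)⁻¹]
    exact mul_le_mul hc (inv_anti₀ h1 (hpos y hy)) (by positivity) zero_le_one

theorem unitInt_log_pow_mul_inv {c : ℝ} (hc : |c| ≤ 1) (k : ℕ) :
    unitInt (fun y => l y ^ (k + 1) * (c / (1 - c * y)))
      = (-1) ^ (k + 1) * (k + 1).factorial * rpolylog (k + 2) c := by
  have hb0 : LogBdd (fun y => l y ^ (k + 1) * (c / (1 - c * y))) :=
    ((LogBdd.l.pow k).mul (logBdd_log_mul_inv hc)).congr fun y _ => by ring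
  have hb2 := LogBdd.rpolylog_mul_div (s := 1) (by omega) hc
  have hb3 := LogBdd.rpolylog_mul (s := 1) (by omega) hc
  have h := unitInt_deriv (F := fun y => l y ^ (k + 1) * rpolylog 1 (c * y))
    (F' := fun y => (k + 1 : ℝ) * (l y ^ k * (rpolylog 1 (c * y) / y))
      + l y ^ (k + 1) * (c / (1 - c * y))) (a := 0) (b := 0)
    (fun y hy => by
      refine (((hasDerivAt_l hy).pow (k + 1)).mul (hasDerivAt_rpolylog_mul hc hy)).congr_deriv ?_
      rw [Nat.add_sub_cancel, rpolylog_zero (abs_mul_lt_one hc hy)]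
      push_cast
      simp only [Pi.pow_apply]
      have h0 := hy.1.ne'
      have h1 : 1 - c * y ≠ 0 := by linarith [(abs_lt.1 (abs_mul_lt_one hc hy)).2]
      field_simp)
    (by fun_prop)
    (tendsto_zero_of_eq (G := fun y => l y ^ (k + 1) * (rpolylog 1 (c * y) / y))
      (by fun_prop) fun y hy => by have := hy.1.ne'; field_simp)
    (tendsto_one_of_eq (G := fun y => lc y * (l y ^ k * rpolylog 1 (c * y)))
      (by fun_prop) fun y hy => by simp only [pow_succ]; nth_rewrite 2 [l_eq hy]; ring)
  rw [unitInt_add (by fun_prop) (by fun_prop), unitInt_const_mul,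
    unitInt_log_pow_mul_rpolylog hc k le_rfl] at h
  rw [Nat.factorial_succ, show k + 2 = 1 + k + 1 by ring]
  push_cast
  rw [pow_succ]
  linear_combination h

theorem unitInt_l_pow_mx (k : ℕ) :
    unitInt (fun x => l x ^ k * mx x) = -((-1) ^ k * k.factorial * rpolylog (k + 2) 1) := by
  have h := unitInt_log_pow_mul_rpolylog (c := 1) (by simp) k le_rfl
  rw [show 1 + k + 1 = k + 2 by ring] at h
  rw [← h, ← unitInt_neg]
  refine unitInt_congr fun x hx => ?_
  rw [one_mul, rpolylog_one (by rw [abs_of_pos hx.1]; exact hx.2), mx, m]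
  ring

theorem unitInt_l_pow_px (k : ℕ) :
    unitInt (fun x => l x ^ k * px x) = -((-1) ^ k * k.factorial * rpolylog (k + 2) (-1)) := by
  have h := unitInt_log_pow_mul_rpolylog (c := -1) (by simp) k le_rfl
  rw [show 1 + k + 1 = k + 2 by ring] at h
  rw [← h, ← unitInt_neg]
  refine unitInt_congr fun x hx => ?_
  rw [neg_one_mul, rpolylog_one_neg hx, px]
  ring

theorem unitInt_l_pow_lc (k : ℕ) :
    unitInt (fun x => l x ^ k * lc x)
      = (-1) ^ (k + 1) * (k + 1).factorial * rpolylog (k + 2) 1 := by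
  rw [← unitInt_log_pow_mul_inv (c := 1) (by simp) k]
  refine unitInt_congr fun x _ => ?_
  rw [lc, one_mul]
  ring

end LogIntegrals

theorem unitInt_vmap (H : ℝ → ℝ → ℝ) (hb : LogBdd (fun x => H (l x) (m x) / x)) :
    unitInt (fun x => H (l x) (m x) / x)
      = unitInt (fun x => H (l x - p x) (-p x) * (1 / x - ic x))
        + unitInt (fun x => H (-p x) (l x - p x) * ic x) := by
  rw [unitInt_halves hb]
  congr 1
  · refine unitInt_congr fun x hx => ?_
    have h0 := hx.1
    rw [l_left hx, m_left hx, ic]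
    field_simp
    ring
  · refine unitInt_congr fun x hx => ?_
    have h0 := hx.1
    rw [l_right, m_right hx, ic]
    field_simp

theorem unitInt_dual_inv (H : ℝ → ℝ → ℝ) :
    unitInt (fun x => H (m x - p x) (p x) / x)
      = unitInt (fun x => H (l x) (Real.log 2 - p x) * (1 / (1 - x) + ic x)) := by
  rw [unitInt_dual]
  refine unitInt_congr fun x hx => ?_
  rw [m_dual hx, p_dual hx, div_eq_mul_one_div (H _ _), mul_left_comm, inv_dual hx, ic]
  congr 2
  ring

theorem unitInt_dual_ic (H : ℝ → ℝ → ℝ) :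
    unitInt (fun x => H (m x - p x) (p x) * ic x)
      = unitInt (fun x => H (l x) (Real.log 2 - p x) * ic x) := by
  rw [unitInt_dual]
  refine unitInt_congr fun x hx => ?_
  rw [m_dual hx, p_dual hx, mul_left_comm, ic_dual hx]
  congr 2
  ring

theorem unitInt_sq_inv (H : ℝ → ℝ → ℝ) :
    unitInt (fun x => H (l x) (m x) / x) = 2 * unitInt (fun x => H (2 * l x) (m x + p x) / x) := by
  rw [unitInt_sq, ← unitInt_const_mul]
  refine unitInt_congr fun x hx => ?_
  have h0 := hx.1.ne'
  rw [l_sq, m_sq hx]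
  field_simp

/-- `∫₀¹ logⁱ(x) log^(j+1)(1+x) / x dx` -/
noncomputable def J (i j : ℕ) : ℝ := unitInt (fun x => l x ^ i * (p x ^ j * px x))

/-- `∫₀¹ logⁱ(x) logʲ(1+x) / (1+x) dx` -/
noncomputable def K (i j : ℕ) : ℝ := unitInt (fun x => l x ^ i * (p x ^ j * ic x))

theorem J_eq (i j : ℕ) : unitInt (fun x => l x ^ i * (p x ^ j * px x)) = J i j := rfl

theorem K_eq (i j : ℕ) : unitInt (fun x => l x ^ i * (p x ^ j * ic x)) = K i j := rfl

theorem K_succ (i j : ℕ) : K (i + 1) j = -((i + 1) / (j + 1)) * J i j := by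
  have h := unitInt_deriv (F := fun x => l x ^ (i + 1) * p x ^ (j + 1))
    (F' := fun x => (i + 1 : ℝ) * (l x ^ i * (p x ^ j * px x))
      + (j + 1 : ℝ) * (l x ^ (i + 1) * (p x ^ j * ic x))) (a := 0) (b := 0)
    (fun x hx => by
      refine (((hasDerivAt_l hx).pow (i + 1)).mul ((hasDerivAt_p hx).pow (j + 1))).congr_deriv ?_
      rw [Nat.add_sub_cancel, Nat.add_sub_cancel, px, ic]
      simp only [Pi.pow_apply]
      push_cast
      ring)
    (by fun_prop)
    (tendsto_zero_of_eq (G := fun x => l x ^ (i + 1) * p x ^ j * px x) (by fun_prop) fun x hx => by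
      simp only [pow_succ]; nth_rewrite 2 [p_eq hx]; ring)
    (tendsto_one_of_eq (G := fun x => l x ^ i * lc x * p x ^ (j + 1)) (by fun_prop) fun x hx => by
      simp only [pow_succ]; nth_rewrite 2 [l_eq hx]; ring)
  rw [unitInt_add (by fun_prop) (by fun_prop), unitInt_const_mul, unitInt_const_mul, J_eq,
    K_eq] at h
  have hj : (j + 1 : ℝ) ≠ 0 := by positivity
  field_simp
  linear_combination h

theorem K_zero (j : ℕ) : K 0 j = Real.log 2 ^ (j + 1) / (j + 1) := by
  have h := unitInt_deriv (F := fun x => p x ^ (j + 1))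
    (F' := fun x => (j + 1 : ℝ) * (l x ^ 0 * (p x ^ j * ic x)))
    (fun x hx => by
      refine ((hasDerivAt_p hx).pow (j + 1)).congr_deriv ?_
      rw [Nat.add_sub_cancel, ic]
      push_cast
      ring)
    (by fun_prop) (tendsto_p_zero.pow (j + 1)) (tendsto_p_one.pow (j + 1))
  rw [unitInt_const_mul, K_eq, zero_pow (by omega), sub_zero] at h
  have hj : (j + 1 : ℝ) ≠ 0 := by positivity
  field_simp
  linear_combination h

theorem J_zero_right (i : ℕ) : J i 0 = -((-1) ^ i * i.factorial * rpolylog (i + 2) (-1)) := by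
  rw [← unitInt_l_pow_px, ← J_eq]
  exact unitInt_congr fun x _ => by ring

theorem vmap_weight_four : -2 * rpolylog 4 1 = -J 2 0 + J 1 1 - 2 / 3 * J 0 2 := by
  have h0 := unitInt_l_pow_mx 2
  have h := unitInt_vmap (fun a b => a ^ 2 * b)
    (LogBdd.congr (F := fun x => l x ^ 2 * mx x) (by fun_prop) fun x _ => by rw [mx]; ring)
  rw [unitInt_congr (G := fun x => l x ^ 2 * mx x) fun x _ => by rw [mx]; ring, h0,
    unitInt_congr (F := fun x => (l x - p x) ^ 2 * -p x * (1 / x - ic x))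
      (G := fun x => (2 * (l x ^ 1 * (p x ^ 1 * px x)) - l x ^ 2 * (p x ^ 0 * px x)
        - l x ^ 0 * (p x ^ 2 * px x))
        + (l x ^ 2 * (p x ^ 1 * ic x) - 2 * (l x ^ 1 * (p x ^ 2 * ic x))
        + l x ^ 0 * (p x ^ 3 * ic x))) fun x _ => by rw [px]; ring,
    unitInt_congr (F := fun x => (-p x) ^ 2 * (l x - p x) * ic x)
      (G := fun x => l x ^ 1 * (p x ^ 2 * ic x) - l x ^ 0 * (p x ^ 3 * ic x)) fun x _ => by ring]
    at h
  simp (disch := fun_prop) only [unitInt_add, unitInt_sub, unitInt_const_mul, J_eq, K_eq,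
    K_succ] at h
  norm_num at h ⊢
  linarith

theorem vmap_weight_five :
    6 * rpolylog 5 1 = -J 3 0 + 3 / 2 * J 2 1 - J 1 2 + 1 / 2 * J 0 3 := by
  have h0 := unitInt_l_pow_mx 3
  have h := unitInt_vmap (fun a b => a ^ 3 * b)
    (LogBdd.congr (F := fun x => l x ^ 3 * mx x) (by fun_prop) fun x _ => by rw [mx]; ring)
  rw [unitInt_congr (G := fun x => l x ^ 3 * mx x) fun x _ => by rw [mx]; ring, h0,
    unitInt_congr (F := fun x => (l x - p x) ^ 3 * -p x * (1 / x - ic x))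
      (G := fun x => (3 * (l x ^ 2 * (p x ^ 1 * px x)) - l x ^ 3 * (p x ^ 0 * px x)
        - 3 * (l x ^ 1 * (p x ^ 2 * px x)) + l x ^ 0 * (p x ^ 3 * px x))
        + (l x ^ 3 * (p x ^ 1 * ic x) - 3 * (l x ^ 2 * (p x ^ 2 * ic x))
        + 3 * (l x ^ 1 * (p x ^ 3 * ic x)) - l x ^ 0 * (p x ^ 4 * ic x)))
      fun x _ => by rw [px]; ring,
    unitInt_congr (F := fun x => (-p x) ^ 3 * (l x - p x) * ic x)
      (G := fun x => l x ^ 0 * (p x ^ 4 * ic x) - l x ^ 1 * (p x ^ 3 * ic x)) fun x _ => by ring]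
    at h
  simp (disch := fun_prop) only [unitInt_add, unitInt_sub, unitInt_const_mul, J_eq, K_eq,
    K_succ] at h
  norm_num [Nat.factorial] at h ⊢
  linarith

theorem unitInt_l_sq_m_sq :
    unitInt (fun x => l x ^ 2 * (m x * mx x)) = J 2 1 - 2 * J 1 2 + J 0 3 := by
  have h := unitInt_vmap (fun a b => a ^ 2 * b ^ 2)
    (LogBdd.congr (F := fun x => l x ^ 2 * (m x * mx x)) (by fun_prop)
      fun x _ => by rw [mx]; ring)
  rw [unitInt_congr (G := fun x => l x ^ 2 * (m x * mx x)) fun x _ => by rw [mx]; ring,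
    unitInt_congr (F := fun x => (l x - p x) ^ 2 * (-p x) ^ 2 * (1 / x - ic x))
      (G := fun x => (l x ^ 2 * (p x ^ 1 * px x) - 2 * (l x ^ 1 * (p x ^ 2 * px x))
        + l x ^ 0 * (p x ^ 3 * px x)) - (l x - p x) ^ 2 * p x ^ 2 * ic x)
      fun x _ => by rw [px]; ring,
    unitInt_congr (F := fun x => (-p x) ^ 2 * (l x - p x) ^ 2 * ic x)
      (G := fun x => (l x - p x) ^ 2 * p x ^ 2 * ic x) fun x _ => by ring] at h
  simp (disch := fun_prop) only [unitInt_add, unitInt_sub, unitInt_const_mul, J_eq] at h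
  linarith

/-- `∫₀¹ log^(i+1)(1-x) logʲ(1+x) / x dx` -/
noncomputable def M (i j : ℕ) : ℝ := unitInt (fun x => m x ^ i * (p x ^ j * mx x))

theorem M_eq (i j : ℕ) : unitInt (fun x => m x ^ i * (p x ^ j * mx x)) = M i j := rfl

theorem M_zero_right (i : ℕ) : M i 0 = (-1) ^ (i + 1) * (i + 1).factorial * rpolylog (i + 2) 1 := by
  rw [← unitInt_l_pow_lc, ← M_eq, ← unitInt_reflect]
  refine unitInt_congr fun x _ => ?_
  rw [m, mx, m, lc, l, sub_sub_cancel]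
  ring

theorem unitInt_add_pow_div (n : ℕ) :
    unitInt (fun x => (m x + p x) ^ (n + 1) / x) = 1 / 2 * M n 0 := by
  have h := unitInt_sq_inv (fun _ b => b ^ (n + 1))
  rw [unitInt_congr (G := fun x => m x ^ n * (p x ^ 0 * mx x)) fun x _ => by rw [mx]; ring,
    M_eq] at h
  linarith

theorem unitInt_sub_pow_div (n : ℕ) :
    unitInt (fun x => (m x - p x) ^ (n + 1) / x) = M n 0 + K (n + 1) 0 := by
  have h := unitInt_dual_inv (fun a _ => a ^ (n + 1))
  rw [unitInt_congr (G := fun x => l x ^ n * lc x + l x ^ (n + 1) * (p x ^ 0 * ic x))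
      (F := fun x => l x ^ (n + 1) * (1 / (1 - x) + ic x)) fun x _ => by rw [lc]; ring,
    unitInt_add (by fun_prop) (by fun_prop), unitInt_l_pow_lc, ← M_zero_right, K_eq] at h
  exact h

theorem two_logs :
    M 1 0 + 2 * M 0 1 + J 0 1 = 1 / 2 * M 1 0 ∧ M 1 0 - 2 * M 0 1 + J 0 1 = M 1 0 + K 2 0 := by
  constructor
  · rw [← unitInt_add_pow_div 1, unitInt_congr (G := fun x => m x ^ 1 * (p x ^ 0 * mx x)
      + 2 * (m x ^ 0 * (p x ^ 1 * mx x)) + l x ^ 0 * (p x ^ 1 * px x))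
      fun x _ => by rw [mx, px]; ring]
    simp (disch := fun_prop) only [unitInt_add, unitInt_const_mul, J_eq, M_eq]
  · rw [← unitInt_sub_pow_div 1, unitInt_congr (G := fun x => m x ^ 1 * (p x ^ 0 * mx x)
      - 2 * (m x ^ 0 * (p x ^ 1 * mx x)) + l x ^ 0 * (p x ^ 1 * px x))
      fun x _ => by rw [mx, px]; ring]
    simp (disch := fun_prop) only [unitInt_add, unitInt_sub, unitInt_const_mul, J_eq, M_eq]

theorem three_logs :
    M 2 0 + 3 * M 1 1 + 3 * M 0 2 + J 0 2 = 1 / 2 * M 2 0 ∧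
      M 2 0 - 3 * M 1 1 + 3 * M 0 2 - J 0 2 = M 2 0 + K 3 0 := by
  constructor
  · rw [← unitInt_add_pow_div 2, unitInt_congr (G := fun x => m x ^ 2 * (p x ^ 0 * mx x)
      + 3 * (m x ^ 1 * (p x ^ 1 * mx x)) + 3 * (m x ^ 0 * (p x ^ 2 * mx x))
      + l x ^ 0 * (p x ^ 2 * px x)) fun x _ => by rw [mx, px]; ring]
    simp (disch := fun_prop) only [unitInt_add, unitInt_const_mul, J_eq, M_eq]
  · rw [← unitInt_sub_pow_div 2, unitInt_congr (G := fun x => m x ^ 2 * (p x ^ 0 * mx x)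
      - 3 * (m x ^ 1 * (p x ^ 1 * mx x)) + 3 * (m x ^ 0 * (p x ^ 2 * mx x))
      - l x ^ 0 * (p x ^ 2 * px x)) fun x _ => by rw [mx, px]; ring]
    simp (disch := fun_prop) only [unitInt_add, unitInt_sub, unitInt_const_mul, J_eq, M_eq]

theorem four_logs :
    M 3 0 + 4 * M 2 1 + 6 * M 1 2 + 4 * M 0 3 + J 0 3 = 1 / 2 * M 3 0 ∧
      M 3 0 - 4 * M 2 1 + 6 * M 1 2 - 4 * M 0 3 + J 0 3 = M 3 0 + K 4 0 := by
  constructor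
  · rw [← unitInt_add_pow_div 3, unitInt_congr (G := fun x => m x ^ 3 * (p x ^ 0 * mx x)
      + 4 * (m x ^ 2 * (p x ^ 1 * mx x)) + 6 * (m x ^ 1 * (p x ^ 2 * mx x))
      + 4 * (m x ^ 0 * (p x ^ 3 * mx x)) + l x ^ 0 * (p x ^ 3 * px x))
      fun x _ => by rw [mx, px]; ring]
    simp (disch := fun_prop) only [unitInt_add, unitInt_const_mul, J_eq, M_eq]
  · rw [← unitInt_sub_pow_div 3, unitInt_congr (G := fun x => m x ^ 3 * (p x ^ 0 * mx x)
      - 4 * (m x ^ 2 * (p x ^ 1 * mx x)) + 6 * (m x ^ 1 * (p x ^ 2 * mx x))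
      - 4 * (m x ^ 0 * (p x ^ 3 * mx x)) + l x ^ 0 * (p x ^ 3 * px x))
      fun x _ => by rw [mx, px]; ring]
    simp (disch := fun_prop) only [unitInt_add, unitInt_sub, unitInt_const_mul, J_eq, M_eq]

theorem unitInt_l_cube_pc :
    unitInt (fun x => l x ^ 3 * pc x) = Real.log 2 * K 3 0 - K 3 1
      - (M 2 1 - 3 * M 1 2 + 3 * M 0 3 - J 0 3) := by
  have h := unitInt_dual_inv (fun a b => a ^ 3 * b)
  rw [unitInt_congr (F := fun x => (m x - p x) ^ 3 * p x / x)
      (G := fun x => m x ^ 2 * (p x ^ 1 * mx x) - 3 * (m x ^ 1 * (p x ^ 2 * mx x))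
        + 3 * (m x ^ 0 * (p x ^ 3 * mx x)) - l x ^ 0 * (p x ^ 3 * px x))
      fun x _ => by rw [mx, px]; ring,
    unitInt_congr (F := fun x => l x ^ 3 * (Real.log 2 - p x) * (1 / (1 - x) + ic x))
      (G := fun x => Real.log 2 * (l x ^ 3 * (p x ^ 0 * ic x)) - l x ^ 3 * (p x ^ 1 * ic x)
        - l x ^ 3 * pc x) fun x _ => by rw [pc]; ring] at h
  simp (disch := fun_prop) only [unitInt_add, unitInt_sub, unitInt_const_mul, J_eq, M_eq,
    K_eq] at h
  linarith

theorem unitInt_l_sq_p_pc :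
    unitInt (fun x => l x ^ 2 * ((p x + Real.log 2) * pc x)) = Real.log 2 ^ 2 * K 2 0 - K 2 2
      + (M 1 2 - 2 * M 0 3 + J 0 3) - 2 * Real.log 2 * (M 1 1 - 2 * M 0 2 + J 0 2) := by
  have h := unitInt_dual_inv (fun a b => a ^ 2 * (b ^ 2 - 2 * Real.log 2 * b))
  rw [unitInt_congr (F := fun x => (m x - p x) ^ 2 * (p x ^ 2 - 2 * Real.log 2 * p x) / x)
      (G := fun x => m x ^ 1 * (p x ^ 2 * mx x) - 2 * (m x ^ 0 * (p x ^ 3 * mx x))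
        + l x ^ 0 * (p x ^ 3 * px x) - 2 * Real.log 2 * (m x ^ 1 * (p x ^ 1 * mx x)
        - 2 * (m x ^ 0 * (p x ^ 2 * mx x)) + l x ^ 0 * (p x ^ 2 * px x)))
      fun x _ => by rw [mx, px]; ring,
    unitInt_congr (F := fun x => l x ^ 2 * ((Real.log 2 - p x) ^ 2
        - 2 * Real.log 2 * (Real.log 2 - p x)) * (1 / (1 - x) + ic x))
      (G := fun x => l x ^ 2 * ((p x + Real.log 2) * pc x) + l x ^ 2 * (p x ^ 2 * ic x)
        - Real.log 2 ^ 2 * (l x ^ 2 * (p x ^ 0 * ic x))) fun x _ => by rw [pc]; ring] at h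
  simp (disch := fun_prop) only [unitInt_add, unitInt_sub, unitInt_const_mul, J_eq, M_eq,
    K_eq] at h
  linarith

section InverseArgument

theorem hasDerivAt_rpolylog_inv (k : ℕ) {x : ℝ} (hx : x ∈ Ioo (0 : ℝ) 1) :
    HasDerivAt (fun x => rpolylog (k + 1) (1 / (1 + x)))
      (-(rpolylog k (1 / (1 + x)) * ic x)) x := by
  have h1 : 0 < 1 + x := by linarith [hx.1]
  have habs : |1 / (1 + x)| < 1 := by
    rw [abs_of_pos (by positivity), div_lt_one h1]; linarith [hx.1]
  have h := (hasDerivAt_rpolylog k habs (by positivity)).comp x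
    ((hasDerivAt_const x (1 : ℝ)).div ((hasDerivAt_id x).const_add 1) h1.ne')
  refine h.congr_deriv ?_
  simp only [id, ic]
  field_simp
  ring

theorem logBdd_rpolylog_inv (k : ℕ) : LogBdd (fun x => rpolylog (k + 1) (1 / (1 + x))) := by
  refine LogBdd.mono (F := fun x => p x - l x) (by fun_prop)
    (fun x hx => (hasDerivAt_rpolylog_inv k hx).continuousAt.continuousWithinAt) fun x hx => ?_
  have h1 : 0 < 1 + x := by linarith [hx.1]
  have h2 : |1 / (1 + x)| ≤ 1 / (1 + x) := le_of_eq (abs_of_pos (by positivity))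
  refine (abs_rpolylog_le_log (by omega) h2 ?_).trans (le_of_eq_of_le ?_ (le_abs_self _))
  · rw [div_lt_one h1]; linarith [hx.1]
  · have := m_right hx
    rw [m] at this
    rw [this]; ring

theorem tendsto_rpolylog_inv {k : ℕ} (hk : 2 ≤ k) :
    Tendsto (fun x => rpolylog k (1 / (1 + x))) (𝓝[>] 0) (𝓝 (rpolylog k 1)) ∧
      Tendsto (fun x => rpolylog k (1 / (1 + x))) (𝓝[<] 1) (𝓝 (rpolylog k (1 / 2))) := by
  have hc : ContinuousOn (fun x : ℝ => rpolylog k (1 / (1 + x))) (Icc 0 1) := by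
    refine (continuousOn_rpolylog hk).comp
      (continuousOn_const.div (by fun_prop) fun x hx => by linarith [hx.1]) fun x hx => ?_
    have h1 : 0 < 1 + x := by linarith [hx.1]
    refine abs_le.1 ?_
    rw [abs_of_pos (by positivity), div_le_one h1]
    linarith [hx.1]
  constructor
  · have := (hc 0 (by simp)).tendsto
    rw [add_zero, div_one] at this
    refine this.mono_left ?_
    rw [← nhdsWithin_Ioo_eq_nhdsGT (zero_lt_one' ℝ)]
    exact nhdsWithin_mono _ Ioo_subset_Icc_self
  · have := (hc 1 (by simp)).tendsto
    rw [one_add_one_eq_two] at this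
    refine this.mono_left ?_
    rw [← nhdsWithin_Ioo_eq_nhdsLT (zero_lt_one' ℝ)]
    exact nhdsWithin_mono _ Ioo_subset_Icc_self

/-- `∫₀¹ logⁿ(1+x) Liₖ₊₁(1/(1+x)) / (1+x) dx` -/
noncomputable def T (n k : ℕ) : ℝ :=
  unitInt (fun x => p x ^ n * (rpolylog (k + 1) (1 / (1 + x)) * ic x))

theorem T_zero (k : ℕ) : T 0 k = rpolylog (k + 2) 1 - rpolylog (k + 2) (1 / 2) := by
  have hb := logBdd_rpolylog_inv k
  have ht := tendsto_rpolylog_inv (k := k + 2) (by omega)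
  have h := unitInt_deriv (fun x hx => hasDerivAt_rpolylog_inv (k + 1) hx) (by fun_prop)
    ht.1 ht.2
  rw [unitInt_neg] at h
  rw [T, unitInt_congr (G := fun x => rpolylog (k + 1) (1 / (1 + x)) * ic x) fun x _ => by ring]
  linarith

theorem T_succ (n k : ℕ) : T (n + 1) k
    = (n + 1) * T n (k + 1) - Real.log 2 ^ (n + 1) * rpolylog (k + 2) (1 / 2) := by
  have hb := logBdd_rpolylog_inv k
  have hb1 := logBdd_rpolylog_inv (k + 1)
  have ht := tendsto_rpolylog_inv (k := k + 2) (by omega)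
  have h := unitInt_deriv (F := fun x => p x ^ (n + 1) * rpolylog (k + 2) (1 / (1 + x)))
    (F' := fun x => (n + 1 : ℝ) * (p x ^ n * (rpolylog (k + 1 + 1) (1 / (1 + x)) * ic x))
      - p x ^ (n + 1) * (rpolylog (k + 1) (1 / (1 + x)) * ic x))
    (fun x hx => by
      refine (((hasDerivAt_p hx).pow (n + 1)).mul (hasDerivAt_rpolylog_inv (k + 1) hx)).congr_deriv
        ?_
      rw [Nat.add_sub_cancel]
      simp only [Pi.pow_apply, ic]
      push_cast
      ring)
    (by fun_prop) ((tendsto_p_zero.pow (n + 1)).mul ht.1) ((tendsto_p_one.pow (n + 1)).mul ht.2)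
  rw [unitInt_sub (by fun_prop) (by fun_prop), unitInt_const_mul, zero_pow (by omega)] at h
  rw [T, T]
  linarith

theorem T_one (n : ℕ) : T n 0 = Real.log 2 ^ (n + 2) / (n + 2) + J 0 n / (n + 1) := by
  have h1 := K_zero (n + 1)
  have h2 := K_succ 0 n
  rw [T, unitInt_congr (G := fun x => l x ^ 0 * (p x ^ (n + 1) * ic x) - l x ^ 1 * (p x ^ n * ic x))
    fun x hx => by
      have h1 : 0 < 1 + x := by linarith [hx.1]
      have h3 := m_right hx
      rw [m] at h3
      rw [rpolylog_one, h3]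
      · ring
      · rw [abs_of_pos (by positivity), div_lt_one h1]; linarith [hx.1]]
  rw [unitInt_sub (by fun_prop) (by fun_prop), K_eq, K_eq, h1]
  rw [zero_add] at h2
  rw [h2]
  push_cast
  ring

end InverseArgument

theorem mem_left {x : ℝ} (hx : x ∈ Ioo (0 : ℝ) 1) : x / (1 + x) ∈ Ioo (0 : ℝ) 1 := by
  have h1 : 0 < 1 + x := by linarith [hx.1]
  exact ⟨div_pos hx.1 h1, by rw [div_lt_one h1]; linarith⟩

theorem mem_right {x : ℝ} (hx : x ∈ Ioo (0 : ℝ) 1) : 1 / (1 + x) ∈ Ioo (0 : ℝ) 1 := by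
  have h1 : 0 < 1 + x := by linarith [hx.1]
  exact ⟨by positivity, by rw [div_lt_one h1]; linarith [hx.1]⟩

/-- Landen's identity for the dilogarithm. -/
theorem r2_left {x : ℝ} (hx : x ∈ Ioo (0 : ℝ) 1) :
    r2 (x / (1 + x)) = -q2 x - 1 / 2 * p x ^ 2 := by
  have h := eq_of_deriv_eq_zero (F := fun x => r2 (x / (1 + x)) + (q2 x + 1 / 2 * p x ^ 2))
    (a := 0) (fun y hy => by
      have h1 : 0 < 1 + y := by linarith [hy.1]
      have h0 := hy.1
      have hd := ((hasDerivAt_r2 (mem_left hy)).comp y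
        ((hasDerivAt_id y).div ((hasDerivAt_id y).const_add 1) h1.ne')).add
        ((hasDerivAt_q2 hy).add (((hasDerivAt_p hy).pow 2).const_mul (1 / 2)))
      refine hd.congr_deriv ?_
      rw [m_left hy]
      simp only [id]
      push_cast
      field_simp
      ring)
    (by
      have h1 : Tendsto (fun x : ℝ => r2 (x / (1 + x))) (𝓝[>] 0) (𝓝 0) := by
        refine tendsto_r2_zero.comp (tendsto_nhdsWithin_iff.2 ⟨?_, ?_⟩)
        · have : ContinuousAt (fun x : ℝ => x / (1 + x)) 0 :=
            continuousAt_id.div (by fun_prop) (by norm_num)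
          have := this.tendsto
          rw [zero_div] at this
          exact this.mono_left nhdsWithin_le_nhds
        · filter_upwards [Ioo_mem_nhdsGT (zero_lt_one' ℝ)] with y hy using (mem_left hy).1
      have := h1.add (tendsto_q2_zero.add ((tendsto_p_zero.pow 2).const_mul (1 / 2)))
      simpa using this) hx
  linarith

theorem r2_right {x : ℝ} (hx : x ∈ Ioo (0 : ℝ) 1) :
    r2 (1 / (1 + x)) = Real.pi ^ 2 / 6 + l x * p x - 1 / 2 * p x ^ 2 + q2 x := by
  have h := eq_of_deriv_eq_zero
    (F := fun x => r2 (1 / (1 + x)) - (l x * p x - 1 / 2 * p x ^ 2 + q2 x))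
    (a := Real.pi ^ 2 / 6) (fun y hy => by
      have h1 : 0 < 1 + y := by linarith [hy.1]
      have h0 := hy.1
      have hd := ((hasDerivAt_r2 (mem_right hy)).comp y
        ((hasDerivAt_const y (1 : ℝ)).div ((hasDerivAt_id y).const_add 1) h1.ne')).sub
        ((((hasDerivAt_l hy).mul (hasDerivAt_p hy)).sub
          (((hasDerivAt_p hy).pow 2).const_mul (1 / 2))).add (hasDerivAt_q2 hy))
      refine hd.congr_deriv ?_
      rw [m_right hy]
      simp only [id]
      push_cast
      field_simp
      ring)
    (by
      have h1 := (tendsto_rpolylog_inv (k := 2) le_rfl).1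
      rw [rpolylog_two_one] at h1
      have h2 : Tendsto (fun x => l x * p x) (𝓝[>] 0) (𝓝 0) :=
        tendsto_zero_of_eq (G := fun x => l x * px x) (by fun_prop)
          fun x hx => by rw [p_eq hx]; ring
      have := h1.sub ((h2.sub ((tendsto_p_zero.pow 2).const_mul (1 / 2))).add tendsto_q2_zero)
      simpa [r2] using this) hx
  linarith

/-- `∫₀¹ Li₂(x)² / x dx` -/
noncomputable def U : ℝ := unitInt (fun x => r2 x * r2x x)
/-- `∫₀¹ Li₂(-x)² / x dx` -/
noncomputable def V : ℝ := unitInt (fun x => q2 x * q2x x)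
/-- `∫₀¹ Li₂(-x) log²(1+x) / x dx` -/
noncomputable def Y : ℝ := unitInt (fun x => q2 x * (p x * px x))
/-- `∫₀¹ Li₃(-x) log(1-x) / (1+x) dx` -/
noncomputable def N : ℝ := unitInt (fun x => q3 x * (m x * ic x))

theorem unitInt_q3_px : unitInt (fun x => q3 x * px x) = V - q2 1 * q3 1 := by
  have h := unitInt_deriv (F := fun x => q2 x * q3 x)
    (F' := fun x => q2 x * q2x x - q3 x * px x) (fun x hx => by
      refine ((hasDerivAt_q2 hx).mul (hasDerivAt_q3 hx)).congr_deriv ?_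
      rw [q2x, px]; ring)
    (by fun_prop) (tendsto_q2_zero.mul tendsto_q3_zero) (tendsto_q2_one.mul tendsto_q3_one)
  rw [unitInt_sub (by fun_prop) (by fun_prop)] at h
  rw [V]; linarith

theorem unitInt_q3_l_ic :
    unitInt (fun x => q3 x * (l x * ic x)) = q2 1 * q3 1 - 3 / 2 * V := by
  have h := unitInt_deriv (F := fun x => l x * (q3 x * p x + 1 / 2 * q2 x ^ 2) + q2 x * q3 x)
    (F' := fun x => q3 x * (l x * ic x) + 3 / 2 * (q2 x * q2x x)) (fun x hx => by
      refine (((hasDerivAt_l hx).mul (((hasDerivAt_q3 hx).mul (hasDerivAt_p hx)).add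
        (((hasDerivAt_q2 hx).pow 2).const_mul (1 / 2)))).add
        ((hasDerivAt_q2 hx).mul (hasDerivAt_q3 hx))).congr_deriv ?_
      simp only [Pi.add_apply, Pi.mul_apply, Pi.pow_apply]
      rw [ic, q2x]; push_cast; ring)
    (by fun_prop)
    (tendsto_zero_of_eq (G := fun x => l x * (q3x x * p x + 1 / 2 * q2 x * q2x x) + q2x x * q3 x)
      (by fun_prop) fun x hx => by
        rw [pow_two]; nth_rewrite 1 [q3_eq hx]; nth_rewrite 2 [q2_eq hx]
        nth_rewrite 2 [q2_eq hx]; ring)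
    ((tendsto_l_one.mul ((tendsto_q3_one.mul tendsto_p_one).add
      ((tendsto_q2_one.pow 2).const_mul (1 / 2)))).add (tendsto_q2_one.mul tendsto_q3_one))
  rw [unitInt_add (by fun_prop) (by fun_prop), unitInt_const_mul] at h
  rw [V]; linarith

theorem unitInt_q3_p_ic :
    unitInt (fun x => q3 x * (p x * ic x)) = 1 / 2 * Real.log 2 ^ 2 * q3 1 - 1 / 2 * Y := by
  have h := unitInt_deriv (F := fun x => 1 / 2 * p x ^ 2 * q3 x)
    (F' := fun x => q3 x * (p x * ic x) + 1 / 2 * (q2 x * (p x * px x))) (fun x hx => by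
      refine ((((hasDerivAt_p hx).pow 2).const_mul (1 / 2)).mul (hasDerivAt_q3 hx)).congr_deriv ?_
      simp only [Pi.pow_apply]
      rw [ic, px]; push_cast; ring)
    (by fun_prop)
    (((tendsto_p_zero.pow 2).const_mul (1 / 2)).mul tendsto_q3_zero)
    (((tendsto_p_one.pow 2).const_mul (1 / 2)).mul tendsto_q3_one)
  rw [unitInt_add (by fun_prop) (by fun_prop), unitInt_const_mul] at h
  rw [Y]; linarith

theorem unitInt_q4_ic :
    unitInt (fun x => q4 x * ic x) = Real.log 2 * q4 1 + q2 1 * q3 1 - V := by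
  have h := unitInt_deriv (F := fun x => p x * q4 x)
    (F' := fun x => q4 x * ic x + q3 x * px x) (fun x hx => by
      refine ((hasDerivAt_p hx).mul (hasDerivAt_q4 hx)).congr_deriv ?_
      rw [ic, px]; ring)
    (by fun_prop) (tendsto_p_zero.mul tendsto_q4_zero) (tendsto_p_one.mul tendsto_q4_one)
  rw [unitInt_add (by fun_prop) (by fun_prop), unitInt_q3_px] at h
  linarith

theorem unitInt_q2_ic : unitInt (fun x => q2 x * ic x) = Real.log 2 * q2 1 + J 0 1 := by
  have h := unitInt_deriv (F := fun x => p x * q2 x)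
    (F' := fun x => q2 x * ic x - l x ^ 0 * (p x ^ 1 * px x)) (fun x hx => by
      refine ((hasDerivAt_p hx).mul (hasDerivAt_q2 hx)).congr_deriv ?_
      rw [ic, px]; ring)
    (by fun_prop) (tendsto_p_zero.mul tendsto_q2_zero) (tendsto_p_one.mul tendsto_q2_one)
  rw [unitInt_sub (by fun_prop) (by fun_prop), J_eq] at h
  linarith

theorem unitInt_q2_l_p_ic :
    unitInt (fun x => q2 x * (l x * (p x * ic x))) = 1 / 2 * J 1 2 - 1 / 2 * Y := by
  have h := unitInt_deriv (F := fun x => 1 / 2 * p x ^ 2 * (l x * q2 x))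
    (F' := fun x => q2 x * (l x * (p x * ic x)) + 1 / 2 * (q2 x * (p x * px x))
      - 1 / 2 * (l x ^ 1 * (p x ^ 2 * px x))) (fun x hx => by
      refine ((((hasDerivAt_p hx).pow 2).const_mul (1 / 2)).mul
        ((hasDerivAt_l hx).mul (hasDerivAt_q2 hx))).congr_deriv ?_
      simp only [Pi.pow_apply, Pi.mul_apply]
      rw [ic, px]; push_cast; ring)
    (by fun_prop)
    (tendsto_zero_of_eq (G := fun x => 1 / 2 * p x ^ 2 * (l x * q2x x)) (by fun_prop)
      fun x hx => by rw [q2_eq hx]; ring)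
    (((tendsto_p_one.pow 2).const_mul (1 / 2)).mul (tendsto_l_one.mul tendsto_q2_one))
  simp (disch := fun_prop) only [unitInt_add, unitInt_sub, unitInt_const_mul, J_eq] at h
  rw [Y]; linarith

theorem unitInt_q2_p_sq_ic :
    unitInt (fun x => q2 x * (p x ^ 2 * ic x)) = 1 / 3 * Real.log 2 ^ 3 * q2 1 + 1 / 3 * J 0 3 := by
  have h := unitInt_deriv (F := fun x => 1 / 3 * p x ^ 3 * q2 x)
    (F' := fun x => q2 x * (p x ^ 2 * ic x) - 1 / 3 * (l x ^ 0 * (p x ^ 3 * px x))) (fun x hx => by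
      refine ((((hasDerivAt_p hx).pow 3).const_mul (1 / 3)).mul (hasDerivAt_q2 hx)).congr_deriv ?_
      simp only [Pi.pow_apply]
      rw [ic, px]; push_cast; ring)
    (by fun_prop)
    (((tendsto_p_zero.pow 3).const_mul (1 / 3)).mul tendsto_q2_zero)
    (((tendsto_p_one.pow 3).const_mul (1 / 3)).mul tendsto_q2_one)
  simp (disch := fun_prop) only [unitInt_sub, unitInt_const_mul, J_eq] at h
  linarith

theorem U_eq_V : U = V + Y + 1 / 4 * J 0 3 + (Real.pi ^ 2 / 6) ^ 2 * K 0 0 + K 2 2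
    + 2 * (Real.pi ^ 2 / 6) * K 1 1 - Real.pi ^ 2 / 6 * K 0 2 - K 1 3
    + 2 * (Real.pi ^ 2 / 6) * (Real.log 2 * q2 1 + J 0 1) + (J 1 2 - Y)
    - 2 * (1 / 3 * Real.log 2 ^ 3 * q2 1 + 1 / 3 * J 0 3) := by
  have h := unitInt_halves (F := fun x => r2 x * r2x x) (by fun_prop)
  rw [unitInt_congr (F := fun x => 1 / (1 + x) ^ 2 * (r2 (x / (1 + x)) * r2x (x / (1 + x))))
      (G := fun x => q2 x * q2x x + q2 x * (p x * px x) + 1 / 4 * (l x ^ 0 * (p x ^ 3 * px x))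
        - (q2 x + 1 / 2 * p x ^ 2) ^ 2 * ic x) fun x hx => by
      have h1 : 0 < 1 + x := by linarith [hx.1]
      have h0 := hx.1
      rw [r2x, r2_left hx, ic, px, q2x]
      field_simp
      ring,
    unitInt_congr (F := fun x => 1 / (1 + x) ^ 2 * (r2 (1 / (1 + x)) * r2x (1 / (1 + x))))
      (G := fun x => (q2 x + 1 / 2 * p x ^ 2) ^ 2 * ic x
        + ((Real.pi ^ 2 / 6) ^ 2 * (l x ^ 0 * (p x ^ 0 * ic x)) + l x ^ 2 * (p x ^ 2 * ic x)
        + 2 * (Real.pi ^ 2 / 6) * (l x ^ 1 * (p x ^ 1 * ic x))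
        - Real.pi ^ 2 / 6 * (l x ^ 0 * (p x ^ 2 * ic x)) - l x ^ 1 * (p x ^ 3 * ic x)
        + 2 * (Real.pi ^ 2 / 6) * (q2 x * ic x) + 2 * (q2 x * (l x * (p x * ic x)))
        - 2 * (q2 x * (p x ^ 2 * ic x)))) fun x hx => by
      have h1 : 0 < 1 + x := by linarith [hx.1]
      rw [r2x, r2_right hx, ic]
      field_simp
      ring] at h
  rw [unitInt_sub (by fun_prop) (by fun_prop),
    unitInt_add (F := fun x => (q2 x + 1 / 2 * p x ^ 2) ^ 2 * ic x) (by fun_prop) (by fun_prop)] at h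
  simp (disch := fun_prop) only [unitInt_add, unitInt_sub, unitInt_const_mul, J_eq, K_eq,
    unitInt_q2_ic, unitInt_q2_l_p_ic, unitInt_q2_p_sq_ic] at h
  rw [U, V, Y] at *
  linarith

theorem unitInt_l_m_ic :
    unitInt (fun x => l x * (m x * ic x))
      = unitInt (fun x => l x * pc x) - M 0 1 + Real.log 2 * M 0 0 := by
  have h := unitInt_deriv (F := fun x => l x * (m x * (p x - Real.log 2)))
    (F' := fun x => l x * (m x * ic x) - l x * pc x + m x ^ 0 * (p x ^ 1 * mx x)
      - Real.log 2 * (m x ^ 0 * (p x ^ 0 * mx x))) (a := 0) (b := 0) (fun x hx => by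
      refine ((hasDerivAt_l hx).mul ((hasDerivAt_m hx).mul
        ((hasDerivAt_p hx).sub_const (Real.log 2)))).congr_deriv ?_
      simp only [Pi.mul_apply]
      rw [ic, mx, pc]; ring)
    (by fun_prop)
    (tendsto_zero_of_eq (G := fun x => l x * (mx x * (p x - Real.log 2))) (by fun_prop)
      fun x hx => by rw [m_eq hx]; ring)
    (tendsto_one_of_eq (G := fun x => lc x * (m x * (p x - Real.log 2))) (by fun_prop)
      fun x hx => by rw [l_eq hx]; ring)
  simp (disch := fun_prop) only [unitInt_add, unitInt_sub, unitInt_const_mul, M_eq] at h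
  linarith

theorem unitInt_l_pc :
    unitInt (fun x => l x * pc x) = Real.log 2 * K 1 0 - K 1 1 - (M 0 1 - J 0 1) := by
  have h := unitInt_dual_inv (fun a b => a * b)
  rw [unitInt_congr (F := fun x => (m x - p x) * p x / x)
      (G := fun x => m x ^ 0 * (p x ^ 1 * mx x) - l x ^ 0 * (p x ^ 1 * px x))
      fun x _ => by rw [mx, px]; ring,
    unitInt_congr (F := fun x => l x * (Real.log 2 - p x) * (1 / (1 - x) + ic x))
      (G := fun x => Real.log 2 * (l x ^ 1 * (p x ^ 0 * ic x)) - l x ^ 1 * (p x ^ 1 * ic x)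
        - l x * pc x) fun x _ => by rw [pc]; ring] at h
  simp (disch := fun_prop) only [unitInt_sub, unitInt_const_mul, J_eq, M_eq, K_eq] at h
  linarith

theorem unitInt_l_cube_m_ic :
    unitInt (fun x => l x ^ 3 * (m x * ic x)) = unitInt (fun x => l x ^ 3 * pc x)
      - 3 * unitInt (fun x => l x ^ 2 * (p x * mx x))
      + 3 * Real.log 2 * unitInt (fun x => l x ^ 2 * mx x) := by
  have h := unitInt_deriv (F := fun x => l x ^ 3 * (m x * (p x - Real.log 2)))
    (F' := fun x => l x ^ 3 * (m x * ic x) - l x ^ 3 * pc x + 3 * (l x ^ 2 * (p x * mx x))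
      - 3 * Real.log 2 * (l x ^ 2 * mx x)) (a := 0) (b := 0) (fun x hx => by
      refine (((hasDerivAt_l hx).pow 3).mul ((hasDerivAt_m hx).mul
        ((hasDerivAt_p hx).sub_const (Real.log 2)))).congr_deriv ?_
      simp only [Pi.mul_apply, Pi.pow_apply]
      rw [ic, mx, pc]; push_cast; ring)
    (by fun_prop)
    (tendsto_zero_of_eq (G := fun x => l x ^ 3 * (mx x * (p x - Real.log 2))) (by fun_prop)
      fun x hx => by rw [m_eq hx]; ring)
    (tendsto_one_of_eq (G := fun x => l x ^ 2 * lc x * (m x * (p x - Real.log 2))) (by fun_prop)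
      fun x hx => by rw [pow_succ (l x) 2]; nth_rewrite 2 [l_eq hx]; ring)
  simp (disch := fun_prop) only [unitInt_add, unitInt_sub, unitInt_const_mul] at h
  linarith

theorem unitInt_l_sq_p_mx :
    2 * unitInt (fun x => l x ^ 2 * (p x * mx x))
      = -(7 / 8) * unitInt (fun x => l x ^ 2 * (m x * mx x)) - J 2 1 := by
  have h := unitInt_sq_inv (fun a b => a ^ 2 * b ^ 2)
  rw [unitInt_congr (G := fun x => l x ^ 2 * (m x * mx x)) fun x _ => by rw [mx]; ring,
    unitInt_congr (F := fun x => (2 * l x) ^ 2 * (m x + p x) ^ 2 / x)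
      (G := fun x => 4 * (l x ^ 2 * (m x * mx x)) + 8 * (l x ^ 2 * (p x * mx x))
        + 4 * (l x ^ 2 * (p x ^ 1 * px x))) fun x _ => by rw [mx, px]; ring] at h
  simp (disch := fun_prop) only [unitInt_add, unitInt_const_mul, J_eq] at h
  linarith

theorem unitInt_q3_sub_div :
    unitInt (fun x => q3 x * mx x) - unitInt (fun x => q3 x * px x)
      = q3 1 * (q2 1 - Real.pi ^ 2 / 6) - 3 / 2 * V - 7 / 16 * U := by
  have h := unitInt_deriv (F := fun x => q3 x * (q2 x - r2 x))
    (F' := fun x => q2 x * q2x x - q2 x * r2x x + (q3 x * mx x - q3 x * px x)) (fun x hx => by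
      refine ((hasDerivAt_q3 hx).mul ((hasDerivAt_q2 hx).sub (hasDerivAt_r2 hx))).congr_deriv ?_
      simp only [Pi.sub_apply]
      rw [px, mx, q2x, r2x]; ring)
    (by fun_prop) (tendsto_q3_zero.mul (tendsto_q2_zero.sub tendsto_r2_zero))
    (tendsto_q3_one.mul (tendsto_q2_one.sub tendsto_r2_one))
  have h2 := unitInt_sq (fun x => r2 x * r2x x)
  rw [unitInt_congr (F := fun x => 2 * x * (r2 (x ^ 2) * r2x (x ^ 2)))
    (G := fun x => 8 * (r2 x * r2x x) + 8 * (q2 x * q2x x) + 16 * (q2 x * r2x x)) fun x hx => by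
      have h3 := rpolylog_add_neg (s := 2) le_rfl (x := x) (by rw [abs_of_pos hx.1]; exact hx.2.le)
      have h0 := hx.1.ne'
      have h4 : r2 (x ^ 2) = 2 * (r2 x + q2 x) := by rw [r2, r2, q2]; linarith
      rw [r2x, h4, r2x, q2x]
      field_simp
      ring] at h2
  simp (disch := fun_prop) only [unitInt_add, unitInt_sub, unitInt_const_mul] at h h2
  rw [U, V]
  linarith

theorem neg_mem {x : ℝ} (hx : x ∈ Ioo (0 : ℝ) 1) : |-x| ≤ 1 := by
  rw [abs_neg, abs_of_pos hx.1]; exact hx.2.le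

theorem mul_mem {x y : ℝ} (hx : x ∈ Ioo (0 : ℝ) 1) (hy : y ∈ Ioo (0 : ℝ) 1) :
    x * y ∈ Ioo (0 : ℝ) 1 :=
  ⟨mul_pos hx.1 hy.1, mul_lt_one_of_nonneg_of_lt_one_left hx.1.le hx.2 hy.2.le⟩

theorem logBdd_inv_one_add_mul {y : ℝ} (hy : y ∈ Ioo (0 : ℝ) 1) :
    LogBdd (fun x => 1 / (1 + x * y)) := by
  refine LogBdd.of_bounded (continuousOn_const.div (by fun_prop) fun x hx => ?_) 1 fun x hx => ?_
  · linarith [(mul_mem hx hy).1]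
  · have := (mul_mem hx hy).1
    rw [abs_of_pos (by positivity), div_le_one (by linarith)]
    linarith

theorem q2_eq_unitInt {x : ℝ} (hx : x ∈ Ioo (0 : ℝ) 1) :
    q2 x = unitInt (fun y => x * (l y * (1 / (1 + y * x)))) := by
  have h := unitInt_log_pow_mul_inv (neg_mem hx) 0
  rw [unitInt_congr (G := fun y => -(x * (l y * (1 / (1 + y * x))))) fun y _ => by
    rw [show 1 - -x * y = 1 + y * x by ring]; ring, unitInt_neg] at h
  rw [q2]
  norm_num at h ⊢
  linarith

theorem q3_eq_unitInt {x : ℝ} (hx : x ∈ Ioo (0 : ℝ) 1) :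
    q3 x = unitInt (fun y => -(1 / 2) * (x * (l y ^ 2 * (1 / (1 + y * x))))) := by
  have h := unitInt_log_pow_mul_inv (neg_mem hx) 1
  rw [unitInt_congr (G := fun y => 2 * (-(1 / 2) * (x * (l y ^ 2 * (1 / (1 + y * x))))))
    fun y _ => by rw [show 1 - -x * y = 1 + y * x by ring]; ring, unitInt_const_mul] at h
  rw [q3]
  norm_num [Nat.factorial] at h ⊢
  linarith

theorem q4_eq_unitInt {x : ℝ} (hx : x ∈ Ioo (0 : ℝ) 1) :
    q4 x = unitInt (fun y => 1 / 6 * (x * (l y ^ 3 * (1 / (1 + y * x))))) := by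
  have h := unitInt_log_pow_mul_inv (neg_mem hx) 2
  rw [unitInt_congr (G := fun y => -6 * (1 / 6 * (x * (l y ^ 3 * (1 / (1 + y * x))))))
    fun y _ => by rw [show 1 - -x * y = 1 + y * x by ring]; ring, unitInt_const_mul] at h
  rw [q4]
  norm_num [Nat.factorial] at h ⊢
  linarith

theorem unitInt_inv_one_add_mul {y : ℝ} (hy : y ∈ Ioo (0 : ℝ) 1) :
    unitInt (fun x => 1 / (1 + x * y)) = px y := by
  have hb := logBdd_inv_one_add_mul hy
  have hd : ∀ x : ℝ, 0 ≤ x → HasDerivAt (fun x => Real.log (1 + x * y) / y) (1 / (1 + x * y)) x :=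
    fun x hx => by
      have h0 := hy.1
      have h1 : 0 < 1 + x * y := by positivity
      refine (((((hasDerivAt_id x).mul_const y).const_add 1).log h1.ne').div_const y).congr_deriv ?_
      simp only [id]
      field_simp
  have h := unitInt_deriv (fun x hx => hd x hx.1.le) hb
    ((hd 0 le_rfl).continuousAt.tendsto.mono_left nhdsWithin_le_nhds)
    ((hd 1 zero_le_one).continuousAt.tendsto.mono_left nhdsWithin_le_nhds)
  rw [h, px, p]
  simp

theorem unitInt_l_div_one_add_mul {y : ℝ} (hy : y ∈ Ioo (0 : ℝ) 1) :
    unitInt (fun x => l x * (1 / (1 + x * y))) = q2x y := by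
  rw [q2x, q2_eq_unitInt hy, unitInt_const_mul, mul_div_cancel_left₀ _ hy.1.ne']

theorem unitInt_m_div_one_add_mul {y : ℝ} (hy : y ∈ Ioo (0 : ℝ) 1) :
    unitInt (fun x => m x * (1 / (1 + x * y))) = q2x y + 1 / 2 * (p y * px y) := by
  have h0 := hy.1
  have h1 : 0 < 1 + y := by linarith
  have hc := mem_left hy
  have h := unitInt_log_pow_mul_inv (c := y / (1 + y))
    (by rw [abs_of_pos hc.1]; exact hc.2.le) 0
  have h2 := r2_left hy
  rw [r2] at h2
  rw [h2, ← unitInt_reflect, unitInt_congr (G := fun x => y * (m x * (1 / (1 + x * y))))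
    fun x hx => by
      have h3 := hx.1
      rw [l, m, show 1 - y / (1 + y) * (1 - x) = (1 + x * y) / (1 + y) by field_simp; ring]
      field_simp
      rw [zero_add, pow_one], unitInt_const_mul] at h
  rw [q2x, px, ← mul_right_inj' h0.ne', h]
  field_simp
  norm_num
  ring

theorem continuousOn_uncurry_aux {g h : ℝ → ℝ} (hg : LogBdd g) (hh : LogBdd h) :
    ContinuousOn (Function.uncurry fun x y => g x * (h y * (1 / (1 + y * x))))
      (Ioo (0 : ℝ) 1 ×ˢ Ioo (0 : ℝ) 1) := by
  refine (hg.1.comp continuousOn_fst fun z hz => hz.1).mul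
    ((hh.1.comp continuousOn_snd fun z hz => hz.2).mul
      (continuousOn_const.div (by fun_prop) fun z hz => ?_))
  linarith [(mul_mem hz.2 hz.1).1]

/-- Interchange of integrations for the kernel `g(x) h(y) / (1 + xy)`. -/
theorem unitInt_swap_inv {g h : ℝ → ℝ} (hg : LogBdd g) (hh : LogBdd h) :
    unitInt (fun x => g x * unitInt (fun y => h y * (1 / (1 + y * x))))
      = unitInt (fun y => h y * unitInt (fun x => g x * (1 / (1 + x * y)))) := by
  have e := unitInt_swap (continuousOn_uncurry_aux hg hh) hg hh fun x hx y hy => by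
    have h1 := (mul_mem hy hx).1
    rw [← mul_assoc, abs_mul]
    refine mul_le_of_le_one_right (abs_nonneg _) ?_
    rw [abs_of_pos (by positivity), div_le_one (by positivity)]
    linarith
  simp only [unitInt_const_mul] at e
  rw [e]
  refine unitInt_congr fun y _ => ?_
  rw [← unitInt_const_mul]
  exact unitInt_congr fun x _ => by ring_nf

theorem unitInt_q4_ic_eq :
    6 * unitInt (fun x => q4 x * ic x) = J 3 0 + unitInt (fun x => l x ^ 3 * pc x) := by
  have h := unitInt_swap_inv (g := fun x => 1 / 6 * (x * ic x)) (h := fun y => l y ^ 3)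
    (by fun_prop) (by fun_prop)
  rw [unitInt_congr (G := fun x => q4 x * ic x) fun x hx => by
      rw [q4_eq_unitInt hx, unitInt_const_mul, unitInt_const_mul]; ring,
    unitInt_congr (F := fun y => l y ^ 3 * _)
      (G := fun y => 1 / 6 * (l y ^ 3 * (p y ^ 0 * px y) + l y ^ 3 * pc y))
      fun y hy => by
      have hb := logBdd_inv_one_add_mul hy
      have h0 := hy.1.ne'
      have h1 : 1 - y ≠ 0 := by linarith [hy.2]
      rw [unitInt_congr (G := fun x => 1 / 6 * (1 / (1 - y)) * (1 / (1 + x * y)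
          - l x ^ 0 * (p x ^ 0 * ic x))) fun x hx => by
        have h2 := (mul_mem hx hy).1
        have h3 := hx.1
        rw [ic]
        field_simp
        ring,
        unitInt_const_mul, unitInt_sub hb (by fun_prop), unitInt_inv_one_add_mul hy, K_eq, K_zero,
        px, pc, Nat.cast_zero, zero_add, pow_one]
      field_simp
      ring,
    unitInt_const_mul, unitInt_add (by fun_prop) (by fun_prop), J_eq] at h
  linarith

theorem unitInt_m_ic : unitInt (fun x => m x * ic x) = K 1 0 + K 0 1 := by
  have h := unitInt_dual_ic (fun a _ => a)
  rw [unitInt_congr (G := fun x => m x * ic x - l x ^ 0 * (p x ^ 1 * ic x)) fun x _ => by ring,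
    unitInt_sub (by fun_prop) (by fun_prop), K_eq,
    unitInt_congr (F := fun x => l x * ic x) (G := fun x => l x ^ 1 * (p x ^ 0 * ic x))
      fun x _ => by ring, K_eq] at h
  linarith

theorem N_eq_of_representation :
    N = unitInt (fun x => q3 x * (l x * ic x)) - 1 / 4 * J 2 1
      - 1 / 4 * unitInt (fun x => l x ^ 2 * ((p x + Real.log 2) * pc x)) := by
  have h := unitInt_swap_inv (g := fun x => -(1 / 2) * (x * ((m x - l x) * ic x)))
    (h := fun y => l y ^ 2) (by fun_prop) (by fun_prop)
  rw [unitInt_congr (G := fun x => q3 x * (m x * ic x) - q3 x * (l x * ic x)) fun x hx => by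
      rw [q3_eq_unitInt hx, unitInt_const_mul, unitInt_const_mul]; ring,
    unitInt_congr (F := fun y => l y ^ 2 * _) (G := fun y => -(1 / 4) * (l y ^ 2 * (p y ^ 1 * px y)
        + l y ^ 2 * ((p y + Real.log 2) * pc y))) fun y hy => by
      have hb := logBdd_inv_one_add_mul hy
      have h0 := hy.1.ne'
      have h1 : 1 - y ≠ 0 := by linarith [hy.2]
      rw [unitInt_congr (G := fun x => -(1 / 2) * (1 / (1 - y)) * (m x * (1 / (1 + x * y))
          - l x * (1 / (1 + x * y)) - (m x * ic x - l x ^ 1 * (p x ^ 0 * ic x)))) fun x hx => by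
        have h2 := (mul_mem hx hy).1
        have h3 := hx.1
        rw [ic]
        field_simp
        ring,
        unitInt_const_mul, unitInt_sub (by fun_prop) (by fun_prop),
        unitInt_sub (by fun_prop) (by fun_prop), unitInt_sub (by fun_prop) (by fun_prop), K_eq,
        unitInt_m_div_one_add_mul hy, unitInt_l_div_one_add_mul hy, unitInt_m_ic, K_zero,
        px, pc]
      field_simp
      norm_num
      ring,
    unitInt_sub (by fun_prop) (by fun_prop), unitInt_const_mul,
    unitInt_add (by fun_prop) (by fun_prop), J_eq] at h
  rw [N]
  linarith

theorem unitInt_q2_mx : 2 * unitInt (fun x => q2 x * mx x) = J 2 0 + J 1 1 := by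
  have h := unitInt_swap_inv (g := m) (h := l) (by fun_prop) (by fun_prop)
  have h2 := unitInt_log_pow_mul_rpolylog (c := -1) (by simp) 1 (s := 2) (by norm_num)
  rw [unitInt_congr (G := fun x => q2 x * mx x) fun x hx => by
      have := hx.1.ne'
      rw [q2_eq_unitInt hx, unitInt_const_mul, mx]
      generalize unitInt _ = I
      field_simp,
    unitInt_congr (F := fun y => l y * _)
      (G := fun y => l y * q2x y + 1 / 2 * (l y ^ 1 * (p y ^ 1 * px y)))
      fun y hy => by rw [unitInt_m_div_one_add_mul hy]; ring,
    unitInt_add (by fun_prop) (by fun_prop), unitInt_const_mul, J_eq] at h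
  rw [unitInt_congr (G := fun y => l y * q2x y) fun y _ => by
    rw [neg_one_mul, q2x, q2]; ring] at h2
  rw [h, h2, J_zero_right]
  norm_num
  ring

theorem LogBdd.comp_mul {F : ℝ → ℝ} (hF : LogBdd F) {x : ℝ} (hx : x ∈ Ioo (0 : ℝ) 1) :
    LogBdd (fun z => F (z * x)) := by
  obtain ⟨cF, C, n, hC⟩ := hF
  refine ⟨cF.comp (by fun_prop) fun z hz => mul_mem hz hx, |C| * (1 - Real.log x) ^ n, n,
    fun z hz => ?_⟩
  have hw := one_le_weight hz
  have hzx := mul_mem hz hx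
  have hw' := one_le_weight hzx
  have h1 : Real.log x ≤ 0 := Real.log_nonpos hx.1.le hx.2.le
  have h2 : Real.log (1 - z) ≤ Real.log (1 - z * x) :=
    Real.log_le_log (by linarith [hz.2]) (by nlinarith [hz.1, hx.2])
  refine (hC _ hzx).trans ?_
  rw [mul_assoc, ← mul_pow]
  refine mul_le_mul (le_abs_self C) (pow_le_pow_left₀ (by linarith) ?_ n) (by positivity)
    (abs_nonneg C)
  rw [Real.log_mul hz.1.ne' hx.1.ne'] at *
  nlinarith

theorem tendsto_mul_zero {F : ℝ → ℝ} {a x : ℝ} (hx : x ∈ Ioo (0 : ℝ) 1)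
    (h : Tendsto F (𝓝[>] 0) (𝓝 a)) : Tendsto (fun z => F (z * x)) (𝓝[>] 0) (𝓝 a) := by
  refine h.comp (tendsto_nhdsWithin_iff.2 ⟨?_, ?_⟩)
  · have : ContinuousAt (fun z : ℝ => z * x) 0 := by fun_prop
    have := this.tendsto
    rw [zero_mul] at this
    exact this.mono_left nhdsWithin_le_nhds
  · filter_upwards [self_mem_nhdsWithin] with z hz using mul_pos hz hx.1

theorem tendsto_mul_one {F : ℝ → ℝ} {x : ℝ} (h : ContinuousAt F x) :
    Tendsto (fun z => F (z * x)) (𝓝[<] 1) (𝓝 (F x)) := by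
  have : ContinuousAt (fun z : ℝ => F (z * x)) 1 :=
    ContinuousAt.comp' (by rwa [one_mul]) (by fun_prop)
  have := this.tendsto
  rw [one_mul] at this
  exact this.mono_left nhdsWithin_le_nhds

theorem HasDerivAt.comp_mul_right {F : ℝ → ℝ} {a x z : ℝ} (h : HasDerivAt F a (z * x)) :
    HasDerivAt (fun z => F (z * x)) (a * x) z := by
  have := h.comp z ((hasDerivAt_id z).mul_const x)
  rw [one_mul] at this
  exact this

/-- `(log (1 + z) - log (1 + zx)) / (1 - x)` -/
noncomputable def pslope (z x : ℝ) : ℝ := (p z - p (z * x)) / (1 - x)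

theorem abs_pslope_le {z x : ℝ} (hz : z ∈ Ioo (0 : ℝ) 1) (hx : x ∈ Ioo (0 : ℝ) 1) :
    |pslope z x| ≤ 1 := by
  have hx1 : 0 < 1 - x := by linarith [hx.2]
  have hzx := mul_mem hz hx
  have h1 : 0 < 1 + z * x := by linarith [hzx.1]
  have h2 : 0 < 1 + z := by linarith [hz.1]
  have h3 : Real.log (1 + z * x) ≤ Real.log (1 + z) :=
    Real.log_le_log h1 (by nlinarith [hz.1, hx.2])
  have h4 := Real.log_le_sub_one_of_pos (div_pos h2 h1)
  rw [Real.log_div h2.ne' h1.ne'] at h4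
  rw [pslope, p, p, abs_of_nonneg (div_nonneg (by linarith) hx1.le), div_le_one hx1]
  refine h4.trans ?_
  rw [sub_le_iff_le_add, div_le_iff₀ h1]
  have h5 : z * (1 - x) ≤ 1 := mul_le_one₀ hz.2.le hx1.le (by linarith [hx.1])
  nlinarith [mul_nonneg hx1.le (sub_nonneg.2 h5)]

theorem logBdd_pslope {z : ℝ} (hz : z ∈ Ioo (0 : ℝ) 1) : LogBdd (pslope z) := by
  refine LogBdd.of_bounded ?_ 1 fun x hx => abs_pslope_le hz hx
  refine (continuousOn_const.sub (LogBdd.p.1.comp (by fun_prop) fun x hx => mul_mem hz hx)).div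
    (by fun_prop) fun x hx => ?_
  linarith [hx.2]

/-- `(Li₂(-1) - Li₂(-x)) / (1 - x)` -/
noncomputable def q2c (x : ℝ) : ℝ := (q2 1 - q2 x) / (1 - x)

@[fun_prop]
theorem logBdd_q2c : LogBdd q2c := by
  refine LogBdd.of_bounded ((continuousOn_const.sub LogBdd.q2.1).div (by fun_prop)
    fun x hx => by linarith [hx.2]) 1 fun x hx => ?_
  have hc : ContinuousOn q2 (Icc x 1) :=
    (continuousOn_rpolylog le_rfl).comp (by fun_prop) fun y hy =>
      ⟨by linarith [hy.2], by linarith [hy.1, hx.1]⟩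
  obtain ⟨c, hcx, h⟩ := exists_hasDerivAt_eq_slope q2 (fun y => -(p y / y)) hx.2 hc
    fun y hy => hasDerivAt_q2 ⟨hx.1.trans hy.1, hy.2⟩
  have h0 : 0 < c := hx.1.trans hcx.1
  have h1 := Real.log_le_sub_one_of_pos (show 0 < 1 + c by linarith)
  have h2 := Real.log_nonneg (show 1 ≤ 1 + c by linarith)
  rw [q2c, ← h, abs_neg, p, abs_of_nonneg (by positivity), div_le_one h0]
  linarith

/-- The kernel whose integral over the unit square is computed in two ways. -/
noncomputable def ker (x z : ℝ) : ℝ :=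
  ic z * (q3 (z * x) * (1 / (1 + z * x))) + q2x z * pslope z x

theorem abs_ker_le {x z : ℝ} (hx : x ∈ Ioo (0 : ℝ) 1) (hz : z ∈ Ioo (0 : ℝ) 1) :
    |ker x z| ≤ 2 * rpolylog 2 1 := by
  have hzx := mul_mem hz hx
  have h1 : |ic z| ≤ 1 := by
    have := hz.1
    rw [ic, abs_of_pos (by positivity), div_le_one (by linarith)]; linarith
  have h2 : |1 / (1 + z * x)| ≤ 1 := by
    rw [abs_of_pos (by have := hzx.1; positivity), div_le_one (by linarith [hzx.1])]
    linarith [hzx.1]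
  have h0 : 0 ≤ rpolylog 2 1 := by rw [rpolylog_two_one]; positivity
  have h3 : |q3 (z * x)| ≤ rpolylog 2 1 := by
    refine (abs_rpolylog_le (by norm_num) (neg_mem hzx)).trans ?_
    exact mul_le_of_le_one_right h0 (neg_mem hzx)
  have h4 : |q2x z| ≤ rpolylog 2 1 := by
    rw [q2x, abs_div, div_le_iff₀ (abs_pos.2 hz.1.ne'), ← abs_neg z]
    exact abs_rpolylog_le le_rfl (neg_mem hz)
  have h5 := abs_pslope_le hz hx
  refine (abs_add_le _ _).trans ?_
  rw [abs_mul, abs_mul, abs_mul]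
  have a1 : |q3 (z * x)| * |1 / (1 + z * x)| ≤ rpolylog 2 1 * 1 :=
    mul_le_mul h3 h2 (abs_nonneg _) h0
  have a2 : |ic z| * (|q3 (z * x)| * |1 / (1 + z * x)|) ≤ 1 * (rpolylog 2 1 * 1) :=
    mul_le_mul h1 a1 (by positivity) zero_le_one
  have a3 : |q2x z| * |pslope z x| ≤ rpolylog 2 1 * 1 :=
    mul_le_mul h4 h5 (abs_nonneg _) h0
  linarith

theorem continuousOn_ker :
    ContinuousOn (Function.uncurry ker) (Ioo (0 : ℝ) 1 ×ˢ Ioo (0 : ℝ) 1) := by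
  have hm : MapsTo (fun z : ℝ × ℝ => z.2 * z.1) (Ioo (0 : ℝ) 1 ×ˢ Ioo (0 : ℝ) 1) (Ioo 0 1) :=
    fun z hz => mul_mem hz.2 hz.1
  have hs : MapsTo (fun z : ℝ × ℝ => z.2) (Ioo (0 : ℝ) 1 ×ˢ Ioo (0 : ℝ) 1) (Ioo 0 1) :=
    fun z hz => hz.2
  have hc : ContinuousOn (fun z : ℝ × ℝ => z.2 * z.1) (Ioo (0 : ℝ) 1 ×ˢ Ioo (0 : ℝ) 1) := by
    fun_prop
  refine ((LogBdd.ic.1.comp continuousOn_snd hs).mul ((LogBdd.q3.1.comp hc hm).mul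
    (continuousOn_const.div (by fun_prop) fun z hz => ?_))).add
    ((LogBdd.q2x.1.comp continuousOn_snd hs).mul
    (((LogBdd.p.1.comp continuousOn_snd hs).sub (LogBdd.p.1.comp hc hm)).div
    (by fun_prop) fun z hz => ?_))
  · linarith [(hm hz).1]
  · linarith [hz.1.2]

theorem unitInt_ker_right {x : ℝ} (hx : x ∈ Ioo (0 : ℝ) 1) :
    unitInt (fun z => ker x z) = -(q3 x * pc x) - 1 / 2 * ((q2 1 - q2 x) * q2c x) := by
  have hx1 : 1 - x ≠ 0 := by linarith [hx.2]
  have b1 := LogBdd.q3.comp_mul hx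
  have b2 := LogBdd.p.comp_mul hx
  have b3 := LogBdd.ic.comp_mul hx
  have hb : LogBdd (fun z => ker x z) := by
    have : LogBdd (fun z => ic z * (q3 (z * x) * ic (z * x))
        + q2x z * ((p z - p (z * x)) * (1 / (1 - x)))) := by fun_prop
    refine this.congr fun z _ => ?_
    rw [ker, ic, ic, pslope, mul_one_div _ (1 - x)]
  have h := unitInt_deriv (F := fun z => (1 / (1 - x)) * ((p z - p (z * x)) * q3 (z * x)
      - 1 / 2 * (q2 z - q2 (z * x)) ^ 2)) (F' := fun z => ker x z) (fun z hz => by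
      have hzx := mul_mem hz hx
      have h0 := hz.1
      have h0' := hx.1
      refine (((((hasDerivAt_p hz).sub (HasDerivAt.comp_mul_right (hasDerivAt_p hzx))).mul
        (HasDerivAt.comp_mul_right (hasDerivAt_q3 hzx))).sub
        ((((hasDerivAt_q2 hz).sub (HasDerivAt.comp_mul_right (hasDerivAt_q2 hzx))).pow 2).const_mul
          (1 / 2))).const_mul (1 / (1 - x))).congr_deriv ?_
      simp only [Pi.sub_apply]
      rw [ker, ic, pslope, q2x]
      push_cast
      field_simp
      ring)
    hb
    (((((tendsto_p_zero.sub (tendsto_mul_zero hx tendsto_p_zero))).mul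
      (tendsto_mul_zero hx tendsto_q3_zero)).sub
      (((tendsto_q2_zero.sub (tendsto_mul_zero hx tendsto_q2_zero)).pow 2).const_mul
        (1 / 2))).const_mul _)
    (((((tendsto_p_one.sub (tendsto_mul_one (hasDerivAt_p hx).continuousAt))).mul
      (tendsto_mul_one (hasDerivAt_q3 hx).continuousAt)).sub
      (((tendsto_q2_one.sub (tendsto_mul_one (hasDerivAt_q2 hx).continuousAt)).pow 2).const_mul
        (1 / 2))).const_mul _)
  rw [h, pc, q2c]
  field_simp
  ring

theorem unitInt_pslope {z : ℝ} (hz : z ∈ Ioo (0 : ℝ) 1) :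
    unitInt (pslope z) = -(q2 z + 1 / 2 * p z ^ 2) := by
  have b1 := logBdd_pslope hz
  have b2 := logBdd_inv_one_add_mul hz
  have hp : ∀ x, p (z * x) = p (x * z) := fun x => by rw [mul_comm]
  have h := unitInt_deriv (F := fun x => -(m x * (p z - p (x * z))))
    (F' := fun x => pslope z x + z * (m x * (1 / (1 + x * z)))) (a := 0) (b := 0) (fun x hx => by
      have hx1 : 1 - x ≠ 0 := by linarith [hx.2]
      have h1 := (mul_mem hx hz).1
      refine ((hasDerivAt_m hx).mul
        ((HasDerivAt.comp_mul_right (hasDerivAt_p (mul_mem hx hz))).const_sub (p z))).neg.congr_deriv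
          ?_
      rw [pslope, hp]
      field_simp
      ring)
    (by fun_prop)
    (tendsto_zero_of_eq (G := fun x => -(mx x * (p z - p (x * z))))
      (by have := LogBdd.p.comp_mul hz; fun_prop) fun x hx => by rw [m_eq hx]; ring)
    (tendsto_one_of_eq (G := fun x => -(m x * pslope z x)) (by fun_prop) fun x hx => by
      have hx1 : 1 - x ≠ 0 := by linarith [hx.2]
      rw [pslope, hp]
      field_simp)
  have h0 := hz.1.ne'
  rw [unitInt_add b1 (by fun_prop), unitInt_const_mul, unitInt_m_div_one_add_mul hz] at h
  have h2 : z * (q2x z + 1 / 2 * (p z * px z)) = q2 z + 1 / 2 * p z ^ 2 := by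
    rw [q2x, px]
    field_simp
  linarith

theorem unitInt_ker_left {z : ℝ} (hz : z ∈ Ioo (0 : ℝ) 1) :
    unitInt (fun x => ker x z) = ic z * (q3 z * px z + 1 / 2 * (q2 z * q2x z))
      - (q2 z * q2x z + 1 / 2 * (q2 z * (p z * px z))) := by
  have h0 := hz.1
  have b0 := logBdd_pslope hz
  have b1 := LogBdd.q3.comp_mul hz
  have b2 := LogBdd.ic.comp_mul hz
  have h := unitInt_deriv (F := fun x => 1 / z * (p (x * z) * q3 (x * z) + 1 / 2 * q2 (x * z) ^ 2))
    (F' := fun x => q3 (x * z) * ic (x * z)) (fun x hx => by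
      have h1 := mul_mem hx hz
      have h2 := h1.1
      have h3 := hx.1
      refine ((((HasDerivAt.comp_mul_right (hasDerivAt_p h1)).mul
        (HasDerivAt.comp_mul_right (hasDerivAt_q3 h1))).add
        (((HasDerivAt.comp_mul_right (hasDerivAt_q2 h1)).pow 2).const_mul (1 / 2))).const_mul
          (1 / z)).congr_deriv ?_
      rw [ic]
      push_cast
      field_simp
      ring)
    (by fun_prop)
    ((((tendsto_mul_zero hz tendsto_p_zero).mul (tendsto_mul_zero hz tendsto_q3_zero)).add
      (((tendsto_mul_zero hz tendsto_q2_zero).pow 2).const_mul (1 / 2))).const_mul _)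
    ((((tendsto_mul_one (hasDerivAt_p hz).continuousAt).mul
      (tendsto_mul_one (hasDerivAt_q3 hz).continuousAt)).add
      (((tendsto_mul_one (hasDerivAt_q2 hz).continuousAt).pow 2).const_mul (1 / 2))).const_mul _)
  rw [unitInt_congr (G := fun x => ic z * (q3 (x * z) * ic (x * z)) + q2x z * pslope z x)
      fun x _ => by rw [ker, mul_comm z x, ic, ic],
    unitInt_add (by fun_prop) (by fun_prop), unitInt_const_mul, unitInt_const_mul, h,
    unitInt_pslope hz, q2x, px]
  field_simp
  ring

theorem unitInt_unitInt_ker_right :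
    unitInt (fun x => unitInt (fun z => ker x z))
      = -N + Real.log 2 * unitInt (fun x => q2 x * mx x) - q2 1 * M 0 1 := by
  rw [unitInt_congr fun x hx => unitInt_ker_right hx]
  have h := unitInt_deriv
    (F := fun x => -(m x * ((Real.log 2 - p x) * q3 x - 1 / 2 * (q2 1 - q2 x) ^ 2)))
    (F' := fun x => (-(q3 x * pc x) - 1 / 2 * ((q2 1 - q2 x) * q2c x)) + (q3 x * (m x * ic x)
      - Real.log 2 * (q2 x * mx x) + q2 1 * (m x ^ 0 * (p x ^ 1 * mx x)))) (a := 0) (b := 0)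
    (fun x hx => by
      have hx1 : 1 - x ≠ 0 := by linarith [hx.2]
      have h0 := hx.1
      refine ((hasDerivAt_m hx).mul ((((hasDerivAt_p hx).const_sub (Real.log 2)).mul
        (hasDerivAt_q3 hx)).sub ((((hasDerivAt_q2 hx).const_sub (q2 1)).pow 2).const_mul
        (1 / 2)))).neg.congr_deriv ?_
      simp only [Pi.sub_apply, Pi.mul_apply, Pi.pow_apply]
      rw [pc, q2c, ic, mx]
      push_cast
      field_simp
      ring)
    (by fun_prop)
    (tendsto_zero_of_eq
      (G := fun x => -(mx x * ((Real.log 2 - p x) * q3 x - 1 / 2 * (q2 1 - q2 x) ^ 2)))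
      (by fun_prop) fun x hx => by rw [m_eq hx]; ring)
    (tendsto_one_of_eq
      (G := fun x => m x * (pc x * q3 x + 1 / 2 * ((q2 1 - q2 x) * q2c x)))
      (by fun_prop) fun x hx => by
        have hx1 : 1 - x ≠ 0 := by linarith [hx.2]
        rw [pc, q2c]
        field_simp
        ring)
  rw [unitInt_add (F := fun x => -(q3 x * pc x) - 1 / 2 * ((q2 1 - q2 x) * q2c x)) (by fun_prop)
    (by fun_prop)] at h
  simp (disch := fun_prop) only [unitInt_add, unitInt_sub, unitInt_const_mul, M_eq] at h
  rw [N]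
  simp (disch := fun_prop) only [unitInt_sub, unitInt_const_mul]
  linarith

theorem unitInt_unitInt_ker_left :
    unitInt (fun z => unitInt (fun x => ker x z))
      = -Real.log 2 * (Real.log 2 * q3 1 + 1 / 2 * q2 1 ^ 2)
        - unitInt (fun x => q3 x * (l x * ic x)) + unitInt (fun x => q3 x * (p x * ic x))
        - V - 1 / 2 * Y := by
  rw [unitInt_congr fun z hz => unitInt_ker_left hz]
  have h := unitInt_deriv
    (F := fun x => (l x - p x) * (p x * q3 x + 1 / 2 * q2 x ^ 2))
    (F' := fun x => ic x * (q3 x * px x + 1 / 2 * (q2 x * q2x x)) + (q3 x * (l x * ic x)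
      - q3 x * (p x * ic x))) (fun x hx => by
      have h0 := hx.1
      refine (((hasDerivAt_l hx).sub (hasDerivAt_p hx)).mul (((hasDerivAt_p hx).mul
        (hasDerivAt_q3 hx)).add (((hasDerivAt_q2 hx).pow 2).const_mul (1 / 2)))).congr_deriv ?_
      simp only [Pi.add_apply, Pi.mul_apply, Pi.sub_apply, Pi.pow_apply]
      rw [ic, px, q2x]
      push_cast
      field_simp
      ring)
    (by fun_prop)
    (tendsto_zero_of_eq
      (G := fun x => (l x - p x) * (px x * q3 x + 1 / 2 * (q2 x * q2x x))) (by fun_prop)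
      fun x hx => by
        have h0 := hx.1.ne'
        rw [px, q2x]
        field_simp)
    ((tendsto_l_one.sub tendsto_p_one).mul ((tendsto_p_one.mul tendsto_q3_one).add
      ((tendsto_q2_one.pow 2).const_mul (1 / 2))))
  rw [unitInt_add (F := fun x => ic x * (q3 x * px x + 1 / 2 * (q2 x * q2x x))) (by fun_prop)
    (by fun_prop), unitInt_sub (by fun_prop) (by fun_prop)] at h
  rw [unitInt_sub (by fun_prop) (by fun_prop), unitInt_add (by fun_prop) (by fun_prop),
    unitInt_const_mul, V, Y]
  linarith

theorem N_eq_of_kernel :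
    -N + Real.log 2 * (1 / 2 * (J 2 0 + J 1 1)) - q2 1 * M 0 1
      = -Real.log 2 * (Real.log 2 * q3 1 + 1 / 2 * q2 1 ^ 2)
        - unitInt (fun x => q3 x * (l x * ic x)) + unitInt (fun x => q3 x * (p x * ic x))
        - V - 1 / 2 * Y := by
  rw [← unitInt_unitInt_ker_left, ← unitInt_q2_mx]
  have h := unitInt_swap continuousOn_ker (LogBdd.const (2 * rpolylog 2 1)) (LogBdd.const 1)
    fun x hx z hz => by
      rw [mul_one]
      exact (abs_ker_le hx hz).trans (le_abs_self _)
  rw [← h, unitInt_unitInt_ker_right]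
  ring

/-- `Li₃(x)` -/
noncomputable def r3 (x : ℝ) : ℝ := rpolylog 3 x
/-- `Li₄(x)` -/
noncomputable def r4 (x : ℝ) : ℝ := rpolylog 4 x
/-- `(Li₄(x) - Li₄(1)) / (1 - x)` -/
noncomputable def r4c (x : ℝ) : ℝ := (r4 x - r4 1) / (1 - x)

theorem pos_mem {x : ℝ} (hx : x ∈ Ioo (0 : ℝ) 1) : |x| ≤ 1 := by
  rw [abs_of_pos hx.1]; exact hx.2.le

theorem hasDerivAt_r3 {x : ℝ} (hx : x ∈ Ioo (0 : ℝ) 1) : HasDerivAt r3 (r2 x / x) x :=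
  hasDerivAt_rpolylog 2 (by rw [abs_of_pos hx.1]; exact hx.2) hx.1.ne'

theorem hasDerivAt_r4 {x : ℝ} (hx : x ∈ Ioo (0 : ℝ) 1) : HasDerivAt r4 (r3 x / x) x :=
  hasDerivAt_rpolylog 3 (by rw [abs_of_pos hx.1]; exact hx.2) hx.1.ne'

@[fun_prop]
theorem logBdd_r3 : LogBdd r3 := by
  have h := LogBdd.rpolylog_mul (s := 3) (by norm_num) (c := 1) (by simp)
  simp only [one_mul] at h
  exact h

@[fun_prop]
theorem logBdd_r4 : LogBdd r4 := by
  have h := LogBdd.rpolylog_mul (s := 4) (by norm_num) (c := 1) (by simp)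
  simp only [one_mul] at h
  exact h

theorem tendsto_r3_zero : Tendsto r3 (𝓝[>] 0) (𝓝 0) := by
  have h := tendsto_rpolylog_zero (s := 3) (by norm_num) 1
  simp only [one_mul] at h
  exact h

theorem tendsto_r3_one : Tendsto r3 (𝓝[<] 1) (𝓝 (r3 1)) := by
  have h := tendsto_rpolylog_one (s := 3) (by norm_num) (c := 1) (by simp)
  simp only [one_mul] at h
  exact h

@[fun_prop]
theorem logBdd_r4c : LogBdd r4c := by
  refine LogBdd.of_bounded ((LogBdd.sub logBdd_r4 (LogBdd.const _)).1.div (by fun_prop)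
    fun x hx => by linarith [hx.2]) (rpolylog 2 1) fun x hx => ?_
  have hc : ContinuousOn r4 (Icc x 1) :=
    (continuousOn_rpolylog (by norm_num)).mono fun y hy => ⟨by linarith [hy.1, hx.1], hy.2⟩
  obtain ⟨c, hcx, h⟩ := exists_hasDerivAt_eq_slope r4 (fun y => r3 y / y) hx.2 hc
    fun y hy => hasDerivAt_r4 ⟨hx.1.trans hy.1, hy.2⟩
  have h0 : 0 < c := hx.1.trans hcx.1
  rw [r4c, ← neg_sub (r4 1), neg_div, ← h, abs_neg, abs_div, div_le_iff₀ (abs_pos.2 h0.ne')]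
  exact abs_rpolylog_le (by norm_num) (pos_mem ⟨h0, hcx.2⟩)

theorem unitInt_mx_r3 : unitInt (fun x => mx x * r3 x) = U - Real.pi ^ 2 / 6 * r3 1 := by
  have h := unitInt_deriv (F := fun x => r2 x * r3 x) (F' := fun x => r2 x * r2x x - mx x * r3 x)
    (fun x hx => by
      refine ((hasDerivAt_r2 hx).mul (hasDerivAt_r3 hx)).congr_deriv ?_
      rw [mx, r2x]; ring)
    (by fun_prop) (tendsto_r2_zero.mul tendsto_r3_zero) (tendsto_r2_one.mul tendsto_r3_one)
  rw [unitInt_sub (by fun_prop) (by fun_prop)] at h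
  rw [U]
  linarith

theorem unitInt_l_mx_r2 : unitInt (fun x => l x * (mx x * r2 x)) = 1 / 2 * U := by
  have h := unitInt_deriv (F := fun x => l x * r2 x ^ 2)
    (F' := fun x => r2 x * r2x x - 2 * (l x * (mx x * r2 x))) (fun x hx => by
      refine ((hasDerivAt_l hx).mul ((hasDerivAt_r2 hx).pow 2)).congr_deriv ?_
      simp only [Pi.pow_apply]
      rw [mx, r2x]; push_cast; ring)
    (by fun_prop)
    (tendsto_zero_of_eq (G := fun x => l x * (r2 x * r2x x)) (by fun_prop) fun x hx => by
      have := hx.1.ne'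
      rw [r2x]; field_simp)
    (tendsto_l_one.mul (tendsto_r2_one.pow 2))
  rw [unitInt_sub (by fun_prop) (by fun_prop), unitInt_const_mul] at h
  rw [U]
  linarith

theorem unitInt_lc_r3 :
    unitInt (fun x => lc x * r3 x) = 3 / 2 * U - Real.pi ^ 2 / 6 * r3 1 := by
  have h := unitInt_deriv (F := fun x => l x * (m x * r3 x))
    (F' := fun x => mx x * r3 x + l x * (mx x * r2 x) - lc x * r3 x) (a := 0) (b := 0)
    (fun x hx => by
      refine ((hasDerivAt_l hx).mul ((hasDerivAt_m hx).mul (hasDerivAt_r3 hx))).congr_deriv ?_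
      simp only [Pi.mul_apply]
      rw [mx, lc]; ring)
    (by fun_prop)
    (tendsto_zero_of_eq (G := fun x => l x * (mx x * r3 x)) (by fun_prop) fun x hx => by
      rw [m_eq hx]; ring)
    (tendsto_one_of_eq (G := fun x => lc x * (m x * r3 x)) (by fun_prop) fun x hx => by
      rw [l_eq hx]; ring)
  rw [unitInt_sub (by fun_prop) (by fun_prop), unitInt_add (by fun_prop) (by fun_prop),
    unitInt_mx_r3, unitInt_l_mx_r2] at h
  linarith

theorem unitInt_l_lc_r2 :
    unitInt (fun x => l x * lc x * r2 x) = U - unitInt (fun x => l x ^ 2 * (m x * mx x)) := by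
  have h := unitInt_deriv (F := fun x => l x ^ 2 * (m x * r2 x))
    (F' := fun x => 2 * (l x * (mx x * r2 x)) - l x ^ 2 * (m x * mx x) - l x * lc x * r2 x)
    (a := 0) (b := 0) (fun x hx => by
      refine (((hasDerivAt_l hx).pow 2).mul
        ((hasDerivAt_m hx).mul (hasDerivAt_r2 hx))).congr_deriv ?_
      simp only [Pi.mul_apply, Pi.pow_apply]
      rw [mx, lc]; push_cast; ring)
    (by fun_prop)
    (tendsto_zero_of_eq (G := fun x => l x ^ 2 * (mx x * r2 x)) (by fun_prop) fun x hx => by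
      rw [m_eq hx]; ring)
    (tendsto_one_of_eq (G := fun x => l x * lc x * (m x * r2 x)) (by fun_prop) fun x hx => by
      rw [pow_two]; nth_rewrite 2 [l_eq hx]; ring)
  rw [unitInt_sub (by fun_prop) (by fun_prop), unitInt_sub (by fun_prop) (by fun_prop),
    unitInt_const_mul, unitInt_l_mx_r2] at h
  linarith

theorem unitInt_l_sq_lc_m : unitInt (fun x => l x ^ 2 * (lc x * m x))
    = 3 / 2 * unitInt (fun x => l x ^ 2 * (m x * mx x)) := by
  have h := unitInt_deriv (F := fun x => l x ^ 3 * m x ^ 2)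
    (F' := fun x => 3 * (l x ^ 2 * (m x * mx x)) - 2 * (l x ^ 2 * (lc x * m x)))
    (a := 0) (b := 0) (fun x hx => by
      refine (((hasDerivAt_l hx).pow 3).mul ((hasDerivAt_m hx).pow 2)).congr_deriv ?_
      simp only [Pi.pow_apply]
      rw [mx, lc]; push_cast; ring)
    (by fun_prop)
    (tendsto_zero_of_eq (G := fun x => l x ^ 3 * (mx x * m x)) (by fun_prop) fun x hx => by
      rw [pow_two]; nth_rewrite 1 [m_eq hx]; ring)
    (tendsto_one_of_eq (G := fun x => l x ^ 2 * lc x * m x ^ 2) (by fun_prop) fun x hx => by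
      rw [pow_succ (l x) 2]; nth_rewrite 2 [l_eq hx]; ring)
  rw [unitInt_sub (by fun_prop) (by fun_prop), unitInt_const_mul, unitInt_const_mul] at h
  linarith

theorem unitInt_r4c : unitInt r4c = unitInt (fun x => mx x * r3 x) := by
  have h := unitInt_deriv (F := fun x => m x * (r4 x - r4 1))
    (F' := fun x => mx x * r3 x - r4c x) (a := 0) (b := 0) (fun x hx => by
      refine ((hasDerivAt_m hx).mul ((hasDerivAt_r4 hx).sub_const (r4 1))).congr_deriv ?_
      rw [mx, r4c]; ring)
    (by fun_prop)
    (tendsto_zero_of_eq (G := fun x => mx x * (r4 x - r4 1)) (by fun_prop) fun x hx => by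
      rw [m_eq hx]; ring)
    (tendsto_one_of_eq (G := fun x => m x * r4c x) (by fun_prop) fun x hx => by
      have : 1 - x ≠ 0 := by linarith [hx.2]
      rw [r4c]; field_simp)
  rw [unitInt_sub (by fun_prop) (by fun_prop)] at h
  linarith

theorem continuousOn_uncurry_one_sub {g h : ℝ → ℝ} (hg : LogBdd g) (hh : LogBdd h) :
    ContinuousOn (Function.uncurry fun x y => g x * (h y * (1 / (1 - y * x))))
      (Ioo (0 : ℝ) 1 ×ˢ Ioo (0 : ℝ) 1) := by
  refine (hg.1.comp continuousOn_fst fun z hz => hz.1).mul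
    ((hh.1.comp continuousOn_snd fun z hz => hz.2).mul
      (continuousOn_const.div (by fun_prop) fun z hz => ?_))
  linarith [(mul_mem hz.2 hz.1).2]

theorem abs_inv_one_sub_mul_le {x y : ℝ} (hx : x ∈ Ioo (0 : ℝ) 1) (hy : y ∈ Ioo (0 : ℝ) 1) :
    |1 / (1 - y * x)| ≤ 1 / (1 - x) := by
  have h1 := (mul_mem hy hx).2
  have h2 : 0 < 1 - x := by linarith [hx.2]
  rw [abs_of_pos (one_div_pos.2 (by linarith))]
  exact one_div_le_one_div_of_le h2 (by nlinarith [hx.1, hy.2])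

theorem logBdd_inv_one_sub_mul {y : ℝ} (hy : y ∈ Ioo (0 : ℝ) 1) :
    LogBdd (fun x => 1 / (1 - x * y)) := by
  refine LogBdd.of_bounded (continuousOn_const.div (by fun_prop) fun x hx => ?_) (1 / (1 - y))
    fun x hx => abs_inv_one_sub_mul_le hy hx
  linarith [(mul_mem hx hy).2]

/-- Interchange of integrations for the kernel `g(x) h(y) / (1 - xy)`. -/
theorem unitInt_swap_inv_one_sub {g h : ℝ → ℝ} (hg : LogBdd g) (hh : LogBdd h)
    (hgc : LogBdd (fun x => g x * (1 / (1 - x)))) :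
    unitInt (fun x => g x * unitInt (fun y => h y * (1 / (1 - y * x))))
      = unitInt (fun y => h y * unitInt (fun x => g x * (1 / (1 - x * y)))) := by
  have e := unitInt_swap (continuousOn_uncurry_one_sub hg hh) hgc hh fun x hx y hy => by
    have h2 : 0 < 1 - x := by linarith [hx.2]
    rw [abs_mul, abs_mul, abs_mul, abs_mul, abs_of_pos (one_div_pos.2 h2), mul_comm |h y|,
      ← mul_assoc]
    exact mul_le_mul_of_nonneg_right (mul_le_mul_of_nonneg_left
      (abs_inv_one_sub_mul_le hx hy) (abs_nonneg _)) (abs_nonneg _)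
  simp only [unitInt_const_mul] at e
  rw [e]
  refine unitInt_congr fun y _ => ?_
  rw [← unitInt_const_mul]
  exact unitInt_congr fun x _ => by ring_nf

theorem unitInt_l_div_one_sub_mul {y : ℝ} (hy : y ∈ Ioo (0 : ℝ) 1) :
    unitInt (fun x => l x * (1 / (1 - x * y))) = -r2x y := by
  have h := unitInt_log_pow_mul_inv (pos_mem hy) 0
  rw [unitInt_congr (G := fun x => y * (l x * (1 / (1 - x * y)))) fun x _ => by
    rw [mul_comm y x]; ring, unitInt_const_mul] at h
  rw [← mul_right_inj' hy.1.ne', h, r2x, r2, mul_neg, mul_div_cancel₀ _ hy.1.ne']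
  norm_num

theorem unitInt_l_sq_div_one_sub_mul {y : ℝ} (hy : y ∈ Ioo (0 : ℝ) 1) :
    unitInt (fun x => l x ^ 2 * (1 / (1 - x * y))) = 2 * (r3 y / y) := by
  have h := unitInt_log_pow_mul_inv (pos_mem hy) 1
  rw [unitInt_congr (G := fun x => y * (l x ^ 2 * (1 / (1 - x * y)))) fun x _ => by
    rw [mul_comm y x]; ring, unitInt_const_mul] at h
  rw [← mul_right_inj' hy.1.ne', h, r3, mul_left_comm, mul_div_cancel₀ _ hy.1.ne']
  norm_num

theorem unitInt_inv_one_sub_mul {y : ℝ} (hy : y ∈ Ioo (0 : ℝ) 1) :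
    unitInt (fun x => 1 / (1 - x * y)) = -mx y := by
  have hb := logBdd_inv_one_sub_mul hy
  have hd : ∀ x : ℝ, x ≤ 1 → HasDerivAt (fun x => -Real.log (1 - x * y) / y) (1 / (1 - x * y)) x :=
    fun x hx => by
      have h0 := hy.1
      have h1 : 0 < 1 - x * y := by nlinarith [hy.2]
      refine (((((hasDerivAt_id x).mul_const y).const_sub 1).log h1.ne').neg.div_const y).congr_deriv
        ?_
      simp only [id]
      field_simp
  have h := unitInt_deriv (fun x hx => hd x hx.2.le) hb
    ((hd 0 zero_le_one).continuousAt.tendsto.mono_left nhdsWithin_le_nhds)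
    ((hd 1 le_rfl).continuousAt.tendsto.mono_left nhdsWithin_le_nhds)
  rw [h, mx, m]
  simp [neg_div]

theorem unitInt_r4c_eq : 6 * unitInt r4c = -unitInt (fun y => l y ^ 3 * mx y)
    - unitInt (fun y => l y ^ 2 * (lc y * m y)) := by
  have h := unitInt_swap_inv_one_sub (g := fun x => l x ^ 2 * lc x) (h := fun _ => 1)
    (by fun_prop) (by fun_prop) (by
      have : LogBdd (fun x => l x * lc x ^ 2) := by fun_prop
      exact this.congr fun x _ => by rw [lc]; ring)
  rw [unitInt_congr (F := fun x => l x ^ 2 * lc x * _)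
      (G := fun x => -(l x ^ 3 * mx x) - l x ^ 2 * (lc x * m x)) fun x hx => by
      have h1 := hx.1.ne'
      have h2 : 1 - x ≠ 0 := by linarith [hx.2]
      simp only [one_mul]
      rw [unitInt_inv_one_sub_mul hx, lc, mx]
      field_simp
      ring,
    unitInt_congr (F := fun y => 1 * _) (G := fun y => 6 * r4c y) fun y hy => by
      have hb := logBdd_inv_one_sub_mul hy
      have h2 : 1 - y ≠ 0 := by linarith [hy.2]
      have e1 := unitInt_log_pow_mul_inv (pos_mem hy) 2
      have e2 := unitInt_log_pow_mul_inv (c := 1) (by simp) 2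
      rw [unitInt_congr (G := fun x => y * (l x ^ 3 * (1 / (1 - x * y)))) fun x _ => by
        rw [mul_comm y x]; ring] at e1
      rw [unitInt_congr (G := fun x => l x ^ 2 * lc x) fun x _ => by rw [lc]; ring] at e2
      rw [unitInt_congr (G := fun x => 1 / (1 - y) * (l x ^ 2 * lc x
        - y * (l x ^ 3 * (1 / (1 - x * y))))) fun x hx => by
          have h3 : 1 - x ≠ 0 := by linarith [hx.2]
          have h4 : 1 - x * y ≠ 0 := by linarith [(mul_mem hx hy).2]
          rw [lc]
          field_simp
          ring,
        unitInt_const_mul, unitInt_sub (by fun_prop) (by fun_prop), e1, e2, r4c, r4, r4]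
      norm_num [Nat.factorial]
      field_simp
      ring,
    unitInt_const_mul, unitInt_sub (by fun_prop) (by fun_prop), unitInt_neg] at h
  exact h.symm

theorem stuffle_two_three : 2 * (Real.pi ^ 2 / 6 * r3 1)
    = 2 * rpolylog 5 1 - 2 * unitInt (fun x => lc x * r3 x)
      + unitInt (fun x => l x * lc x * r2 x) := by
  have hs := unitInt_swap_inv_one_sub (g := l) (h := fun y => y * (l y * lc y))
    (by fun_prop) (by fun_prop) (by
      exact LogBdd.lc.congr fun x _ => by rw [lc]; ring)
  rw [unitInt_congr (F := fun y => y * (l y * lc y) * _) (G := fun y => -(l y * lc y * r2 y))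
    fun y hy => by
      have h1 := hy.1.ne'
      rw [unitInt_l_div_one_sub_mul hy, r2x]
      field_simp, unitInt_neg] at hs
  have e1 := unitInt_log_pow_mul_inv (c := 1) (by simp) 0
  have e2 := unitInt_log_pow_mul_inv (c := 1) (by simp) 1
  have e3 := unitInt_log_pow_mul_rpolylog (c := 1) (by simp) 1 (s := 3) (by norm_num)
  rw [unitInt_congr (G := lc) fun x _ => by rw [lc]; ring] at e1
  rw [unitInt_congr (G := fun x => l x * lc x) fun x _ => by rw [lc]; ring] at e2
  rw [unitInt_congr (G := fun x => l x * (r3 x / x)) fun x _ => by rw [r3]; ring_nf] at e3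
  have hb3 : LogBdd (fun x => r3 x / x) := by
    have h := LogBdd.rpolylog_mul_div (s := 3) (by norm_num) (c := 1) (by simp)
    simp only [one_mul] at h
    exact h
  have key : ∀ x ∈ Ioo (0 : ℝ) 1,
      l x * unitInt (fun y => y * (l y * lc y) * (1 / (1 - y * x)))
        = unitInt (fun y => l y * lc y) * lc x - 2 * (l x * (r3 x / x)) - 2 * (lc x * r3 x) :=
    fun x hx => by
      have hb := logBdd_inv_one_sub_mul hx
      have h1 := hx.1.ne'
      have h2 : 1 - x ≠ 0 := by linarith [hx.2]
      have h := unitInt_congr (F := fun y => lc x * (l y * lc y))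
        (G := fun y => lc x * (l y ^ 2 * (1 / (1 - y * x)))
          + l x * (y * (l y * lc y) * (1 / (1 - y * x)))) fun y hy => by
        have h3 : 1 - y ≠ 0 := by linarith [hy.2]
        have h4 : 1 - y * x ≠ 0 := by linarith [(mul_mem hy hx).2]
        have h5 : 1 - x * y ≠ 0 := by rwa [mul_comm]
        rw [lc, lc, mul_comm y x]
        field_simp
        ring
      rw [unitInt_const_mul, unitInt_add (by fun_prop) (by fun_prop), unitInt_const_mul,
        unitInt_const_mul, unitInt_l_sq_div_one_sub_mul hx] at h
      have h5 : lc x * (2 * (r3 x / x)) = 2 * (l x * (r3 x / x)) + 2 * (lc x * r3 x) := by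
        rw [lc]
        field_simp
        ring
      linarith
  rw [unitInt_congr key, unitInt_sub (by fun_prop) (by fun_prop),
    unitInt_sub (by fun_prop) (by fun_prop), unitInt_const_mul, unitInt_const_mul,
    unitInt_const_mul, e1, e2, e3, rpolylog_two_one] at hs
  rw [r3]
  norm_num [Nat.factorial] at hs ⊢
  linarith

theorem U_eq : U = 2 * (Real.pi ^ 2 / 6 * r3 1) - 3 * rpolylog 5 1 := by
  have h1 := stuffle_two_three
  have h2 := unitInt_r4c_eq
  have h3 := unitInt_l_pow_mx 3
  rw [unitInt_lc_r3, unitInt_l_lc_r2] at h1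
  rw [unitInt_r4c, unitInt_mx_r3, unitInt_l_sq_lc_m, h3] at h2
  norm_num [Nat.factorial] at h2
  linarith

theorem unitInt_l_sq_m_mx : unitInt (fun x => l x ^ 2 * (m x * mx x))
    = 8 * rpolylog 5 1 - 4 * (Real.pi ^ 2 / 6 * r3 1) := by
  have h1 := stuffle_two_three
  rw [unitInt_lc_r3, unitInt_l_lc_r2, U_eq] at h1
  linarith

theorem intervalIntegrable_log_one_sub_div {y : ℝ} (hy : y < 0) :
    IntervalIntegrable (fun t : ℝ => Real.log (1 - t) / t) volume 0 y := by
  rw [intervalIntegrable_iff, uIoc_of_ge hy.le]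
  refine Measure.integrableOn_of_bounded (M := 1) (by simp)
    (by fun_prop : Measurable fun t : ℝ => Real.log (1 - t) / t).aestronglyMeasurable ?_
  refine (ae_restrict_iff' measurableSet_Ioc).2 (Eventually.of_forall fun t ht => ?_)
  have h0 : 0 ≤ Real.log (1 - t) := Real.log_nonneg (by linarith [ht.2])
  have h1 : Real.log (1 - t) ≤ 1 - t - 1 := Real.log_le_sub_one_of_pos (by linarith [ht.2])
  rw [norm_div, Real.norm_eq_abs, Real.norm_eq_abs, abs_of_nonneg h0, abs_of_nonpos ht.2]
  exact div_le_one_of_le₀ (by linarith) (by linarith [ht.2])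

theorem hasDerivAt_dilogNeg {y : ℝ} (hy : y < 0) :
    HasDerivAt dilogNeg (-(Real.log (1 - y) / y)) y :=
  (intervalIntegral.integral_hasDerivAt_right (intervalIntegrable_log_one_sub_div hy)
    (by fun_prop : Measurable fun t : ℝ => Real.log (1 - t) / t).stronglyMeasurable.stronglyMeasurableAtFilter
    (ContinuousAt.div (ContinuousAt.log (by fun_prop) (by linarith)) continuousAt_id hy.ne)).neg

theorem dilogNeg_neg_one : dilogNeg (-1) = q2 1 := by
  have h := unitInt_l_pow_px 0
  have h2 := intervalIntegral.integral_comp_neg (a := 0) (b := 1)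
    (fun t : ℝ => Real.log (1 - t) / t)
  have h3 : unitInt px = ∫ x in (0 : ℝ)..1, px x := by
    rw [unitInt, ← integral_Ioc_eq_integral_Ioo, intervalIntegral.integral_of_le zero_le_one]
  norm_num at h
  rw [dilogNeg, q2, ← neg_neg (rpolylog 2 (-1)), ← h, ← intervalIntegral.integral_symm, h3,
    ← intervalIntegral.integral_neg, ← neg_zero, ← h2, neg_zero]
  refine intervalIntegral.integral_congr fun x _ => ?_
  simp only [sub_neg_eq_add, px, p, div_neg]

theorem dilogNeg_neg_inv {x : ℝ} (hx : x ∈ Ioo (0 : ℝ) 1) :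
    dilogNeg (-1 / x) = -(Real.pi ^ 2 / 6) - 1 / 2 * l x ^ 2 - q2 x := by
  have hd : ∀ y ∈ Ioo (0 : ℝ) 1,
      HasDerivAt (fun y => dilogNeg (-1 / y) + (1 / 2 * l y ^ 2 + q2 y)) 0 y := fun y hy => by
    have h0 := hy.1
    have h1 : 0 < 1 + y := by linarith
    have hc : HasDerivAt (fun y : ℝ => -1 / y) (1 / y ^ 2) y := by
      refine ((hasDerivAt_const y (-1 : ℝ)).div (hasDerivAt_id y) h0.ne').congr_deriv ?_
      simp
    have hn : -1 / y < 0 := div_neg_of_neg_of_pos (by norm_num) h0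
    refine (((hasDerivAt_dilogNeg hn).comp y hc).add ((((hasDerivAt_l hy).pow 2).const_mul
      (1 / 2)).add (hasDerivAt_q2 hy))).congr_deriv ?_
    have e : Real.log (1 - -1 / y) = p y - l y := by
      rw [p, l, ← Real.log_div h1.ne' h0.ne']
      congr 1
      field_simp
      ring
    rw [e]
    push_cast
    field_simp
    ring
  have ht : Tendsto (fun y => dilogNeg (-1 / y) + (1 / 2 * l y ^ 2 + q2 y)) (𝓝[<] 1)
      (𝓝 (q2 1 + (1 / 2 * 0 ^ 2 + q2 1))) := by
    refine Tendsto.add ?_ (((tendsto_l_one.pow 2).const_mul _).add tendsto_q2_one)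
    have hc : ContinuousAt (fun y : ℝ => dilogNeg (-1 / y)) 1 :=
      ContinuousAt.comp' (g := dilogNeg) (by
        rw [div_one]
        exact (hasDerivAt_dilogNeg (by norm_num)).continuousAt)
        (ContinuousAt.div (by fun_prop) (by fun_prop) one_ne_zero)
    have := hc.tendsto
    rw [div_one, dilogNeg_neg_one] at this
    exact this.mono_left nhdsWithin_le_nhds
  have h := eq_tendsto_one_of_deriv_eq_zero hd ht hx
  rw [q2_one] at h
  linarith

/-- `Li₂(4x/(1+x)²)` -/
noncomputable def g (x : ℝ) : ℝ := rpolylog 2 (4 * x / (1 + x) ^ 2)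

theorem one_sub_quad {x : ℝ} (hx : 0 ≤ x) :
    1 - 4 * x / (1 + x) ^ 2 = ((1 - x) / (1 + x)) ^ 2 := by
  have : 1 + x ≠ 0 := by linarith
  field_simp
  ring

theorem quad_mem {x : ℝ} (hx : x ∈ Ioo (0 : ℝ) 1) : 4 * x / (1 + x) ^ 2 ∈ Ioo (0 : ℝ) 1 := by
  have h0 := hx.1
  have h1 : 0 < 1 - x := by linarith [hx.2]
  have h2 : 0 < ((1 - x) / (1 + x)) ^ 2 := by positivity
  rw [← one_sub_quad h0.le] at h2
  exact ⟨by positivity, by linarith⟩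

theorem hasDerivAt_g {x : ℝ} (hx : x ∈ Ioo (0 : ℝ) 1) :
    HasDerivAt g (-2 * (m x - p x) * (1 / x - 2 * ic x)) x := by
  have h0 := hx.1
  have h1 : 0 < 1 + x := by linarith
  have h2 : 0 < 1 - x := by linarith [hx.2]
  have hq : HasDerivAt (fun x : ℝ => 4 * x / (1 + x) ^ 2)
      (4 * x / (1 + x) ^ 2 * (1 / x - 2 * ic x)) x := by
    refine (((hasDerivAt_id x).const_mul 4).div (((hasDerivAt_id x).const_add 1).pow 2)
      (by simp; positivity)).congr_deriv ?_
    rw [ic]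
    simp only [id_eq, Pi.pow_apply]
    push_cast
    field_simp
  have hm : m (4 * x / (1 + x) ^ 2) = 2 * (m x - p x) := by
    rw [m, one_sub_quad h0.le, Real.log_pow, Real.log_div h2.ne' h1.ne', m, p]
    push_cast
    ring
  refine ((hasDerivAt_r2 (quad_mem hx)).comp x hq).congr_deriv ?_
  rw [hm]
  have := (quad_mem hx).1.ne'
  field_simp

theorem abs_g_le {x : ℝ} (hx : x ∈ Ioo (0 : ℝ) 1) : |g x| ≤ 4 * rpolylog 2 1 * x := by
  have h0 := hx.1
  have hq := quad_mem hx
  have h := abs_rpolylog_le le_rfl (x := 4 * x / (1 + x) ^ 2)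
    (by rw [abs_of_pos hq.1]; exact hq.2.le)
  have h2 : 4 * x / (1 + x) ^ 2 ≤ 4 * x := div_le_self (by positivity) (one_le_pow₀ (by linarith))
  have h3 : 0 ≤ rpolylog 2 1 := by rw [rpolylog_two_one]; positivity
  rw [abs_of_pos hq.1] at h
  exact h.trans (by nlinarith)

theorem logBdd_g_div : LogBdd (fun x => g x / x) := by
  refine LogBdd.of_bounded (fun x hx => ?_) (4 * rpolylog 2 1) fun x hx => ?_
  · exact ((hasDerivAt_g hx).continuousAt.div continuousAt_id hx.1.ne').continuousWithinAt
  · rw [abs_div, abs_of_pos hx.1, div_le_iff₀ hx.1]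
    exact abs_g_le hx

theorem tendsto_g_one : Tendsto g (𝓝[<] 1) (𝓝 (Real.pi ^ 2 / 6)) := by
  refine tendsto_r2_one.comp (tendsto_nhdsWithin_iff.2 ⟨?_, ?_⟩)
  · have : ContinuousAt (fun x : ℝ => 4 * x / (1 + x) ^ 2) 1 :=
      ContinuousAt.div (by fun_prop) (by fun_prop) (by norm_num)
    have := this.tendsto
    norm_num at this
    exact this.mono_left nhdsWithin_le_nhds
  · filter_upwards [Ioo_mem_nhdsLT (zero_lt_one' ℝ)] with x hx using (quad_mem hx).2

/-- Integration by parts against the primitive of `Li₂(-1/x) / x`. -/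
theorem unitInt_eq_of_parts : unitInt (fun x => dilogNeg (-1 / x) * g x / x)
    = -q3 1 * (Real.pi ^ 2 / 6)
      - 2 * unitInt (fun x => (Real.pi ^ 2 / 6 * l x + 1 / 6 * l x ^ 3 + q3 x)
        * (mx x - px x - 2 * (m x * ic x - p x * ic x))) := by
  have hg := logBdd_g_div
  have h := unitInt_deriv
    (F := fun x => -(Real.pi ^ 2 / 6 * l x + 1 / 6 * l x ^ 3 + q3 x) * g x)
    (F' := fun x => (-(Real.pi ^ 2 / 6) - 1 / 2 * l x ^ 2 - q2 x) * (g x / x)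
      + 2 * ((Real.pi ^ 2 / 6 * l x + 1 / 6 * l x ^ 3 + q3 x)
        * (mx x - px x - 2 * (m x * ic x - p x * ic x))))
    (fun x hx => by
      refine ((((((hasDerivAt_l hx).const_mul _).add (((hasDerivAt_l hx).pow 3).const_mul _)).add
        (hasDerivAt_q3 hx)).neg).mul (hasDerivAt_g hx)).congr_deriv ?_
      have := hx.1.ne'
      simp only [Pi.neg_apply, Pi.add_apply, Pi.pow_apply]
      rw [mx, px]
      push_cast
      field_simp
      ring)
    (by fun_prop)
    (tendsto_zero_of_eq (G := fun x => -(Real.pi ^ 2 / 6 * l x + 1 / 6 * l x ^ 3 + q3 x)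
      * (g x / x)) (by fun_prop) fun x hx => by
        have := hx.1.ne'
        field_simp)
    (((((tendsto_l_one.const_mul _).add ((tendsto_l_one.pow 3).const_mul _)).add
      tendsto_q3_one).neg).mul tendsto_g_one)
  rw [unitInt_add (by fun_prop) (by fun_prop), unitInt_const_mul] at h
  rw [unitInt_congr fun x hx => by rw [dilogNeg_neg_inv hx, mul_div_assoc]]
  norm_num at h ⊢
  linarith

local notation "L" => Real.log 2
local notation "ζ₂" => Real.pi ^ 2 / 6
local notation "ζ₃" => rpolylog 3 1
local notation "ζ₅" => rpolylog 5 1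
local notation "P₄" => rpolylog 4 (1 / 2)
local notation "P₅" => rpolylog 5 (1 / 2)

theorem J_zero_right_values : J 0 0 = ζ₂ / 2 ∧ J 1 0 = -(3 / 4 * ζ₃) ∧
    J 2 0 = 7 / 4 * (Real.pi ^ 4 / 90) ∧ J 3 0 = -(45 / 8 * ζ₅) := by
  have h2 := rpolylog_neg_one (s := 2) (by norm_num)
  have h3 := rpolylog_neg_one (s := 3) (by norm_num)
  have h4 := rpolylog_neg_one (s := 4) (by norm_num)
  have h5 := rpolylog_neg_one (s := 5) (by norm_num)
  rw [rpolylog_two_one] at h2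
  rw [rpolylog_four_one] at h4
  simp only [J_zero_right]
  norm_num [Nat.factorial]
  refine ⟨?_, ?_, ?_, ?_⟩ <;> linarith

theorem M_zero_right_values : M 0 0 = -ζ₂ ∧ M 1 0 = 2 * ζ₃ ∧
    M 2 0 = -(6 * (Real.pi ^ 4 / 90)) ∧ M 3 0 = 24 * ζ₅ := by
  simp only [M_zero_right]
  norm_num [Nat.factorial, rpolylog_two_one, rpolylog_four_one]

/-- Evaluation of the integrals of total weight three. -/
theorem weight_three_values : rpolylog 2 (1 / 2) = ζ₂ / 2 - L ^ 2 / 2 ∧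
    rpolylog 3 (1 / 2) = L ^ 3 / 6 - L * ζ₂ / 2 + 7 / 8 * ζ₃ ∧
    J 0 1 = ζ₃ / 4 ∧ M 0 1 = -(5 / 8 * ζ₃) := by
  have a0 := T_one 0
  have a1 := T_one 1
  obtain ⟨h1, h2⟩ := two_logs
  obtain ⟨j0, j1, -⟩ := J_zero_right_values
  obtain ⟨-, m1, -⟩ := M_zero_right_values
  simp only [T_succ, T_zero, K_succ, j0, j1, m1] at a0 a1 h1 h2
  norm_num at a0 a1 h1 h2
  rw [rpolylog_two_one] at a0
  have e2 : rpolylog 2 (1 / 2) = ζ₂ / 2 - L ^ 2 / 2 := by linarith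
  rw [e2] at a1
  exact ⟨e2, by linarith, by linarith, by linarith⟩

/-- Evaluation of the integrals of total weight four. -/
theorem weight_four_values :
    J 0 2 = -L ^ 4 / 4 + 3 / 2 * L ^ 2 * ζ₂ - 21 / 4 * L * ζ₃ - 6 * P₄ + Real.pi ^ 4 / 15 ∧
    J 1 1 = -L ^ 4 / 6 + L ^ 2 * ζ₂ - 7 / 2 * L * ζ₃ - 4 * P₄ + Real.pi ^ 4 / 24 ∧
    M 0 2 = -(Real.pi ^ 4 / 240) ∧
    M 1 1 = L ^ 4 / 12 - L ^ 2 * ζ₂ / 2 + 7 / 4 * L * ζ₃ + 2 * P₄ - Real.pi ^ 4 / 144 := by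
  have a0 := T_one 2
  have h := vmap_weight_four
  obtain ⟨h1, h2⟩ := three_logs
  obtain ⟨e2, e3, -⟩ := weight_three_values
  obtain ⟨-, -, j2, -⟩ := J_zero_right_values
  obtain ⟨-, -, m2, -⟩ := M_zero_right_values
  simp only [T_succ, T_zero, K_succ, e2, e3, j2, m2] at a0 h h1 h2
  norm_num at a0 h h1 h2
  simp only [rpolylog_four_one] at a0 h
  refine ⟨?_, ?_, ?_, ?_⟩ <;> linarith

/-- Evaluation of the integrals of total weight five. -/
theorem weight_five_values :
    J 2 1 = 2 * ζ₂ * ζ₃ - 29 / 8 * ζ₅ ∧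
    J 1 2 = -2 / 5 * L ^ 5 + 2 * L ^ 3 * ζ₂ - 21 / 4 * L ^ 2 * ζ₃ - 12 * L * P₄ - 12 * P₅
      + 3 * ζ₂ * ζ₃ + 99 / 16 * ζ₅ ∧
    J 0 3 = -4 / 5 * L ^ 5 + 4 * L ^ 3 * ζ₂ - 21 / 2 * L ^ 2 * ζ₃ - 24 * L * P₄ - 24 * P₅
      + 24 * ζ₅ := by
  have a0 := T_one 3
  have h := vmap_weight_five
  have h1 := unitInt_l_sq_m_sq
  obtain ⟨e2, e3, -⟩ := weight_three_values
  obtain ⟨-, -, -, j3⟩ := J_zero_right_values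
  rw [unitInt_l_sq_m_mx, r3] at h1
  simp only [T_succ, T_zero, e2, e3, j3] at a0 h
  norm_num at a0 h
  refine ⟨?_, ?_, ?_⟩ <;> linarith

theorem V_eq : V = 3 / 4 * ζ₂ * ζ₃ - 17 / 16 * ζ₅ := by
  have h := U_eq_V
  obtain ⟨-, -, j01, -⟩ := weight_three_values
  obtain ⟨-, j12, j03⟩ := weight_five_values
  simp only [U_eq, r3, K_succ, K_zero, q2_one, j01, j12, j03] at h
  norm_num at h
  linarith

theorem unitInt_l_cube_pc_eq : unitInt (fun x => l x ^ 3 * pc x)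
    = -(7 / 120 * Real.pi ^ 4 * L) - 9 / 4 * ζ₂ * ζ₃ + 12 * ζ₅ := by
  have h := unitInt_q4_ic_eq
  obtain ⟨-, -, -, j3⟩ := J_zero_right_values
  rw [unitInt_q4_ic, q2_one, q3_one, q4_one, V_eq, j3] at h
  linarith

theorem unitInt_l_sq_p_pc_eq : unitInt (fun x => l x ^ 2 * ((p x + L) * pc x))
    = -1 / 5 * L ^ 5 + 2 / 3 * L ^ 3 * ζ₂ + 3 / 2 * L ^ 2 * ζ₃ - 8 * L * P₄
      - 49 / 360 * L * Real.pi ^ 4 - 16 * P₅ - 13 / 4 * ζ₂ * ζ₃ + 47 / 2 * ζ₅ := by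
  have h := unitInt_l_cube_pc
  obtain ⟨h1, h2⟩ := four_logs
  obtain ⟨-, j1, j2, j3⟩ := J_zero_right_values
  obtain ⟨-, -, -, m3⟩ := M_zero_right_values
  obtain ⟨j02, -, m02, m11⟩ := weight_four_values
  obtain ⟨j21, j12, j03⟩ := weight_five_values
  rw [unitInt_l_sq_p_pc]
  rw [unitInt_l_cube_pc_eq] at h
  simp only [K_succ, j1, j2, j3, m3, j02, m02, m11, j21, j12, j03] at h h1 h2 ⊢
  norm_num at h h1 h2 ⊢
  linarith

theorem N_eq : N = 1 / 20 * L ^ 5 - 1 / 6 * L ^ 3 * ζ₂ - 3 / 8 * L ^ 2 * ζ₃ + 2 * L * P₄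
    + 49 / 1440 * L * Real.pi ^ 4 + 4 * P₅ - 7 / 16 * ζ₂ * ζ₃ - 27 / 8 * ζ₅ := by
  obtain ⟨j21, -⟩ := weight_five_values
  rw [N_eq_of_representation, unitInt_q3_l_ic, unitInt_l_sq_p_pc_eq, j21, V_eq, q2_one, q3_one]
  ring

theorem Y_eq : Y = 2 / 15 * L ^ 5 - 2 / 3 * L ^ 3 * ζ₂ + 7 / 4 * L ^ 2 * ζ₃ + 4 * L * P₄ + 4 * P₅
    - 1 / 8 * ζ₂ * ζ₃ - 125 / 32 * ζ₅ := by
  have h := N_eq_of_kernel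
  obtain ⟨-, -, j2, -⟩ := J_zero_right_values
  obtain ⟨-, -, -, m01⟩ := weight_three_values
  obtain ⟨-, j11, -⟩ := weight_four_values
  rw [unitInt_q3_l_ic, unitInt_q3_p_ic, N_eq, V_eq, j2, m01, j11, q2_one, q3_one] at h
  linarith

theorem unitInt_l_sq_mx : unitInt (fun x => l x ^ 2 * mx x) = -(Real.pi ^ 4 / 45) := by
  have h := unitInt_l_pow_mx 2
  norm_num [Nat.factorial, rpolylog_four_one] at h
  linarith

theorem unitInt_dilogNeg_mul_g : unitInt (fun x => dilogNeg (-1 / x) * g x / x)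
    = 24 * P₅ + 16 * P₄ * L + Real.pi ^ 2 * ζ₃ / 2 - 93 * ζ₅ / 4 + 7 / 2 * ζ₃ * L ^ 2
      + 7 / 15 * L ^ 5 - 1 / 3 * Real.pi ^ 2 * L ^ 3 - 41 / 360 * Real.pi ^ 4 * L := by
  have a1 := unitInt_l_pow_mx 1
  have a3 := unitInt_l_pow_mx 3
  have b1 := unitInt_l_pow_px 1
  have b3 := unitInt_l_pow_px 3
  have c1 := unitInt_l_m_ic
  have c3 := unitInt_l_cube_m_ic
  have d3 := unitInt_l_sq_p_mx
  have h3 := unitInt_q3_sub_div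
  have z3 := rpolylog_neg_one (s := 3) (by norm_num)
  have z5 := rpolylog_neg_one (s := 5) (by norm_num)
  obtain ⟨j0, -⟩ := J_zero_right_values
  obtain ⟨m0, -⟩ := M_zero_right_values
  obtain ⟨-, -, j01, m01⟩ := weight_three_values
  obtain ⟨j21, -⟩ := weight_five_values
  rw [unitInt_l_pc, m0, m01, K_succ, K_succ, j0, j01] at c1
  rw [unitInt_l_cube_pc_eq, unitInt_l_sq_mx] at c3
  rw [unitInt_l_sq_m_mx, j21, r3] at d3
  rw [V_eq, U_eq, r3, q2_one, q3_one] at h3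
  rw [unitInt_eq_of_parts, unitInt_congr (G := fun x =>
    ζ₂ * (l x ^ 1 * mx x - l x ^ 1 * px x - 2 * (l x * (m x * ic x))
        + 2 * (l x ^ 1 * (p x ^ 1 * ic x)))
      + 1 / 6 * (l x ^ 3 * mx x - l x ^ 3 * px x - 2 * (l x ^ 3 * (m x * ic x))
        + 2 * (l x ^ 3 * (p x ^ 1 * ic x)))
      + (q3 x * mx x - q3 x * px x - 2 * (q3 x * (m x * ic x)) + 2 * (q3 x * (p x * ic x))))
    fun x _ => by ring]
  simp (disch := fun_prop) only [unitInt_add, unitInt_sub, unitInt_const_mul, K_eq, K_succ, j01,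
    j21, c1, h3, unitInt_q3_p_ic, Y_eq, q3_one, a1, a3, b1, b3]
  rw [show unitInt (fun x => q3 x * (m x * ic x)) = N from rfl, N_eq]
  have y3 : rpolylog 3 (-1) = -(3 / 4) * ζ₃ := by linarith
  have y5 : rpolylog 5 (-1) = -(15 / 16) * ζ₅ := by linarith
  have x3 : unitInt (fun x => l x ^ 3 * (m x * ic x))
      = -(1 / 8 * Real.pi ^ 4 * L) - 9 / 2 * ζ₂ * ζ₃ + 273 / 16 * ζ₅ := by linarith
  norm_num [Nat.factorial, y3, y5, x3]
  ring

theorem integral_dilogNeg_mul_rpolylog :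
    ∫ x in (0 : ℝ)..1, dilogNeg (-1 / x) * rpolylog 2 (4 * x / (1 + x) ^ 2) / x
      = 24 * P₅ + 16 * P₄ * L + Real.pi ^ 2 * ζ₃ / 2 - 93 * ζ₅ / 4 + 7 / 2 * ζ₃ * L ^ 2
        + 7 / 15 * L ^ 5 - 1 / 3 * Real.pi ^ 2 * L ^ 3 - 41 / 360 * Real.pi ^ 4 * L := by
  rw [intervalIntegral.integral_of_le zero_le_one, integral_Ioc_eq_integral_Ioo]
  exact unitInt_dilogNeg_mul_g

end DilogIntegral

/-- `∫₀¹ Li₂(−1/x)·Li₂(4x/(1+x)²)/x dx = 24·Li₅(1/2) + 16·Li₄(1/2)·log 2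
+ π²ζ(3)/2 − 93ζ(5)/4 + (7/2)ζ(3)log²2 + (7/15)log⁵2 − (1/3)π²log³2 − (41/360)π⁴·log 2`. -/
theorem statement14 :
    ((∫ x in (0 : ℝ)..1, dilogNeg (-1 / x) * rpolylog 2 (4 * x / (1 + x) ^ 2) / x : ℝ) : ℂ)
      = 24 * (rpolylog 5 (1 / 2) : ℂ) + 16 * (rpolylog 4 (1 / 2) : ℂ) * (Real.log 2 : ℂ)
        + (Real.pi : ℂ) ^ 2 * riemannZeta 3 / 2 - 93 * riemannZeta 5 / 4
        + 7 / 2 * riemannZeta 3 * (Real.log 2 : ℂ) ^ 2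
        + 7 / 15 * (Real.log 2 : ℂ) ^ 5
        - 1 / 3 * (Real.pi : ℂ) ^ 2 * (Real.log 2 : ℂ) ^ 3
        - 41 / 360 * (Real.pi : ℂ) ^ 4 * (Real.log 2 : ℂ) := by
  have h3 := DilogIntegral.riemannZeta_eq_rpolylog (s := 3) (by norm_num)
  have h5 := DilogIntegral.riemannZeta_eq_rpolylog (s := 5) (by norm_num)
  push_cast at h3 h5
  rw [h3, h5, DilogIntegral.integral_dilogNeg_mul_rpolylog]
  push_cast
  ring
end

section
/- ∑_{n=2}^∞ (H_{n−1}^{(2)}/n³)·4ⁿ·binom(2n,n)^{−1} = (1/12)·π⁴·log 2 − (3/4)·π²·ζ(3) + (31/8)·ζ(5), where H_{n−1}^{(2)} = ∑_{k=1}^{n−1} 1/k². -/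
open Real Filter Topology MeasureTheory intervalIntegral

/-- The normalised inverse central binomial coefficient `4ⁿ / C(2n, n)`. -/
noncomputable def invCentralBinom (n : ℕ) : ℝ := 4 ^ n / (n.centralBinom : ℝ)

/-- The generalised harmonic number `H_n^{(2)}`. -/
noncomputable def harmonicTwo (n : ℕ) : ℝ := ∑ k ∈ Finset.range n, 1 / ((k : ℝ) + 1) ^ 2

theorem invCentralBinom_nonneg (n : ℕ) : 0 ≤ invCentralBinom n := by
  unfold invCentralBinom; positivity

theorem invCentralBinom_succ (n : ℕ) :
    invCentralBinom (n + 1) * (2 * n + 1) = invCentralBinom n * (2 * (n + 1)) := by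
  have h := Nat.succ_mul_centralBinom_succ n
  have h1 : (n.centralBinom : ℝ) ≠ 0 := by exact_mod_cast n.centralBinom_ne_zero
  have h2 : ((n + 1).centralBinom : ℝ) ≠ 0 := by exact_mod_cast (n + 1).centralBinom_ne_zero
  have h' : ((n : ℝ) + 1) * (n + 1).centralBinom = 2 * (2 * n + 1) * n.centralBinom := by
    exact_mod_cast h
  unfold invCentralBinom
  field_simp
  rw [pow_succ]
  linear_combination (-2 * 4 ^ n : ℝ) * h'

theorem invCentralBinom_le (n : ℕ) : invCentralBinom n ≤ 2 * n + 1 := by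
  rcases Nat.eq_zero_or_pos n with rfl | hn
  · simp [invCentralBinom]
  have h := Nat.four_pow_le_two_mul_self_mul_centralBinom n hn
  have h1 : (0 : ℝ) < n.centralBinom := by exact_mod_cast n.centralBinom_pos
  unfold invCentralBinom
  rw [div_le_iff₀ h1]
  have h' : (4 : ℝ) ^ n ≤ 2 * n * n.centralBinom := by exact_mod_cast h
  nlinarith

theorem harmonicTwo_nonneg (n : ℕ) : 0 ≤ harmonicTwo n :=
  Finset.sum_nonneg fun _ _ => by positivity

theorem harmonicTwo_succ (n : ℕ) :
    harmonicTwo (n + 1) = harmonicTwo n + 1 / ((n : ℝ) + 1) ^ 2 :=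
  Finset.sum_range_succ _ _

theorem harmonicTwo_le (n : ℕ) : harmonicTwo n ≤ n := by
  have : harmonicTwo n ≤ ∑ _k ∈ Finset.range n, (1 : ℝ) := by
    refine Finset.sum_le_sum fun k _ => ?_
    rw [div_le_one (by positivity)]
    exact one_le_pow₀ (by linarith [(Nat.cast_nonneg k : (0 : ℝ) ≤ k)])
  simpa using this

/-- A function with vanishing value and slope at `0` and nonnegative second derivative on `[0, T]`
is nonnegative at `T`. -/
theorem nonneg_of_second_deriv_nonneg {f f' f'' : ℝ → ℝ} (hf : ∀ t, HasDerivAt f (f' t) t)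
    (hf' : ∀ t, HasDerivAt f' (f'' t) t) (h0 : f 0 = 0) (h0' : f' 0 = 0) {T : ℝ} (hT : 0 ≤ T)
    (h : ∀ s ∈ Set.Icc 0 T, 0 ≤ f'' s) : 0 ≤ f T := by
  have m' : MonotoneOn f' (Set.Icc 0 T) :=
    monotoneOn_of_deriv_nonneg (convex_Icc 0 T)
      (fun t _ => (hf' t).continuousAt.continuousWithinAt)
      (fun t _ => (hf' t).differentiableAt.differentiableWithinAt)
      fun t ht => by rw [(hf' t).deriv]; exact h t (interior_subset ht)
  have m : MonotoneOn f (Set.Icc 0 T) :=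
    monotoneOn_of_deriv_nonneg (convex_Icc 0 T)
      (fun t _ => (hf t).continuousAt.continuousWithinAt)
      (fun t _ => (hf t).differentiableAt.differentiableWithinAt)
      fun t ht => by
        have ht' := interior_subset ht
        rw [(hf t).deriv, ← h0']
        exact m' ⟨le_rfl, hT⟩ ht' ht'.1
  rw [← h0]
  exact m ⟨le_rfl, hT⟩ ⟨hT, le_rfl⟩ hT

theorem le_of_second_deriv_le {f f' f'' : ℝ → ℝ} (hf : ∀ t, HasDerivAt f (f' t) t)
    (hf' : ∀ t, HasDerivAt f' (f'' t) t) (h0 : f 0 = 0) (h0' : f' 0 = 0) {T M : ℝ} (hT : 0 ≤ T)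
    (h : ∀ s ∈ Set.Icc 0 T, f'' s ≤ M) : f T ≤ M * T ^ 2 / 2 := by
  have key := nonneg_of_second_deriv_nonneg (f := fun t => M * t ^ 2 / 2 - f t)
    (f' := fun t => M * t - f' t) (f'' := fun t => M - f'' t) (T := T)
    (fun t => by
      refine HasDerivAt.sub ?_ (hf t)
      have := ((hasDerivAt_id t).pow 2).const_mul (M / 2)
      convert! this using 1
      · ext x; simp; ring
      · simp; ring)
    (fun t => by
      refine HasDerivAt.sub ?_ (hf' t)
      simpa using (hasDerivAt_id t).const_mul M)
    (by simp [h0]) (by simp [h0']) hT (fun s hs => sub_nonneg.2 (h s hs))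
  simpa using key

/-- Partial sum of an even power series in `sin t`, with coefficients normalised by
`4ⁿ / (C(2n, n) n²)`. -/
noncomputable def sinSum (w : ℕ → ℝ) (N : ℕ) (t : ℝ) : ℝ :=
  ∑ n ∈ Finset.range N,
    w n * invCentralBinom (n + 1) / (4 * ((n : ℝ) + 1) ^ 2) * sin t ^ (2 * n + 2)

/-- The derivative of `sinSum`. -/
noncomputable def sinSumDeriv (w : ℕ → ℝ) (N : ℕ) (t : ℝ) : ℝ :=
  ∑ n ∈ Finset.range N,
    w n * invCentralBinom (n + 1) / (2 * ((n : ℝ) + 1)) * (sin t ^ (2 * n + 1) * cos t)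

theorem sinSum_zero (w : ℕ → ℝ) (N : ℕ) : sinSum w N 0 = 0 := by simp [sinSum]

theorem sinSumDeriv_zero (w : ℕ → ℝ) (N : ℕ) : sinSumDeriv w N 0 = 0 := by simp [sinSumDeriv]

theorem hasDerivAt_sinSum (w : ℕ → ℝ) (N : ℕ) (t : ℝ) :
    HasDerivAt (sinSum w N) (sinSumDeriv w N t) t := by
  unfold sinSum sinSumDeriv
  refine HasDerivAt.fun_sum fun n _ => ?_
  have := ((hasDerivAt_sin t).pow (2 * n + 2)).const_mul
    (w n * invCentralBinom (n + 1) / (4 * ((n : ℝ) + 1) ^ 2))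
  refine this.congr_deriv ?_
  push_cast
  field_simp
  ring

theorem hasDerivAt_sinSumDeriv (w : ℕ → ℝ) (N : ℕ) (t : ℝ) :
    HasDerivAt (sinSumDeriv w N) (∑ n ∈ Finset.range N,
      w n * (invCentralBinom n * sin t ^ (2 * n) -
        invCentralBinom (n + 1) * sin t ^ (2 * (n + 1)))) t := by
  unfold sinSumDeriv
  refine HasDerivAt.fun_sum fun n _ => ?_
  have := (((hasDerivAt_sin t).pow (2 * n + 1)).mul (hasDerivAt_cos t)).const_mul
    (w n * invCentralBinom (n + 1) / (2 * ((n : ℝ) + 1)))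
  refine this.congr_deriv ?_
  have h := invCentralBinom_succ n
  have h' : invCentralBinom n = invCentralBinom (n + 1) * (2 * n + 1) / (2 * (n + 1)) := by
    rw [h]; field_simp
  rw [h']
  push_cast
  simp only [Pi.pow_apply]
  have hc : cos t * cos t = 1 - sin t ^ 2 := by rw [← cos_sq']; ring
  field_simp
  linear_combination (2 * n + 1) * sin t ^ (2 * n) * w n * invCentralBinom (n + 1) * hc

/-- The remainder in `t² / 2 = ∑ 4ⁿ sin²ⁿ t / (4 n² C(2n, n))`. -/
noncomputable def sqRemainder (N : ℕ) (t : ℝ) : ℝ := t ^ 2 / 2 - sinSum (fun _ => 1) N t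

/-- The remainder in `t⁴ / 24 = ∑ H_{n-1}^{(2)} 4ⁿ sin²ⁿ t / (16 n² C(2n, n))`. -/
noncomputable def quarticRemainder (N : ℕ) (t : ℝ) : ℝ :=
  t ^ 4 / 24 - sinSum (fun n => harmonicTwo n / 4) N t

theorem sqRemainder_zero (N : ℕ) : sqRemainder N 0 = 0 := by simp [sqRemainder, sinSum_zero]

theorem quarticRemainder_zero (N : ℕ) : quarticRemainder N 0 = 0 := by
  simp [quarticRemainder, sinSum_zero]

theorem hasDerivAt_sqRemainder (N : ℕ) (t : ℝ) :
    HasDerivAt (sqRemainder N) (t - sinSumDeriv (fun _ => 1) N t) t := by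
  refine HasDerivAt.sub ?_ (hasDerivAt_sinSum _ N t)
  refine ((hasDerivAt_pow 2 t).div_const 2).congr_deriv ?_
  simp

theorem hasDerivAt_deriv_sqRemainder (N : ℕ) (t : ℝ) :
    HasDerivAt (fun t => t - sinSumDeriv (fun _ => 1) N t)
      (invCentralBinom N * sin t ^ (2 * N)) t := by
  refine ((hasDerivAt_id t).sub (hasDerivAt_sinSumDeriv _ N t)).congr_deriv ?_
  simp only [one_mul]
  rw [Finset.sum_range_sub' (fun n => invCentralBinom n * sin t ^ (2 * n))]
  simp [invCentralBinom]

theorem hasDerivAt_quarticRemainder (N : ℕ) (t : ℝ) :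
    HasDerivAt (quarticRemainder N)
      (t ^ 3 / 6 - sinSumDeriv (fun n => harmonicTwo n / 4) N t) t := by
  refine HasDerivAt.sub ?_ (hasDerivAt_sinSum _ N t)
  refine ((hasDerivAt_pow 4 t).div_const 24).congr_deriv ?_
  norm_num; ring

theorem hasDerivAt_deriv_quarticRemainder (N : ℕ) (t : ℝ) :
    HasDerivAt (fun t => t ^ 3 / 6 - sinSumDeriv (fun n => harmonicTwo n / 4) N t)
      (sqRemainder N t + harmonicTwo N / 4 * (invCentralBinom N * sin t ^ (2 * N))) t := by
  refine (((hasDerivAt_pow 3 t).div_const 6).sub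
    (hasDerivAt_sinSumDeriv _ N t)).congr_deriv ?_
  unfold sqRemainder sinSum
  induction N with
  | zero => simp [harmonicTwo]; ring
  | succ N ih =>
    simp only [Finset.sum_range_succ, harmonicTwo_succ] at ih ⊢
    have e (a : ℝ) : a / (4 * ((N : ℝ) + 1) ^ 2) = a / 4 * (1 / ((N : ℝ) + 1) ^ 2) := by
      field_simp
    rw [show 2 * (N + 1) = 2 * N + 2 by ring, e]
    linear_combination ih

theorem sqRemainder_nonneg (N : ℕ) {t : ℝ} (ht : 0 ≤ t) : 0 ≤ sqRemainder N t :=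
  nonneg_of_second_deriv_nonneg (hasDerivAt_sqRemainder N) (hasDerivAt_deriv_sqRemainder N)
    (sqRemainder_zero N) (by simp [sinSumDeriv_zero]) ht fun s _ =>
      mul_nonneg (invCentralBinom_nonneg N) (by rw [pow_mul]; positivity)

theorem quarticRemainder_nonneg (N : ℕ) {t : ℝ} (ht : 0 ≤ t) : 0 ≤ quarticRemainder N t :=
  nonneg_of_second_deriv_nonneg (hasDerivAt_quarticRemainder N)
    (hasDerivAt_deriv_quarticRemainder N)
    (quarticRemainder_zero N) (by simp [sinSumDeriv_zero]) ht fun s hs =>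
      add_nonneg (sqRemainder_nonneg N hs.1) <| mul_nonneg
        (div_nonneg (harmonicTwo_nonneg N) (by norm_num))
        (mul_nonneg (invCentralBinom_nonneg N) (by rw [pow_mul]; positivity))

theorem sqRemainder_le (N : ℕ) {t : ℝ} (ht : 0 ≤ t) (ht' : t ≤ π / 2) :
    sqRemainder N t ≤ invCentralBinom N * sin t ^ (2 * N) * t ^ 2 / 2 := by
  refine le_of_second_deriv_le (hasDerivAt_sqRemainder N) (hasDerivAt_deriv_sqRemainder N)
    (sqRemainder_zero N) (by simp [sinSumDeriv_zero]) ht fun s hs => ?_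
  have h0 : 0 ≤ sin s := sin_nonneg_of_nonneg_of_le_pi hs.1 (by linarith [hs.2, pi_pos])
  have h1 : sin s ≤ sin t := sin_le_sin_of_le_of_le_pi_div_two (by linarith [hs.1, pi_pos]) ht' hs.2
  have := invCentralBinom_nonneg N
  gcongr

theorem quarticRemainder_le (N : ℕ) {t : ℝ} (ht : 0 ≤ t) (ht' : t ≤ π / 2) :
    quarticRemainder N t ≤ invCentralBinom N * sin t ^ (2 * N) *
      (t ^ 2 / 2 + harmonicTwo N / 4) * t ^ 2 / 2 := by
  refine le_of_second_deriv_le (hasDerivAt_quarticRemainder N)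
    (hasDerivAt_deriv_quarticRemainder N)
    (quarticRemainder_zero N) (by simp [sinSumDeriv_zero]) ht fun s hs => ?_
  have h0 : 0 ≤ sin s := sin_nonneg_of_nonneg_of_le_pi hs.1 (by linarith [hs.2, pi_pos])
  have h1 : sin s ≤ sin t := sin_le_sin_of_le_of_le_pi_div_two (by linarith [hs.1, pi_pos]) ht' hs.2
  have hc := invCentralBinom_nonneg N
  have hH := harmonicTwo_nonneg N
  have hs0 := hs.1
  have hst := hs.2
  have ht0 : 0 ≤ sin t := h0.trans h1
  calc _ ≤ invCentralBinom N * sin s ^ (2 * N) * s ^ 2 / 2 +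
        harmonicTwo N / 4 * (invCentralBinom N * sin s ^ (2 * N)) := by
        gcongr; exact sqRemainder_le N hs.1 (hs.2.trans ht')
    _ ≤ invCentralBinom N * sin t ^ (2 * N) * t ^ 2 / 2 +
        harmonicTwo N / 4 * (invCentralBinom N * sin t ^ (2 * N)) := by gcongr
    _ = _ := by ring

theorem tendsto_quarticRemainder {t : ℝ} (ht : 0 ≤ t) (ht' : t < π / 2) :
    Tendsto (fun N => quarticRemainder N t) atTop (𝓝 0) := by
  have hs0 : 0 ≤ sin t := sin_nonneg_of_nonneg_of_le_pi ht (by linarith [pi_pos])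
  have hs1 : sin t < 1 := by
    rw [← sin_pi_div_two]
    exact sin_lt_sin_of_lt_of_le_pi_div_two (by linarith) le_rfl ht'
  have hq : |sin t ^ 2| < 1 := by
    rw [abs_of_nonneg (by positivity)]; exact pow_lt_one₀ hs0 hs1 (by norm_num)
  have l (k : ℕ) := tendsto_pow_const_mul_const_pow_of_abs_lt_one k hq
  have lim : Tendsto (fun N : ℕ => (2 * (N : ℝ) + 1) * sin t ^ (2 * N) *
      (t ^ 2 / 2 + N / 4) * t ^ 2 / 2) atTop (𝓝 0) := by
    have := (((l 2).const_mul (t ^ 2 / 4)).add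
      ((l 1).const_mul ((t ^ 2 + 1 / 4) * t ^ 2 / 2))).add ((l 0).const_mul (t ^ 4 / 4))
    simp only [mul_zero, add_zero] at this
    refine this.congr fun N => ?_
    rw [pow_mul (sin t) 2 N]
    ring
  refine squeeze_zero (fun N => quarticRemainder_nonneg N ht)
    (fun N => (quarticRemainder_le N ht ht'.le).trans ?_) lim
  have := invCentralBinom_nonneg N
  have := harmonicTwo_nonneg N
  gcongr
  · exact invCentralBinom_le N
  · exact harmonicTwo_le N

theorem pow_four_div_sin_le {t : ℝ} (ht : 0 < t) (ht' : t ≤ π / 2) :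
    t ^ 4 / sin t ≤ (π / 2) ^ 4 := by
  have hp := pi_pos
  have h := mul_le_sin ht.le ht'
  have hs : 0 < sin t := lt_of_lt_of_le (by positivity) h
  rw [div_le_iff₀ hs]
  calc t ^ 4 = t ^ 3 * (π / 2) * (2 / π * t) := by field_simp
    _ ≤ (π / 2) ^ 3 * (π / 2) * sin t := by gcongr
    _ = _ := by ring

theorem integral_cos_mul_sin_pow (n : ℕ) :
    ∫ t in (0 : ℝ)..π / 2, cos t * sin t ^ (2 * n + 1) = 1 / (2 * (n + 1)) := by
  rw [integral_eq_sub_of_hasDerivAt (f := fun t => sin t ^ (2 * n + 2) / (2 * (n + 1)))]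
  · simp
  · intro t _
    refine (((hasDerivAt_sin t).pow (2 * n + 2)).div_const (2 * (n + 1))).congr_deriv ?_
    push_cast
    field_simp
  · exact (by fun_prop : Continuous _).intervalIntegrable _ _

theorem integral_cot_mul_sinSum (w : ℕ → ℝ) (N : ℕ) :
    ∫ t in (0 : ℝ)..π / 2, cos t / sin t * sinSum w N t =
      ∑ n ∈ Finset.range N, w n * invCentralBinom (n + 1) / (8 * ((n : ℝ) + 1) ^ 3) := by
  have e (t : ℝ) : cos t / sin t * sinSum w N t = ∑ n ∈ Finset.range N,
      w n * invCentralBinom (n + 1) / (4 * ((n : ℝ) + 1) ^ 2) *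
        (cos t * sin t ^ (2 * n + 1)) := by
    rw [sinSum, Finset.mul_sum]
    refine Finset.sum_congr rfl fun n _ => ?_
    rcases eq_or_ne (sin t) 0 with h | h
    · simp [h]
    · field_simp
      ring
  simp_rw [e]
  rw [integral_finsetSum fun n _ => (by fun_prop : Continuous _).intervalIntegrable _ _]
  refine Finset.sum_congr rfl fun n _ => ?_
  rw [intervalIntegral.integral_const_mul, integral_cos_mul_sin_pow]
  field_simp
  ring

theorem tendsto_integral_cot_mul_sinSum :
    Tendsto (fun N => ∫ t in (0 : ℝ)..π / 2,
        cos t / sin t * sinSum (fun n => harmonicTwo n / 4) N t) atTop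
      (𝓝 (∫ t in (0 : ℝ)..π / 2, cos t / sin t * (t ^ 4 / 24))) := by
  have hp := pi_pos
  refine tendsto_integral_filter_of_dominated_convergence (fun _ => (π / 2) ^ 4) ?_ ?_
    intervalIntegrable_const ?_
  · refine Eventually.of_forall fun N => Measurable.aestronglyMeasurable ?_
    unfold sinSum
    fun_prop
  · refine Eventually.of_forall fun N => Eventually.of_forall fun t ht => ?_
    rw [Set.uIoc_of_le (by positivity)] at ht
    have hs : 0 < sin t := sin_pos_of_pos_of_lt_pi ht.1 (by linarith [ht.2])
    have hc : 0 ≤ cos t := cos_nonneg_of_neg_pi_div_two_le_of_le (by linarith [ht.1]) ht.2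
    have hP : 0 ≤ sinSum (fun n => harmonicTwo n / 4) N t :=
      Finset.sum_nonneg fun n _ => by
        have := harmonicTwo_nonneg n
        have := invCentralBinom_nonneg (n + 1)
        positivity
    have hR := quarticRemainder_nonneg N ht.1.le
    rw [norm_of_nonneg (by positivity)]
    have h4 : 0 ≤ t ^ 4 := by positivity
    calc _ ≤ 1 / sin t * t ^ 4 := by
          gcongr
          · exact cos_le_one t
          · unfold quarticRemainder at hR; linarith
      _ = t ^ 4 / sin t := by ring
      _ ≤ _ := pow_four_div_sin_le ht.1 ht.2
  · have hne : ∀ᵐ t : ℝ, t ≠ π / 2 := Measure.ae_ne volume _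
    filter_upwards [hne] with t hne ht
    rw [Set.uIoc_of_le (by positivity)] at ht
    have h := tendsto_quarticRemainder ht.1.le (lt_of_le_of_ne ht.2 hne)
    refine Tendsto.const_mul _ ?_
    have := h.const_sub (t ^ 4 / 24)
    simpa [quarticRemainder] using this

theorem hasSum_eq_integral :
    HasSum (fun n : ℕ => harmonicTwo n * invCentralBinom (n + 1) / ((n : ℝ) + 1) ^ 3)
      (4 / 3 * ∫ t in (0 : ℝ)..π / 2, cos t / sin t * t ^ 4) := by
  rw [hasSum_iff_tendsto_nat_of_nonneg]
  · have h := tendsto_integral_cot_mul_sinSum.const_mul 32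
    simp_rw [integral_cot_mul_sinSum, ← mul_div_assoc, intervalIntegral.integral_div] at h
    convert! h using 2
    · rw [Finset.mul_sum]
      refine Finset.sum_congr rfl fun n _ => ?_
      field_simp
      ring
    · ring
  · intro n
    have := harmonicTwo_nonneg n
    have := invCentralBinom_nonneg (n + 1)
    positivity

theorem cos_eq_sin_mul_sum_add (N : ℕ) (t : ℝ) :
    cos t = sin t * ∑ k ∈ Finset.range N, 2 * sin (2 * (k + 1) * t) + cos ((2 * N + 1) * t) := by
  induction N with
  | zero => simp
  | succ N ih =>
    rw [Finset.sum_range_succ]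
    push_cast
    have h1 : cos ((2 * N + 1) * t) =
        cos (2 * (N + 1) * t) * cos t + sin (2 * (N + 1) * t) * sin t := by
      rw [← cos_sub]; ring_nf
    have h2 : cos ((2 * (N + 1) + 1) * t) =
        cos (2 * (N + 1) * t) * cos t - sin (2 * (N + 1) * t) * sin t := by
      rw [← cos_add]; ring_nf
    linear_combination ih + h1 - h2

theorem integral_pow_four_mul_sin (k : ℕ) :
    ∫ t in (0 : ℝ)..π / 2, t ^ 4 * (2 * sin (2 * (k + 1) * t)) =
      π ^ 4 / 16 * ((-1) ^ k / (k + 1)) - 3 * π ^ 2 / 4 * ((-1) ^ k / (k + 1) ^ 3)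
        + 3 / 2 * ((1 + (-1) ^ k) / (k + 1) ^ 5) := by
  have hk : (k : ℝ) + 1 ≠ 0 := by positivity
  rw [integral_eq_sub_of_hasDerivAt (f := fun t =>
    (-t ^ 4 / (k + 1) + 3 * t ^ 2 / (k + 1) ^ 3 - 3 / 2 / (k + 1) ^ 5) * cos (2 * (k + 1) * t)
      + (2 * t ^ 3 / (k + 1) ^ 2 - 3 * t / (k + 1) ^ 4) * sin (2 * (k + 1) * t))]
  · have e : 2 * ((k : ℝ) + 1) * (π / 2) = (k + 1 : ℕ) * π := by push_cast; ring
    simp only [e, cos_nat_mul_pi, sin_nat_mul_pi, mul_zero, cos_zero, sin_zero]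
    field_simp
    ring
  · intro t _
    have hl : HasDerivAt (fun t : ℝ => 2 * ((k : ℝ) + 1) * t) (2 * (k + 1)) t := by
      simpa using (hasDerivAt_id t).const_mul (2 * ((k : ℝ) + 1))
    have hp (n : ℕ) (c : ℝ) := (hasDerivAt_pow n t).const_mul c
    have h := (((((hp 4 (-1)).div_const ((k : ℝ) + 1)).add
      ((hp 2 3).div_const (((k : ℝ) + 1) ^ 3))).sub_const (3 / 2 / ((k : ℝ) + 1) ^ 5)).mul
      hl.cos).add ((((hp 3 2).div_const (((k : ℝ) + 1) ^ 2)).sub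
      ((hp 1 3).div_const (((k : ℝ) + 1) ^ 4))).mul hl.sin)
    convert! h using 1
    · ext x
      simp
    · simp
      field_simp
      ring
  · exact (by fun_prop : Continuous _).intervalIntegrable _ _

/-- Riemann-Lebesgue lemma for the odd cosine frequencies on an interval. -/
theorem tendsto_integral_mul_cos_odd {f : ℝ → ℝ} {a b : ℝ} (hab : a ≤ b)
    (hf : IntervalIntegrable f volume a b) :
    Tendsto (fun N : ℕ => ∫ t in a..b, f t * cos ((2 * N + 1) * t)) atTop (𝓝 0) := by
  have h := Real.tendsto_integral_exp_smul_cocompact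
    ((Set.Ioc a b).indicator fun t => (f t : ℂ))
  have hw : Tendsto (fun N : ℕ => (2 * (N : ℝ) + 1) / (2 * π)) atTop (cocompact ℝ) := by
    refine Tendsto.mono_right ?_ atTop_le_cocompact
    refine Tendsto.atTop_div_const (by positivity) ?_
    exact tendsto_atTop_add_const_right _ _
      (tendsto_natCast_atTop_atTop.const_mul_atTop (by norm_num))
  have h' := (Complex.continuous_re.tendsto _).comp (h.comp hw)
  simp only [Complex.zero_re] at h'
  refine h'.congr fun N => ?_
  simp only [Function.comp_apply]
  have e (v : ℝ) : (fourierChar (-(v * ((2 * N + 1) / (2 * π)))) •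
      (Set.Ioc a b).indicator (fun t => (f t : ℂ)) v) =
      (Set.Ioc a b).indicator (fun v =>
        Complex.exp (((-((2 * N + 1) * v) : ℝ) : ℂ) * Complex.I) * (f v : ℂ)) v := by
    have hv' : 2 * π * -(v * ((2 * (N : ℝ) + 1) / (2 * π))) = -((2 * N + 1) * v) := by
      field_simp
    by_cases hv : v ∈ Set.Ioc a b <;>
      simp only [hv, Set.indicator_of_mem, Set.indicator_of_notMem, not_false_eq_true,
        Circle.smul_def, Real.fourierChar_apply, hv', smul_eq_mul, mul_zero]
  simp_rw [e]
  rw [MeasureTheory.integral_indicator measurableSet_Ioc, integral_of_le hab,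
    ← RCLike.re_eq_complex_re, ← integral_re]
  · refine integral_congr_ae (Eventually.of_forall fun v => ?_)
    simp only [RCLike.re_eq_complex_re, Complex.re_mul_ofReal, Complex.exp_ofReal_mul_I_re,
      cos_neg]
    exact mul_comm _ _
  · have hf' := ((intervalIntegrable_iff_integrableOn_Ioc_of_le hab).1 hf).ofReal (𝕜 := ℂ)
    refine hf'.bdd_mul (c := 1) ?_ ?_
    · exact (by fun_prop : Continuous _).aestronglyMeasurable
    · exact Eventually.of_forall fun v => (Complex.norm_exp_ofReal_mul_I _).le

theorem intervalIntegrable_pow_four_div_sin :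
    IntervalIntegrable (fun t => t ^ 4 / sin t) volume 0 (π / 2) := by
  have hp := pi_pos
  refine (intervalIntegrable_const (c := (π / 2) ^ 4)).mono_fun ?_ ?_
  · exact Measurable.aestronglyMeasurable (by fun_prop)
  · rw [Set.uIoc_of_le (by positivity)]
    filter_upwards [ae_restrict_mem measurableSet_Ioc] with t ht
    have hs : 0 < sin t := sin_pos_of_pos_of_lt_pi ht.1 (by linarith [ht.2])
    rw [norm_of_nonneg (by positivity), norm_of_nonneg (by positivity)]
    exact pow_four_div_sin_le ht.1 ht.2

theorem tendsto_sum_integral_pow_four_mul_sin :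
    Tendsto (fun N : ℕ => ∑ k ∈ Finset.range N,
        ∫ t in (0 : ℝ)..π / 2, t ^ 4 * (2 * sin (2 * (k + 1) * t))) atTop
      (𝓝 (∫ t in (0 : ℝ)..π / 2, cos t / sin t * t ^ 4)) := by
  have hp := pi_pos
  have h := (tendsto_integral_mul_cos_odd (by positivity)
    intervalIntegrable_pow_four_div_sin).const_sub (∫ t in (0 : ℝ)..π / 2, cos t / sin t * t ^ 4)
  rw [sub_zero] at h
  refine h.congr fun N => ?_
  have hi : IntervalIntegrable (fun t => t ^ 4 / sin t * cos ((2 * N + 1) * t)) volume 0 (π / 2) :=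
    intervalIntegrable_pow_four_div_sin.mul_continuousOn (by fun_prop)
  rw [sub_eq_iff_eq_add, ← integral_finsetSum fun n _ =>
    (by fun_prop : Continuous _).intervalIntegrable _ _, ← integral_add _ hi]
  · refine integral_congr_ae (Eventually.of_forall fun t ht => ?_)
    rw [Set.uIoc_of_le (by positivity)] at ht
    have hs : 0 < sin t := sin_pos_of_pos_of_lt_pi ht.1 (by linarith [ht.2])
    rw [← Finset.mul_sum]
    have := cos_eq_sin_mul_sum_add N t
    generalize ∑ k ∈ Finset.range N, 2 * sin (2 * ((k : ℝ) + 1) * t) = S at this ⊢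
    rw [this]
    field_simp
  · exact (by fun_prop : Continuous _).intervalIntegrable _ _

theorem sum_alternating_harmonic (N : ℕ) :
    ∑ k ∈ Finset.range (2 * N), (-1 : ℝ) ^ k / (k + 1) = harmonic (2 * N) - harmonic N := by
  induction N with
  | zero => simp
  | succ N ih =>
    rw [show 2 * (N + 1) = 2 * N + 1 + 1 by ring]
    simp only [Finset.sum_range_succ, harmonic_succ, ih]
    push_cast
    rw [pow_succ, pow_mul]
    field_simp
    ring

theorem tendsto_alternating_harmonic :
    Tendsto (fun N : ℕ => ∑ k ∈ Finset.range (2 * N), (-1 : ℝ) ^ k / (k + 1)) atTop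
      (𝓝 (log 2)) := by
  have h2 : Tendsto (fun N : ℕ => 2 * N) atTop atTop :=
    tendsto_id.const_mul_atTop' (by norm_num)
  have h := ((tendsto_harmonic_sub_log.comp h2).sub tendsto_harmonic_sub_log).add_const (log 2)
  rw [sub_self, zero_add] at h
  refine h.congr' ?_
  filter_upwards [eventually_gt_atTop 0] with N hN
  have : (N : ℝ) ≠ 0 := by positivity
  rw [sum_alternating_harmonic]
  simp only [Function.comp_apply]
  push_cast
  rw [log_mul (by norm_num) this]
  ring

theorem hasSum_zeta {s : ℕ} (hs : 1 < s) :
    HasSum (fun k : ℕ => 1 / ((k : ℝ) + 1) ^ s) (∑' n : ℕ, 1 / (n : ℝ) ^ s) := by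
  have h := (Real.summable_one_div_nat_pow.2 hs).hasSum
  rw [← hasSum_nat_add_iff' 1] at h
  simpa [show s ≠ 0 by omega] using h

theorem hasSum_alternating_zeta {s : ℕ} (hs : 1 < s) :
    HasSum (fun k : ℕ => (-1 : ℝ) ^ k / ((k : ℝ) + 1) ^ s)
      ((1 - 2 / 2 ^ s) * ∑' n : ℕ, 1 / (n : ℝ) ^ s) := by
  have h := hasSum_zeta hs
  have hodd : HasSum (fun k : ℕ => (1 - (-1 : ℝ) ^ k) / ((k : ℝ) + 1) ^ s)
      (2 / 2 ^ s * ∑' n : ℕ, 1 / (n : ℝ) ^ s) := by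
    have hi : Function.Injective fun k : ℕ => 2 * k + 1 := fun a b hab => by simpa using hab
    rw [← hi.hasSum_iff]
    · convert! h.mul_left (2 / 2 ^ s) using 1
      ext k
      simp only [Function.comp_apply, pow_succ (-1 : ℝ) (2 * k), pow_mul (-1 : ℝ)]
      push_cast
      rw [show (2 * (k : ℝ) + 1 + 1) = 2 * (k + 1) by ring, mul_pow]
      field_simp
      norm_num
    · intro k hk
      have : Even k := by
        by_contra ho
        obtain ⟨m, rfl⟩ := Nat.not_even_iff_odd.1 ho
        exact hk ⟨m, rfl⟩
      simp [this.neg_one_pow]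
  convert! h.sub hodd using 1
  · ext k; ring
  · ring

theorem integral_cot_mul_pow_four :
    ∫ t in (0 : ℝ)..π / 2, cos t / sin t * t ^ 4 =
      π ^ 4 / 16 * log 2 - 9 * π ^ 2 / 16 * (∑' n : ℕ, 1 / (n : ℝ) ^ 3)
        + 93 / 32 * ∑' n : ℕ, 1 / (n : ℝ) ^ 5 := by
  have h2 : Tendsto (fun N : ℕ => 2 * N) atTop atTop :=
    tendsto_id.const_mul_atTop' (by norm_num)
  have h3 := ((hasSum_alternating_zeta (s := 3) (by norm_num)).tendsto_sum_nat.comp h2).const_mul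
    (3 * π ^ 2 / 4)
  have h5 := (((hasSum_zeta (s := 5) (by norm_num)).add
    (hasSum_alternating_zeta (s := 5) (by norm_num))).tendsto_sum_nat.comp h2).const_mul (3 / 2)
  have h := ((tendsto_alternating_harmonic.const_mul (π ^ 4 / 16)).sub h3).add h5
  refine (tendsto_nhds_unique (tendsto_sum_integral_pow_four_mul_sin.comp h2)
    (h.congr fun N => ?_)).trans ?_
  · simp only [Function.comp_apply, integral_pow_four_mul_sin, Finset.sum_add_distrib,
      Finset.sum_sub_distrib, ← Finset.mul_sum, add_div]
  · ring

/-- `∑_{n=2}^∞ (H_{n−1}^{(2)}/n³)·4ⁿ·C(2n,n)⁻¹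
= (1/12)π⁴·log 2 − (3/4)π²ζ(3) + (31/8)ζ(5)`. -/
theorem statement15 :
    ((∑' n : ℕ, (∑ k ∈ Finset.Icc 1 (n + 1), (1 : ℝ) / (k : ℝ) ^ 2) / ((n + 2 : ℕ) : ℝ) ^ 3
        * 4 ^ (n + 2) / (Nat.choose (2 * (n + 2)) (n + 2) : ℝ) : ℝ) : ℂ)
      = 1 / 12 * (Real.pi : ℂ) ^ 4 * (Real.log 2 : ℂ)
        - 3 / 4 * (Real.pi : ℂ) ^ 2 * riemannZeta 3 + 31 / 8 * riemannZeta 5 := by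
  have h := hasSum_eq_integral
  rw [← hasSum_nat_add_iff' 1] at h
  have hterm (n : ℕ) : (∑ k ∈ Finset.Icc 1 (n + 1), (1 : ℝ) / (k : ℝ) ^ 2) /
      ((n + 2 : ℕ) : ℝ) ^ 3 * 4 ^ (n + 2) / (Nat.choose (2 * (n + 2)) (n + 2) : ℝ) =
      harmonicTwo (n + 1) * invCentralBinom (n + 1 + 1) / (((n + 1 : ℕ) : ℝ) + 1) ^ 3 := by
    have hH : ∑ k ∈ Finset.Icc 1 (n + 1), (1 : ℝ) / (k : ℝ) ^ 2 = harmonicTwo (n + 1) := by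
      rw [harmonicTwo, Finset.range_eq_Ico, ← Finset.Ico_add_one_right_eq_Icc,
        Finset.sum_Ico_eq_sum_range, Finset.sum_Ico_eq_sum_range]
      refine Finset.sum_congr (by simp) fun k _ => ?_
      push_cast
      ring
    rw [hH, invCentralBinom, Nat.centralBinom_eq_two_mul_choose]
    push_cast
    ring
  simp_rw [hterm]
  rw [h.tsum_eq, integral_cot_mul_pow_four]
  have z3 := zeta_nat_eq_tsum_of_gt_one (k := 3) (by norm_num)
  have z5 := zeta_nat_eq_tsum_of_gt_one (k := 5) (by norm_num)
  push_cast at z3 z5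
  rw [z3, z5]
  simp only [Finset.sum_range_one, harmonicTwo, Finset.sum_range_zero]
  push_cast
  ring
end
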